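/- Let n ≥ 3 and 1 ≤ i ≤ n−1, and suppose Φ_i ∈ MVal_i is a continuous translation invariant SO(n)-equivariant Minkowski valuation of degree i on convex bodies in an n-dimensional Euclidean vector space that is non-trivial, i.e. Φ_i(K) ≠ {0} for some K ∈ K^n. Then there exists a constant r(Φ_i) > 0 such that W_{n−1}(Φ_i K) = r(Φ_i) · W_{n−i}(K) for every K ∈ K^n. -/

import Mathlib

open scoped Pointwise NNReal
noncomputable section

abbrev En (n : ℕ) : Type := EuclideanSpace ℝ (Fin n)
abbrev Body (n : ℕ) : Type := ConvexBody (En n)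

/-- The special orthogonal group `SO(n)`, as a subgroup of the orthogonal group. -/
def SOGroup (n : ℕ) : Subgroup (Matrix.orthogonalGroup (Fin n) ℝ) where
  carrier := {g | Matrix.det (g : Matrix (Fin n) (Fin n) ℝ) = 1}
  one_mem' := by simp
  mul_mem' := by
    intro a b ha hb
    simp only [Set.mem_setOf_eq] at *
    rw [Submonoid.coe_mul, Matrix.det_mul, ha, hb, mul_one]
  inv_mem' := by
    intro a ha
    simp only [Set.mem_setOf_eq] at *
    have h : ((a * a⁻¹ : Matrix.orthogonalGroup (Fin n) ℝ) : Matrix (Fin n) (Fin n) ℝ) = 1 := by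
      rw [mul_inv_cancel]; rfl
    rw [Submonoid.coe_mul] at h
    have h2 := congrArg Matrix.det h
    rw [Matrix.det_mul, ha, one_mul, Matrix.det_one] at h2
    exact h2

/-- The underlying matrix of an element of `O(n)`. -/
def OMat {n : ℕ} (g : Matrix.orthogonalGroup (Fin n) ℝ) : Matrix (Fin n) (Fin n) ℝ := g

/-- The underlying matrix of an element of `SO(n)`. -/
def SOMat {n : ℕ} (g : SOGroup n) : Matrix (Fin n) (Fin n) ℝ := ((g : Matrix.orthogonalGroup (Fin n) ℝ) : Matrix (Fin n) (Fin n) ℝ)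

def mapBody {n : ℕ} (A : Matrix (Fin n) (Fin n) ℝ) (K : Body n) : Body n where
  carrier := (Matrix.toEuclideanLin A) '' (K : Set (En n))
  convex' := K.convex.linear_image _
  isCompact' := K.isCompact.image (LinearMap.continuous_of_finiteDimensional _)
  nonempty' := K.nonempty.image _

/-- Rotation of a convex body by an element of `SO(n)`. -/
def rotBody {n : ℕ} (g : SOGroup n) (K : Body n) : Body n := mapBody (SOMat g) K

/-- Rotation of a convex body by an element of `O(n)`. -/
def rotBodyO {n : ℕ} (g : Matrix.orthogonalGroup (Fin n) ℝ) (K : Body n) : Body n := mapBody (OMat g) K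

/-- The natural action of `SO(n)` on complex-valued functions of convex bodies. -/
def actVal {n : ℕ} {M : Type*} (g : SOGroup n) (φ : Body n → M) : Body n → M :=
  fun K => φ (rotBody g⁻¹ K)

/-- Volume of a convex body. -/
def bvol {n : ℕ} (K : Body n) : ℝ := (MeasureTheory.volume (K : Set (En n))).toReal

/-- The mixed volume of an `n`-tuple of convex bodies, defined through the standard
polarization formula. -/
def mixedVol {n : ℕ} (K : Fin n → Body n) : ℝ :=
  (n.factorial : ℝ)⁻¹ * ∑ S : Finset (Fin n),
    if S.Nonempty then (-1 : ℝ) ^ (n - S.card) * bvol (∑ i ∈ S, K i) else 0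

/-- The Euclidean unit ball as a convex body. -/
def unitB (n : ℕ) : Body n where
  carrier := Metric.closedBall (0 : En n) 1
  convex' := convex_closedBall _ _
  isCompact' := isCompact_closedBall _ _
  nonempty' := ⟨0, Metric.mem_closedBall_self zero_le_one⟩

/-- The `j`-th quermassintegral `W_j(K)`: the mixed volume of `n - j` copies of `K` and
`j` copies of the unit ball. -/
def quer {n : ℕ} (j : ℕ) (K : Body n) : ℝ :=
  mixedVol (fun l => if (l : ℕ) < n - j then K else unitB n)

/-- The mixed quermassintegral `W_j(K, L)`: the mixed volume of `n - 1 - j` copies of `K`,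
`j` copies of the unit ball and one copy of `L`. -/
def querM {n : ℕ} (j : ℕ) (K L : Body n) : ℝ :=
  mixedVol (fun l => if (l : ℕ) < n - 1 - j then K else if (l : ℕ) < n - 1 then unitB n else L)

/-- The volume `κ_m` of the `m`-dimensional Euclidean unit ball. -/
def kappa (m : ℕ) : ℝ := (MeasureTheory.volume (Metric.closedBall (0 : En m) 1)).toReal

/-- The `i`-th intrinsic volume, normalized by `κ_{n-i} V_i(K) = (n choose i) W_{n-i}(K)`. -/
def intrVol {n : ℕ} (i : ℕ) (K : Body n) : ℝ :=
  (n.choose i : ℝ) * quer (n - i) K / kappa (n - i)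

/-- Two convex bodies are homothetic if one is a translate of a positive dilate of the other. -/
def Homothetic {n : ℕ} (K L : Body n) : Prop :=
  ∃ (t : ℝ) (x : En n), 0 < t ∧ (L : Set (En n)) = (fun y => x + t • y) '' (K : Set (En n))

/-- A convex body with nonempty interior. -/
def HasInterior {n : ℕ} (K : Body n) : Prop := (interior (K : Set (En n))).Nonempty


/-- The translate of a convex body by a vector. -/
def transBody {n : ℕ} (x : En n) (K : Body n) : Body n where
  carrier := (fun y => x + y) '' (K : Set (En n))
  convex' := K.convex.translate x
  isCompact' := K.isCompact.image (continuous_const.add continuous_id)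
  nonempty' := K.nonempty.image _

/-- The dilate of a convex body by a real factor. -/
def scaleBody {n : ℕ} (t : ℝ) (K : Body n) : Body n where
  carrier := t • (K : Set (En n))
  convex' := K.convex.smul t
  isCompact' := K.isCompact.smul t
  nonempty' := K.nonempty.smul_set

/-- `φ` is a valuation: additive on unions of convex bodies which are again convex bodies. -/
def IsValuation {n : ℕ} {M : Type*} [Add M] (φ : Body n → M) : Prop :=
  ∀ K L U I : Body n,
    (U : Set (En n)) = (K : Set (En n)) ∪ (L : Set (En n)) →
    (I : Set (En n)) = (K : Set (En n)) ∩ (L : Set (En n)) →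
    φ K + φ L = φ U + φ I

/-- `φ` is translation invariant. -/
def IsTransInv {n : ℕ} {M : Type*} (φ : Body n → M) : Prop :=
  ∀ (x : En n) (K : Body n), φ (transBody x K) = φ K

/-- `φ` (scalar- or vector-valued) is homogeneous of degree `i`. -/
def IsHomog {n : ℕ} {M : Type*} [SMul ℝ M] (i : ℕ) (φ : Body n → M) : Prop :=
  ∀ (t : ℝ), 0 < t → ∀ K : Body n, φ (scaleBody t K) = (t ^ i : ℝ) • φ K

/-- `φ` is a continuous, translation invariant valuation. -/
def IsContTIVal {n : ℕ} {M : Type*} [Add M] [TopologicalSpace M] (φ : Body n → M) : Prop :=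
  Continuous φ ∧ IsValuation φ ∧ IsTransInv φ

/-- `φ` is a bivaluation: a valuation in each of its two arguments. -/
def IsBival {n : ℕ} {M : Type*} [Add M] (φ : Body n → Body n → M) : Prop :=
  (∀ L : Body n, IsValuation (fun K => φ K L)) ∧ (∀ K : Body n, IsValuation (φ K))

/-- `φ` is invariant under independent translations of its two arguments. -/
def IsTransBiinv {n : ℕ} {M : Type*} (φ : Body n → Body n → M) : Prop :=
  ∀ (x y : En n) (K L : Body n), φ (transBody x K) (transBody y L) = φ K L

/-- `φ` has bidegree `(i, j)`. -/
def IsBihomog {n : ℕ} {M : Type*} [SMul ℝ M] (i j : ℕ) (φ : Body n → Body n → M) : Prop :=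
  ∀ (t s : ℝ), 0 < t → 0 < s → ∀ K L : Body n,
    φ (scaleBody t K) (scaleBody s L) = (t ^ i * s ^ j : ℝ) • φ K L

/-- `φ` is `O(n)` invariant. -/
def IsOBiinv {n : ℕ} {M : Type*} (φ : Body n → Body n → M) : Prop :=
  ∀ (g : Matrix.orthogonalGroup (Fin n) ℝ) (K L : Body n), φ (rotBodyO g K) (rotBodyO g L) = φ K L

/-- `φ` is `SO(n)` invariant. -/
def IsSOBiinv {n : ℕ} {M : Type*} (φ : Body n → Body n → M) : Prop :=
  ∀ (g : SOGroup n) (K L : Body n), φ (rotBody g K) (rotBody g L) = φ K L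

/-- `φ` is jointly continuous. -/
def ContinuousBi {n : ℕ} {M : Type*} [TopologicalSpace M] (φ : Body n → Body n → M) : Prop :=
  Continuous fun p : Body n × Body n => φ p.1 p.2

/-- A continuous translation invariant Minkowski valuation which is
homogeneous of degree `i`. -/
def IsMinkValHom {n : ℕ} (i : ℕ) (Φ : Body n → Body n) : Prop :=
  Continuous Φ ∧ IsValuation Φ ∧ IsTransInv Φ ∧
    ∀ (t : ℝ), 0 < t → ∀ K : Body n, Φ (scaleBody t K) = scaleBody (t ^ i) (Φ K)

/-- A Minkowski valuation is `SO(n)` equivariant. -/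
def IsSOEquivariant {n : ℕ} (Φ : Body n → Body n) : Prop :=
  ∀ (g : SOGroup n) (K : Body n), Φ (rotBody g K) = rotBody g (Φ K)

/-- A Minkowski valuation is `O(n)` equivariant. -/
def IsOEquivariant {n : ℕ} (Φ : Body n → Body n) : Prop :=
  ∀ (g : Matrix.orthogonalGroup (Fin n) ℝ) (K : Body n), Φ (rotBodyO g K) = rotBodyO g (Φ K)

set_option linter.unusedSectionVars false

namespace Hadwiger

section Basic

/-- Compact convex sets (possibly empty). -/
def CC {W : Type*} [AddCommGroup W] [Module ℝ W] [TopologicalSpace W] (s : Set W) : Prop :=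
  IsCompact s ∧ Convex ℝ s

/-- Real valued valuations on compact convex sets. -/
structure IsVal {W : Type*} [AddCommGroup W] [Module ℝ W] [TopologicalSpace W]
    (ν : Set W → ℝ) : Prop where
  empty : ν ∅ = 0
  union_add_inter : ∀ A B, CC A → CC B → Convex ℝ (A ∪ B) → ν (A ∪ B) + ν (A ∩ B) = ν A + ν B

def TransInv {W : Type*} [AddCommGroup W] [Module ℝ W] [TopologicalSpace W]
    (ν : Set W → ℝ) : Prop :=
  ∀ (x : W) (K : Set W), CC K → ν ({x} + K) = ν K

variable {W W' : Type*} [AddCommGroup W] [Module ℝ W] [TopologicalSpace W]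
  [AddCommGroup W'] [Module ℝ W'] [TopologicalSpace W']

theorem CC.add [IsTopologicalAddGroup W] {A B : Set W} (hA : CC A) (hB : CC B) : CC (A + B) :=
  ⟨hA.1.add hB.1, hA.2.add hB.2⟩

theorem CC.image {A : Set W} (hA : CC A) (f : W →L[ℝ] W') : CC (f '' A) :=
  ⟨hA.1.image f.continuous, hA.2.linear_image f.toLinearMap⟩

theorem CC.smul [ContinuousSMul ℝ W] {A : Set W} (hA : CC A) (t : ℝ) : CC (t • A) :=
  ⟨hA.1.smul t, hA.2.smul t⟩

theorem CC.inter {A B : Set W} (hA : CC A) (hB : IsClosed B) (hB' : Convex ℝ B) : CC (A ∩ B) :=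
  ⟨hA.1.inter_right hB, hA.2.inter hB'⟩

theorem CC.singleton (x : W) : CC ({x} : Set W) := ⟨isCompact_singleton, convex_singleton x⟩

theorem exists_mem_segment_inter [IsTopologicalAddGroup W] [ContinuousSMul ℝ W]
    {A B : Set W} (hA : IsClosed A) (hB : IsClosed B) (h : Convex ℝ (A ∪ B)) {a b : W}
    (ha : a ∈ A) (hb : b ∈ B) : ∃ z ∈ segment ℝ a b, z ∈ A ∩ B := by
  have hp : IsPreconnected (segment ℝ a b) := (convex_segment a b).isPreconnected
  rw [isPreconnected_closed_iff] at hp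
  obtain ⟨z, hz, hz'⟩ := hp A B hA hB (h.segment_subset (Or.inl ha) (Or.inr hb))
    ⟨a, left_mem_segment ℝ a b, ha⟩ ⟨b, right_mem_segment ℝ a b, hb⟩
  exact ⟨z, hz, hz'⟩

theorem IsVal.add_right [IsTopologicalAddGroup W] [ContinuousSMul ℝ W] [T2Space W]
    {ν : Set W → ℝ} (hν : IsVal ν) {Q : Set W} (hQ : CC Q) : IsVal (fun K => ν (K + Q)) where
  empty := by simpa using hν.empty
  union_add_inter A B hA hB h := by
    have h2 : (A ∩ B) + Q = (A + Q) ∩ (B + Q) := by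
      refine (Set.inter_add_subset).antisymm ?_
      rintro x ⟨⟨a, ha, q, hq, rfl⟩, ⟨b, hb, q', hq', hx⟩⟩
      obtain ⟨z, ⟨s, t, hs, ht, hst, rfl⟩, hz'⟩ :=
        exists_mem_segment_inter hA.1.isClosed hB.1.isClosed h ha hb
      refine ⟨_, hz', s • q + t • q', hQ.2 hq hq' hs ht hst, ?_⟩
      simp only at hx ⊢
      have : q' = a + q - b := by rw [← hx]; abel
      rw [this, show t = 1 - s by linarith]
      module
    simp only [Set.union_add, h2]
    refine hν.union_add_inter _ _ (hA.add hQ) (hB.add hQ) ?_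
    rw [← Set.union_add]
    exact h.add hQ.2

theorem IsVal.image [IsTopologicalAddGroup W] [ContinuousSMul ℝ W] [T2Space W]
    {ν : Set W' → ℝ} (hν : IsVal ν) (f : W →L[ℝ] W') : IsVal (fun K => ν (f '' K)) where
  empty := by simpa using hν.empty
  union_add_inter A B hA hB h := by
    have h2 : f '' (A ∩ B) = (f '' A) ∩ (f '' B) := by
      refine (Set.image_inter_subset f A B).antisymm ?_
      rintro x ⟨⟨a, ha, rfl⟩, ⟨b, hb, hx⟩⟩
      obtain ⟨z, ⟨s, t, hs, ht, hst, rfl⟩, hz'⟩ :=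
        exists_mem_segment_inter hA.1.isClosed hB.1.isClosed h ha hb
      refine ⟨_, hz', ?_⟩
      rw [map_add, map_smul, map_smul, hx, ← add_smul, hst, one_smul]
    simp only [Set.image_union, h2]
    refine hν.union_add_inter _ _ (hA.image f) (hB.image f) ?_
    rw [← Set.image_union]
    exact h.linear_image f.toLinearMap

theorem IsVal.inter {ν : Set W → ℝ} (hν : IsVal ν) {P : Set W} (hP : IsClosed P)
    (hP' : Convex ℝ P) : IsVal (fun K => ν (K ∩ P)) where
  empty := by simpa using hν.empty
  union_add_inter A B hA hB h := by
    rw [Set.union_inter_distrib_right, Set.inter_inter_distrib_right]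
    refine hν.union_add_inter _ _ (hA.inter hP hP') (hB.inter hP hP') ?_
    rw [← Set.union_inter_distrib_right]
    exact h.inter hP'

theorem IsVal.add {ν μ : Set W → ℝ} (hν : IsVal ν) (hμ : IsVal μ) :
    IsVal (fun K => ν K + μ K) where
  empty := by simp [hν.empty, hμ.empty]
  union_add_inter A B hA hB h := by
    linarith [hν.union_add_inter A B hA hB h, hμ.union_add_inter A B hA hB h]

theorem IsVal.const_mul {ν : Set W → ℝ} (hν : IsVal ν) (c : ℝ) : IsVal (fun K => c * ν K) where
  empty := by simp [hν.empty]
  union_add_inter A B hA hB h := by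
    linear_combination c * hν.union_add_inter A B hA hB h

theorem IsVal.zero : IsVal (fun _ : Set W => (0 : ℝ)) := ⟨rfl, fun _ _ _ _ _ => rfl⟩

theorem IsVal.sum {ι : Type*} (s : Finset ι) {ν : ι → Set W → ℝ} (hν : ∀ i ∈ s, IsVal (ν i)) :
    IsVal (fun K => ∑ i ∈ s, ν i K) := by
  classical
  induction s using Finset.induction_on with
  | empty => simpa using IsVal.zero
  | insert a s ha ih =>
    simp only [Finset.sum_insert ha]
    exact (hν a (by simp)).add (ih fun i hi => hν i (by simp [hi]))

theorem TransInv.add_right [IsTopologicalAddGroup W] {ν : Set W → ℝ} (hν : TransInv ν)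
    {Q : Set W} (hQ : CC Q) : TransInv (fun K => ν (K + Q)) := fun x K hK => by
  simp only [add_assoc]
  exact hν x _ (hK.add hQ)

theorem TransInv.image {ν : Set W' → ℝ} (hν : TransInv ν) (f : W →L[ℝ] W') :
    TransInv (fun K => ν (f '' K)) := fun x K hK => by
  simp only [Set.image_add, Set.image_singleton]
  exact hν _ _ (hK.image f)

theorem TransInv.add {ν μ : Set W → ℝ} (hν : TransInv ν) (hμ : TransInv μ) :
    TransInv (fun K => ν K + μ K) := fun x K hK => by
  simp only [hν x K hK, hμ x K hK]

theorem TransInv.const_mul {ν : Set W → ℝ} (hν : TransInv ν) (c : ℝ) :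
    TransInv (fun K => c * ν K) := fun x K hK => by
  simp only [hν x K hK]

theorem image_smul_id [ContinuousConstSMul ℝ W] (t : ℝ) (K : Set W) :
    (t • ContinuousLinearMap.id ℝ W) '' K = t • K := by
  ext; simp [Set.mem_smul_set]

theorem IsVal.smul [IsTopologicalAddGroup W] [ContinuousSMul ℝ W] [T2Space W]
    {ν : Set W → ℝ} (hν : IsVal ν) (t : ℝ) : IsVal (fun K => ν (t • K)) := by
  simpa only [image_smul_id] using hν.image (t • ContinuousLinearMap.id ℝ W)

theorem TransInv.smul [IsTopologicalAddGroup W] [ContinuousSMul ℝ W]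
    {ν : Set W → ℝ} (hν : TransInv ν) (t : ℝ) : TransInv (fun K => ν (t • K)) := by
  simpa only [image_smul_id] using hν.image (t • ContinuousLinearMap.id ℝ W)

end Basic

section HCont

/-- Continuity with respect to the Hausdorff distance. -/
def HCont {V : Type*} [NormedAddCommGroup V] [NormedSpace ℝ V] (ν : Set V → ℝ) : Prop :=
  ∀ K : Set V, CC K → K.Nonempty → ∀ ε > 0, ∃ δ > 0, ∀ L : Set V, CC L → L.Nonempty →
    K ⊆ L + Metric.closedBall 0 δ → L ⊆ K + Metric.closedBall 0 δ → |ν L - ν K| < ε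

variable {V V' : Type*} [NormedAddCommGroup V] [NormedSpace ℝ V]
  [NormedAddCommGroup V'] [NormedSpace ℝ V']

theorem HCont.add_right {ν : Set V → ℝ} (hν : HCont ν) {Q : Set V} (hQ : CC Q)
    (hQ' : Q.Nonempty) : HCont (fun K => ν (K + Q)) := fun K hK hK' ε hε => by
  obtain ⟨δ, hδ, h⟩ := hν (K + Q) (hK.add hQ) (hK'.add hQ') ε hε
  refine ⟨δ, hδ, fun L hL hL' h1 h2 => h _ (hL.add hQ) (hL'.add hQ') ?_ ?_⟩
  · rw [add_right_comm]; exact Set.add_subset_add_right h1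
  · rw [add_right_comm]; exact Set.add_subset_add_right h2

theorem HCont.image {ν : Set V' → ℝ} (hν : HCont ν) (f : V →L[ℝ] V') :
    HCont (fun K => ν (f '' K)) := fun K hK hK' ε hε => by
  obtain ⟨δ, hδ, h⟩ := hν (f '' K) (hK.image f) (hK'.image f) ε hε
  have hpos : 0 < ‖f‖ + 1 := by positivity
  have key : ∀ A B : Set V, A ⊆ B + Metric.closedBall 0 (δ / (‖f‖ + 1)) →
      f '' A ⊆ f '' B + Metric.closedBall 0 δ := by
    intro A B hAB
    rintro _ ⟨a, ha, rfl⟩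
    obtain ⟨b, hb, y, hy, rfl⟩ := hAB ha
    refine ⟨f b, ⟨b, hb, rfl⟩, f y, ?_, (map_add f b y).symm⟩
    rw [mem_closedBall_zero_iff] at hy ⊢
    calc ‖f y‖ ≤ ‖f‖ * ‖y‖ := f.le_opNorm y
      _ ≤ (‖f‖ + 1) * (δ / (‖f‖ + 1)) := by gcongr; linarith
      _ = δ := by field_simp
  exact ⟨δ / (‖f‖ + 1), by positivity, fun L hL hL' h1 h2 =>
    h _ (hL.image f) (hL'.image f) (key _ _ h1) (key _ _ h2)⟩

theorem HCont.smul {ν : Set V → ℝ} (hν : HCont ν) (t : ℝ) : HCont (fun K => ν (t • K)) := by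
  simpa only [image_smul_id] using hν.image (t • ContinuousLinearMap.id ℝ V)

theorem HCont.add {ν μ : Set V → ℝ} (hν : HCont ν) (hμ : HCont μ) :
    HCont (fun K => ν K + μ K) := fun K hK hK' ε hε => by
  obtain ⟨δ, hδ, h⟩ := hν K hK hK' (ε / 2) (by positivity)
  obtain ⟨δ', hδ', h'⟩ := hμ K hK hK' (ε / 2) (by positivity)
  refine ⟨min δ δ', by positivity, fun L hL hL' h1 h2 => ?_⟩
  have m1 : Metric.closedBall (0 : V) (min δ δ') ⊆ Metric.closedBall 0 δ :=
    Metric.closedBall_subset_closedBall (min_le_left _ _)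
  have m2 : Metric.closedBall (0 : V) (min δ δ') ⊆ Metric.closedBall 0 δ' :=
    Metric.closedBall_subset_closedBall (min_le_right _ _)
  have a1 := h L hL hL' (h1.trans (Set.add_subset_add_left m1))
    (h2.trans (Set.add_subset_add_left m1))
  have a2 := h' L hL hL' (h1.trans (Set.add_subset_add_left m2))
    (h2.trans (Set.add_subset_add_left m2))
  rw [abs_lt] at *
  constructor <;> linarith

theorem HCont.zero : HCont (fun _ : Set V => (0 : ℝ)) := fun _ _ _ ε hε =>
  ⟨1, one_pos, fun _ _ _ _ _ => by simpa using hε⟩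

theorem HCont.const_mul {ν : Set V → ℝ} (hν : HCont ν) (c : ℝ) :
    HCont (fun K => c * ν K) := fun K hK hK' ε hε => by
  obtain ⟨δ, hδ, h⟩ := hν K hK hK' (ε / (|c| + 1)) (by positivity)
  refine ⟨δ, hδ, fun L hL hL' h1 h2 => ?_⟩
  have h3 := h L hL hL' h1 h2
  rw [← mul_sub, abs_mul]
  calc |c| * |ν L - ν K| ≤ |c| * (ε / (|c| + 1)) := by gcongr
    _ < (|c| + 1) * (ε / (|c| + 1)) := by gcongr; linarith
    _ = ε := by field_simp

theorem HCont.sum {ι : Type*} (s : Finset ι) {ν : ι → Set V → ℝ} (hν : ∀ i ∈ s, HCont (ν i)) :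
    HCont (fun K => ∑ i ∈ s, ν i K) := by
  classical
  induction s using Finset.induction_on with
  | empty => simpa using HCont.zero
  | insert a s ha ih =>
    simp only [Finset.sum_insert ha]
    exact (hν a (by simp)).add (ih fun i hi => hν i (by simp [hi]))

/-- A Hausdorff continuous functional that vanishes on suitable arbitrarily close approximants of
`K` vanishes on `K`. -/
theorem HCont.eq_zero {ν : Set V → ℝ} (hν : HCont ν) {K : Set V} (hK : CC K) (hK' : K.Nonempty)
    (h : ∀ δ > 0, ∃ L, CC L ∧ L.Nonempty ∧ K ⊆ L + Metric.closedBall 0 δ ∧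
      L ⊆ K + Metric.closedBall 0 δ ∧ ν L = 0) : ν K = 0 := by
  by_contra h0
  obtain ⟨δ, hδ, h'⟩ := hν K hK hK' |ν K| (abs_pos.2 h0)
  obtain ⟨L, hL, hL', h1, h2, h3⟩ := h δ hδ
  have := h' L hL hL' h1 h2
  simp [h3] at this

end HCont

section Simplex

variable {M : Type*} [AddCommGroup M] [Module ℝ M] {ι : Type}

theorem sum_eq_pair_add [Fintype ι] [DecidableEq ι] {N : Type*} [AddCommMonoid N] {a b : ι}
    (hab : a ≠ b) (f : ι → N) :
    ∑ i, f i = f a + (f b + ∑ i ∈ (Finset.univ.erase a).erase b, f i) := by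
  rw [Finset.add_sum_erase _ f (by simp [hab.symm]), Finset.add_sum_erase _ f (by simp)]

theorem sum_smul_update_pair [Fintype ι] [DecidableEq ι] {a b : ι} (hab : a ≠ b) (u : ι → M)
    (c : ι → ℝ) (p q : ℝ) :
    ∑ i, c i • Function.update u a (p • u a + q • u b) i =
      ∑ i, Function.update (Function.update c a (c a * p)) b (c b + c a * q) i • u i := by
  rw [sum_eq_pair_add hab, sum_eq_pair_add hab]
  have : ∑ i ∈ (Finset.univ.erase a).erase b, c i • Function.update u a (p • u a + q • u b) i =
      ∑ i ∈ (Finset.univ.erase a).erase b,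
        Function.update (Function.update c a (c a * p)) b (c b + c a * q) i • u i := by
    refine Finset.sum_congr rfl fun i hi => ?_
    simp only [Finset.mem_erase, Finset.mem_univ, and_true] at hi
    simp [Function.update_of_ne hi.1, Function.update_of_ne hi.2]
  rw [this]
  simp only [Function.update_self, Function.update_of_ne hab, Function.update_of_ne hab.symm]
  module

variable {V : Type*} [AddCommGroup V] [Module ℝ V]

/-- Homogeneous coordinates. -/
def lift (x : V) : V × ℝ := (x, 1)

theorem lift_comb (x y : V) (t : ℝ) :
    lift ((1 - t) • x + t • y) = (1 - t) • lift x + t • lift y := by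
  simp [lift]

/-- Affine independence, expressed in homogeneous coordinates. -/
def Ind {κ : Type} (v : κ → V) : Prop := LinearIndependent ℝ (fun i => lift (v i))

theorem mem_hull [Fintype ι] {v : ι → V} {x : V} : x ∈ convexHull ℝ (Set.range v) ↔
    ∃ c : ι → ℝ, (∀ i, 0 ≤ c i) ∧ ∑ i, c i • lift (v i) = lift x := by
  classical
  have h := (Fintype.linearCombination ℝ v).image_convexHull
    (Set.range fun i : ι ↦ (Pi.single i 1 : ι → ℝ))
  rw [convexHull_rangle_single_eq_stdSimplex, ← Set.range_comp] at h
  have h2 : (Fintype.linearCombination ℝ v) ∘ (fun i : ι ↦ (Pi.single i 1 : ι → ℝ)) = v := by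
    ext i; simp [Fintype.linearCombination_apply_single]
  rw [h2] at h
  rw [← h]
  simp only [Set.mem_image, stdSimplex, Set.mem_ofPred_eq, Fintype.linearCombination_apply]
  refine exists_congr fun c => ?_
  rw [and_assoc]
  refine and_congr_right fun _ => ?_
  simp only [lift, Prod.ext_iff, Prod.fst_sum, Prod.snd_sum, Prod.smul_fst, Prod.smul_snd,
    smul_eq_mul, mul_one]
  tauto

theorem mem_hull_subtype [Fintype ι] {v : ι → V} {x : V} (p : ι → Prop) [DecidablePred p]
    {c : ι → ℝ}
    (hc : ∀ i, 0 ≤ c i) (hx : ∑ i, c i • lift (v i) = lift x) (h0 : ∀ i, ¬ p i → c i = 0) :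
    x ∈ convexHull ℝ (Set.range fun i : {i // p i} => v i) := by
  refine mem_hull.2 ⟨fun i => c i, fun i => hc i, ?_⟩
  rw [← hx, ← Finset.sum_subtype (Finset.univ.filter p) (by simp) (fun i => c i • lift (v i)),
    Finset.sum_filter]
  refine Finset.sum_congr rfl fun i _ => ?_
  split_ifs with h
  · rfl
  · simp [h0 i h]

theorem lift_update [DecidableEq ι] (v : ι → V) (a : ι) (w : V) :
    (fun i => lift (Function.update v a w i)) = Function.update (fun i => lift (v i)) a (lift w) := by
  ext1 i
  by_cases h : i = a
  · subst h; simp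
  · simp [h]

theorem hull_comb_update [Fintype ι] [DecidableEq ι] {v : ι → V} {a b : ι} (hab : a ≠ b) (t : ℝ)
    (c : ι → ℝ) :
    ∑ i, c i • lift (Function.update v a ((1 - t) • v a + t • v b) i) =
      ∑ i, Function.update (Function.update c a (c a * (1 - t))) b (c b + c a * t) i • lift (v i) := by
  rw [← sum_smul_update_pair hab (fun i => lift (v i)) c, ← lift_comb, ← lift_update]

theorem hull_update_subset [Fintype ι] [DecidableEq ι] {v : ι → V} {a b : ι} (hab : a ≠ b) {t : ℝ}
    (h0 : 0 ≤ t) (h1 : t ≤ 1) :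
    convexHull ℝ (Set.range (Function.update v a ((1 - t) • v a + t • v b))) ⊆
      convexHull ℝ (Set.range v) := by
  refine convexHull_min ?_ (convex_convexHull _ _)
  rintro _ ⟨i, rfl⟩
  by_cases h : i = a
  · subst h
    rw [Function.update_self]
    exact convex_convexHull ℝ _ (subset_convexHull _ _ (Set.mem_range_self i))
      (subset_convexHull _ _ (Set.mem_range_self b))
      (by linarith) h0 (by ring)
  · rw [Function.update_of_ne h]
    exact subset_convexHull _ _ ⟨i, rfl⟩

theorem hull_split_aux [Fintype ι] [DecidableEq ι] {v : ι → V} {a b : ι} (hab : a ≠ b) {t : ℝ}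
    (h1 : t < 1)
    {c : ι → ℝ} (hc : ∀ i, 0 ≤ c i) {x : V} (hx : ∑ i, c i • lift (v i) = lift x)
    (h : c a * t ≤ c b * (1 - t)) :
    x ∈ convexHull ℝ (Set.range (Function.update v a ((1 - t) • v a + t • v b))) := by
  have ht : 0 < 1 - t := by linarith
  refine mem_hull.2 ⟨Function.update (Function.update c a (c a / (1 - t))) b
    (c b - c a / (1 - t) * t), fun i => ?_, ?_⟩
  · rcases eq_or_ne i b with rfl | hb
    · simp only [Function.update_self]
      rw [sub_nonneg, div_mul_eq_mul_div, div_le_iff₀ ht]; exact h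
    rw [Function.update_of_ne hb]
    rcases eq_or_ne i a with rfl | ha
    · simp only [Function.update_self]; exact div_nonneg (hc i) ht.le
    · rw [Function.update_of_ne ha]; exact hc i
  · rw [hull_comb_update hab, ← hx]
    refine Finset.sum_congr rfl fun i _ => ?_
    congr 1
    rcases eq_or_ne i b with rfl | hb
    · simp [hab]
    rcases eq_or_ne i a with rfl | ha
    · simp [hab]; field_simp
    · simp [ha, hb]

theorem hull_split [Fintype ι] [DecidableEq ι] {v : ι → V} {a b : ι} (hab : a ≠ b) {t : ℝ}
    (h0 : 0 < t) (h1 : t < 1) :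
    convexHull ℝ (Set.range v) =
      convexHull ℝ (Set.range (Function.update v a ((1 - t) • v a + t • v b))) ∪
      convexHull ℝ (Set.range (Function.update v b ((1 - t) • v a + t • v b))) := by
  have e : (1 - t) • v a + t • v b = (1 - (1 - t)) • v b + (1 - t) • v a := by module
  apply Set.Subset.antisymm
  · intro x hx
    obtain ⟨c, hc, hx⟩ := mem_hull.1 hx
    rcases le_total (c a * t) (c b * (1 - t)) with h | h
    · exact Or.inl (hull_split_aux hab h1 hc hx h)
    · right
      rw [e]
      exact hull_split_aux hab.symm (by linarith) hc hx (by linarith)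
  · refine Set.union_subset (hull_update_subset hab h0.le h1.le) ?_
    rw [e]
    exact hull_update_subset hab.symm (by linarith) (by linarith)

theorem hull_inter [Fintype ι] [DecidableEq ι] {v : ι → V} (hv : Ind v) {a b : ι} (hab : a ≠ b)
    {t : ℝ} (h0 : 0 < t)
    (h1 : t < 1) :
    convexHull ℝ (Set.range (Function.update v a ((1 - t) • v a + t • v b))) ∩
      convexHull ℝ (Set.range (Function.update v b ((1 - t) • v a + t • v b))) =
    convexHull ℝ (Set.range
      fun i : {i // i ≠ b} => Function.update v a ((1 - t) • v a + t • v b) i) := by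
  have e : (1 - t) • v a + t • v b = (1 - (1 - t)) • v b + (1 - t) • v a := by module
  apply Set.Subset.antisymm
  · rintro x ⟨hx, hx'⟩
    obtain ⟨c, hc, hx⟩ := mem_hull.1 hx
    obtain ⟨d, hd, hx'⟩ := mem_hull.1 hx'
    refine mem_hull_subtype (fun i => i ≠ b) hc hx fun i hi => ?_
    obtain rfl : i = b := not_not.1 hi
    rw [hull_comb_update hab] at hx
    rw [e, hull_comb_update hab.symm] at hx'
    have h := sub_eq_zero.2 (hx.trans hx'.symm)
    rw [← Finset.sum_sub_distrib] at h
    simp only [← sub_smul] at h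
    have key := Fintype.linearIndependent_iff.1 hv _ h
    have ka := key a
    have kb := key i
    simp [hab, hab.symm] at ka kb
    have := hd a
    have := hc i
    have := hd i
    have := hc a
    nlinarith
  · refine Set.subset_inter (convexHull_mono ?_) (convexHull_mono ?_)
    · rintro _ ⟨i, rfl⟩; exact ⟨i, rfl⟩
    · rintro _ ⟨⟨i, hi⟩, rfl⟩
      rcases eq_or_ne i a with rfl | ha
      · exact ⟨b, by simp⟩
      · exact ⟨i, by simp [ha, hi]⟩

theorem Ind.update [DecidableEq ι] {v : ι → V} (hv : Ind v) {a b : ι} (hab : a ≠ b) {t : ℝ}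
    (h1 : t ≠ 1) :
    Ind (Function.update v a ((1 - t) • v a + t • v b)) := by
  unfold Ind
  rw [lift_update, lift_comb]
  refine LinearIndependent.update hv a _ ⟨1, one_mem _,
    Finsupp.single a (1 - t) + Finsupp.single b t, ?_, ?_⟩
  · simp [hab.symm, sub_eq_zero, h1.symm]
  · simp only [one_smul, map_add, Finsupp.linearCombination_single]

theorem Ind.sub {κ : Type} {v : ι → V} (hv : Ind v) {f : κ → ι} (hf : Function.Injective f) :
    Ind (fun i => v (f i)) :=
  LinearIndependent.comp hv f hf

end Simplex

section Vanish

variable {V : Type*} [NormedAddCommGroup V] [NormedSpace ℝ V]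

theorem CC.hull {ι : Type*} [Finite ι] (v : ι → V) : CC (convexHull ℝ (Set.range v)) :=
  ⟨(Set.finite_range v).isCompact_convexHull ℝ, convex_convexHull _ _⟩

/-- A valuation vanishing on all simplices vanishes on simplices cut by a half-space. -/
theorem IsVal.simplex_inter_halfspace {ν : Set V → ℝ} (hν : IsVal ν)
    (h : ∀ (ι : Type) [Fintype ι] (v : ι → V), Ind v → ν (convexHull ℝ (Set.range v)) = 0)
    (f : V →L[ℝ] ℝ) (c : ℝ) (ι : Type) [Fintype ι] (v : ι → V) (hv : Ind v) :
    ν (convexHull ℝ (Set.range v) ∩ {x | c ≤ f x}) = 0 := by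
  classical
  have hcl : IsClosed {x | c ≤ f x} := isClosed_le continuous_const f.continuous
  have hcv : Convex ℝ {x | c ≤ f x} := convex_halfSpace_ge f.toLinearMap.isLinear c
  have hν' := hν.inter hcl hcv
  induction hN : (Finset.univ.filter fun i => f (v i) ≠ c).card using Nat.strong_induction_on
    generalizing ι with
  | _ N ih =>
  by_cases hex : ∃ a b, c < f (v a) ∧ f (v b) < c
  · obtain ⟨a, b, ha, hb⟩ := hex
    have hab : a ≠ b := by rintro rfl; linarith
    set t : ℝ := (f (v a) - c) / (f (v a) - f (v b)) with ht
    have hd : 0 < f (v a) - f (v b) := by linarith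
    have h0 : 0 < t := by rw [ht]; apply div_pos <;> linarith
    have h1 : t < 1 := by rw [ht, div_lt_one hd]; linarith
    have hw : f ((1 - t) • v a + t • v b) = c := by
      rw [map_add, map_smul, map_smul, smul_eq_mul, smul_eq_mul, ht]
      field_simp
      ring
    have e : (1 - t) • v a + t • v b = (1 - (1 - t)) • v b + (1 - t) • v a := by module
    set w := (1 - t) • v a + t • v b with hwdef
    have key := hν'.union_add_inter _ _ (CC.hull (Function.update v a w))
      (CC.hull (Function.update v b w)) (by
        rw [← hull_split hab h0 h1]; exact convex_convexHull _ _)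
    rw [← hull_split hab h0 h1, hull_inter hv hab h0 h1] at key
    have i1 : Ind (Function.update v a w) := hv.update hab h1.ne
    have i2 : Ind (Function.update v b w) := by
      rw [e]; exact hv.update hab.symm (by linarith)
    have lt : ∀ d, f (v d) ≠ c → (Finset.univ.filter fun i => f (Function.update v d w i) ≠ c) ⊂
        (Finset.univ.filter fun i => f (v i) ≠ c) := by
      intro d hd
      refine Finset.ssubset_iff_of_subset (fun i => ?_) |>.2 ⟨d, by simp [hd], by simp [hw]⟩
      rcases eq_or_ne i d with rfl | hi
      · simp [hw]
      · simp [hi]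
    have l1 := Finset.card_lt_card (lt a ha.ne')
    have l2 := Finset.card_lt_card (lt b hb.ne)
    have z1 := ih _ (hN ▸ l1) ι _ i1 rfl
    have z2 := ih _ (hN ▸ l2) ι _ i2 rfl
    have z3 := ih _ (lt_of_le_of_lt ?_ (hN ▸ l1)) {i // i ≠ b} _
      (i1.sub (f := fun i : {i // i ≠ b} => (i : ι)) Subtype.val_injective) rfl
    · linarith
    · refine Finset.card_le_card_of_injOn (fun i => (i : ι)) ?_ Subtype.val_injective.injOn
      intro i hi
      simpa using hi
  · push Not at hex
    by_cases hall : ∀ i, c ≤ f (v i)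
    · rw [Set.inter_eq_left.2]
      · exact h ι v hv
      · refine convexHull_min ?_ hcv
        rintro _ ⟨i, rfl⟩; exact hall i
    · push Not at hall
      obtain ⟨b, hb⟩ := hall
      have hle : ∀ i, f (v i) ≤ c := fun i => by
        by_contra hi
        exact absurd (hex i b (not_le.1 hi)) (not_le.2 hb)
      have : convexHull ℝ (Set.range v) ∩ {x | c ≤ f x} =
          convexHull ℝ (Set.range fun i : {i // f (v i) = c} => v i) := by
        apply Set.Subset.antisymm
        · rintro x ⟨hx, hx'⟩
          obtain ⟨d, hd, hx⟩ := mem_hull.1 hx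
          refine mem_hull_subtype (fun i => f (v i) = c) hd hx fun i hi => ?_
          have h3 := congrArg Prod.snd hx
          have h4 := congrArg (fun z : V × ℝ => f z.1) hx
          simp [lift, Prod.fst_sum, Prod.snd_sum] at h3 h4
          have h5 : ∑ i, d i * (c - f (v i)) ≤ 0 := by
            simp only [mul_sub, Finset.sum_sub_distrib, ← Finset.sum_mul]
            rw [h3, h4]
            have : c ≤ f x := hx'
            linarith
          have h6 : ∀ i ∈ Finset.univ, 0 ≤ d i * (c - f (v i)) := fun i _ =>
            mul_nonneg (hd i) (by linarith [hle i])
          have h7 := (Finset.sum_eq_zero_iff_of_nonneg h6).1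
            (le_antisymm h5 (Finset.sum_nonneg h6)) i (by simp)
          rcases mul_eq_zero.1 h7 with h8 | h8
          · exact h8
          · exact absurd (by linarith) hi
        · refine Set.subset_inter (convexHull_mono ?_) (convexHull_min ?_ hcv)
          · rintro _ ⟨i, rfl⟩; exact ⟨i, rfl⟩
          · rintro _ ⟨i, rfl⟩; exact i.2.ge
      rw [this]
      exact h _ _ (hv.sub (f := fun i : {i // f (v i) = c} => (i : ι)) Subtype.val_injective)

/-- Polyhedra given by a list of half-spaces. -/
def poly (l : List ((V →L[ℝ] ℝ) × ℝ)) : Set V := {x | ∀ p ∈ l, p.2 ≤ p.1 x}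

theorem isClosed_poly (l : List ((V →L[ℝ] ℝ) × ℝ)) : IsClosed (poly l) := by
  have : poly l = ⋂ p ∈ l, {x | p.2 ≤ p.1 x} := by ext; simp [poly]
  rw [this]
  exact isClosed_biInter fun p _ => isClosed_le continuous_const p.1.continuous

theorem convex_poly (l : List ((V →L[ℝ] ℝ) × ℝ)) : Convex ℝ (poly l) := by
  have : poly l = ⋂ p ∈ l, {x | p.2 ≤ p.1 x} := by ext; simp [poly]
  rw [this]
  exact convex_iInter₂ fun p _ => convex_halfSpace_ge p.1.toLinearMap.isLinear p.2

theorem IsVal.simplex_inter_poly {ν : Set V → ℝ} (hν : IsVal ν)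
    (h : ∀ (ι : Type) [Fintype ι] (v : ι → V), Ind v → ν (convexHull ℝ (Set.range v)) = 0)
    (l : List ((V →L[ℝ] ℝ) × ℝ)) (ι : Type) [Fintype ι] (v : ι → V) (hv : Ind v) :
    ν (convexHull ℝ (Set.range v) ∩ poly l) = 0 := by
  induction l generalizing ν with
  | nil => simpa [poly] using h ι v hv
  | cons p l ih =>
    have hcl : IsClosed {x | p.2 ≤ p.1 x} := isClosed_le continuous_const p.1.continuous
    have hcv : Convex ℝ {x | p.2 ≤ p.1 x} := convex_halfSpace_ge p.1.toLinearMap.isLinear p.2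
    have := ih (hν.inter hcl hcv) (fun ι _ v hv => hν.simplex_inter_halfspace h p.1 p.2 ι v hv)
    have e : poly (p :: l) = poly l ∩ {x | p.2 ≤ p.1 x} := by
      ext x; simp [poly, and_comm]
    rw [e, ← Set.inter_assoc]
    exact this

variable [FiniteDimensional ℝ V]

theorem exists_simplex_superset {K : Set V} (hK : IsCompact K) :
    ∃ v : Fin (Module.finrank ℝ V + 1) → V, Ind v ∧ K ⊆ convexHull ℝ (Set.range v) := by
  obtain ⟨b, hb, -⟩ := exists_mem_interior_convexHull_affineBasis (s := Set.univ) (x := (0 : V))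
    Filter.univ_mem
  obtain ⟨r, hr, hball⟩ := Metric.mem_nhds_iff.1 (mem_interior_iff_mem_nhds.1 hb)
  obtain ⟨R, hR⟩ := hK.isBounded.subset_ball 0
  set s : ℝ := (|R| + 1) / r with hs
  have hs0 : 0 < s := by positivity
  refine ⟨fun i => s • b i, ?_, ?_⟩
  · unfold Ind
    rw [Fintype.linearIndependent_iff]
    intro g hg i
    have h3 := congrArg Prod.snd hg
    have h4 := congrArg Prod.fst hg
    simp only [lift, Prod.fst_sum, Prod.snd_sum, Prod.smul_fst, Prod.smul_snd, smul_eq_mul,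
      mul_one, Prod.fst_zero, Prod.snd_zero] at h3 h4
    refine affineIndependent_iff.1 b.ind Finset.univ g h3 ?_ i (by simp)
    simp only [smul_comm _ s, ← Finset.smul_sum] at h4
    exact (smul_eq_zero.1 h4).resolve_left hs0.ne'
  · have : Set.range (fun i => s • b i) = s • Set.range b := by
      ext; simp [Set.mem_smul_set]
    rw [this, convexHull_smul]
    intro x hx
    have hx' := hR hx
    rw [mem_ball_zero_iff] at hx'
    refine ⟨s⁻¹ • x, hball ?_, by simp [smul_smul, hs0.ne']⟩
    rw [mem_ball_zero_iff, norm_smul, norm_inv, Real.norm_of_nonneg hs0.le, hs, inv_div,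
      div_mul_eq_mul_div, div_lt_iff₀ (by positivity)]
    gcongr
    linarith [le_abs_self R]

/-- A continuous valuation vanishing on all simplices is zero. -/
theorem IsVal.eq_zero_of_simplex {ν : Set V → ℝ} (hν : IsVal ν) (hc : HCont ν)
    (h : ∀ (ι : Type) [Fintype ι] (v : ι → V), Ind v → ν (convexHull ℝ (Set.range v)) = 0)
    {K : Set V} (hK : CC K) : ν K = 0 := by
  rcases K.eq_empty_or_nonempty with rfl | hne
  · exact hν.empty
  refine hc.eq_zero hK hne fun δ hδ => ?_
  obtain ⟨v, hv, hKv⟩ := exists_simplex_superset hK.1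
  set T := convexHull ℝ (Set.range v) with hT
  have hTc : IsCompact T := (CC.hull v).1
  set U : Set V := K + Metric.ball 0 δ with hU
  have hUo : IsOpen U := Metric.isOpen_ball.add_left
  have hKU : K ⊆ U := fun x hx => ⟨x, hx, 0, by simpa using hδ, by simp⟩
  have hsep : ∀ x ∈ T \ U, ∃ p : (V →L[ℝ] ℝ) × ℝ, p.1 x < p.2 ∧ ∀ y ∈ K, p.2 ≤ p.1 y := by
    intro x hx
    obtain ⟨f, u, h1, h2⟩ := geometric_hahn_banach_point_closed hK.2 hK.1.isClosed
      (fun hxK => hx.2 (hKU hxK))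
    exact ⟨(f, u), h1, fun y hy => (h2 y hy).le⟩
  choose! p hp1 hp2 using hsep
  obtain ⟨t, ht1, ht2⟩ := (hTc.diff hUo).elim_nhds_subcover (fun x => {y | (p x).1 y < (p x).2})
    (fun x hx => (isOpen_lt (p x).1.continuous continuous_const).mem_nhds (hp1 x hx))
  set P := poly (t.toList.map p) with hP
  have hKP : K ⊆ T ∩ P := by
    refine Set.subset_inter hKv fun y hy => ?_
    intro q hq
    simp only [List.mem_map, Finset.mem_toList] at hq
    obtain ⟨x, hx, rfl⟩ := hq
    exact hp2 x (ht1 x hx) y hy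
  have hPU : T ∩ P ⊆ U := by
    rintro y ⟨hy, hyP⟩
    by_contra hyU
    obtain ⟨x, hx, hxy⟩ := Set.mem_iUnion₂.1 (ht2 ⟨hy, hyU⟩)
    have : (p x).2 ≤ (p x).1 y := hyP (p x) (by simp; exact ⟨x, hx, rfl⟩)
    exact absurd hxy (not_lt.2 this)
  refine ⟨T ∩ P, (CC.hull v).inter (isClosed_poly _) (convex_poly _), hne.mono hKP, ?_, ?_, ?_⟩
  · intro x hx
    exact ⟨x, hKP hx, 0, by simpa using hδ.le, by simp⟩
  · exact hPU.trans (Set.add_subset_add_left Metric.ball_subset_closedBall)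
  · exact hν.simplex_inter_poly h _ _ v hv

end Vanish

section Monotone

/-- Antitone sequences with values in `[0, a]` supported on `[j, l)`. -/
def M (j l : ℕ) (a : ℝ) : Set (ℕ → ℝ) :=
  {x | (∀ i, i < j → x i = 0) ∧ (∀ i, l ≤ i → x i = 0) ∧
    (∀ i i', j ≤ i → i ≤ i' → i' < l → x i' ≤ x i) ∧ ∀ i, 0 ≤ x i ∧ x i ≤ a}

/-- The constant sequence `a` on `[j, l)`. -/
def blk (j l : ℕ) (a : ℝ) : ℕ → ℝ := fun i => if j ≤ i ∧ i < l then a else 0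

theorem CC.M (j l : ℕ) (a : ℝ) : CC (M j l a) := by
  constructor
  · refine (isCompact_univ_pi fun _ : ℕ => isCompact_Icc (a := (0 : ℝ)) (b := a)).of_isClosed_subset
      ?_ fun x hx i _ => hx.2.2.2 i
    simp only [Hadwiger.M, Set.ofPred_and, Set.ofPred_forall]
    refine .inter ?_ (.inter ?_ (.inter ?_ ?_))
    · exact isClosed_iInter fun i => isClosed_iInter fun _ =>
        isClosed_eq (continuous_apply i) continuous_const
    · exact isClosed_iInter fun i => isClosed_iInter fun _ =>
        isClosed_eq (continuous_apply i) continuous_const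
    · exact isClosed_iInter fun i => isClosed_iInter fun i' => isClosed_iInter fun _ =>
        isClosed_iInter fun _ => isClosed_iInter fun _ =>
        isClosed_le (continuous_apply i') (continuous_apply i)
    · exact isClosed_iInter fun i => .inter (isClosed_le continuous_const (continuous_apply i))
        (isClosed_le (continuous_apply i) continuous_const)
  · rintro x ⟨hx1, hx2, hx3, hx4⟩ y ⟨hy1, hy2, hy3, hy4⟩ s t hs ht hst
    refine ⟨fun i hi => by simp [hx1 i hi, hy1 i hi], fun i hi => by simp [hx2 i hi, hy2 i hi],
      fun i i' h1 h2 h3 => ?_, fun i => ⟨?_, ?_⟩⟩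
    · simp only [Pi.add_apply, Pi.smul_apply, smul_eq_mul]
      have := hx3 i i' h1 h2 h3
      have := hy3 i i' h1 h2 h3
      gcongr
    · have := (hx4 i).1
      have := (hy4 i).1
      simp only [Pi.add_apply, Pi.smul_apply, smul_eq_mul]
      positivity
    · simp only [Pi.add_apply, Pi.smul_apply, smul_eq_mul]
      calc s * x i + t * y i ≤ s * a + t * a := by
            have := (hx4 i).2
            have := (hy4 i).2
            gcongr
        _ = a := by rw [← add_mul, hst, one_mul]

theorem M_self (j : ℕ) {a : ℝ} (ha : 0 ≤ a) : M j j a = {0} := by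
  ext x
  constructor
  · rintro ⟨h1, h2, -, -⟩
    ext i
    rcases lt_or_ge i j with h | h
    · exact h1 i h
    · exact h2 i h
  · rintro rfl
    exact ⟨by simp, by simp, by simp, by simp [ha]⟩

theorem M_zero (j l : ℕ) : M j l 0 = {0} := by
  ext x
  constructor
  · rintro ⟨-, -, -, h⟩
    ext i
    exact le_antisymm (h i).2 (h i).1
  · rintro rfl
    exact ⟨by simp, by simp, by simp, by simp⟩

theorem smul_M (j l : ℕ) {a : ℝ} (ha : 0 ≤ a) : a • M j l 1 = M j l a := by
  rcases ha.eq_or_lt with rfl | ha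
  · rw [M_zero, Set.zero_smul_set]
    · rfl
    · exact ⟨0, by simp, by simp, by simp, by simp⟩
  · ext x
    rw [Set.mem_smul_set_iff_inv_smul_mem₀ ha.ne']
    have h1 : ∀ y, a⁻¹ * y ≤ 1 ↔ y ≤ a := fun y => by
      rw [inv_mul_le_iff₀ ha, mul_one]
    have h2 : ∀ y z, a⁻¹ * y ≤ a⁻¹ * z ↔ y ≤ z := fun y z =>
      mul_le_mul_iff_of_pos_left (inv_pos.2 ha)
    have h3 : ∀ y, 0 ≤ a⁻¹ * y ↔ 0 ≤ y := fun y =>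
      mul_nonneg_iff_of_pos_left (inv_pos.2 ha)
    simp [M, ha.ne', h1, h2, h3]

/-- The part of `M j m (k+1)` where the coordinates before `l` are at least `k`. -/
def A (j m l : ℕ) (k : ℝ) : Set (ℕ → ℝ) := {x ∈ M j m (k + 1) | ∀ i, j ≤ i → i < l → k ≤ x i}

theorem A_eq (j m : ℕ) (k : ℝ) : A j m j k = M j m (k + 1) := by
  ext x; simp only [A, Set.mem_ofPred_eq]
  exact ⟨fun h => h.1, fun h => ⟨h, fun i h1 h2 => absurd h2 (not_lt.2 h1)⟩⟩

theorem mem_blk_add_iff {x b : ℕ → ℝ} {P Q : Set (ℕ → ℝ)} :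
    x ∈ {b} + (P + Q) ↔ ∃ y ∈ P, ∃ z ∈ Q, ∀ i, b i + (y i + z i) = x i := by
  simp only [Set.mem_add, Set.mem_singleton_iff, exists_eq_left]
  constructor
  · rintro ⟨_, ⟨y, hy, z, hz, rfl⟩, rfl⟩; exact ⟨y, hy, z, hz, fun i => rfl⟩
  · rintro ⟨y, hy, z, hz, h⟩; exact ⟨_, ⟨y, hy, z, hz, rfl⟩, funext h⟩

theorem A_decomp {j m l l' : ℕ} {k : ℝ} (hk : 0 ≤ k) (hjl : j ≤ l) (hl : l ≤ l') (hl' : l' ≤ m) :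
    {x ∈ M j m (k + 1) | (∀ i, j ≤ i → i < l' → k ≤ x i) ∧ ∀ i, l ≤ i → x i ≤ k} =
      {blk j l' k} + (M j l 1 + M l' m k) := by
  ext x
  rw [mem_blk_add_iff]
  constructor
  · rintro ⟨⟨h1, h2, h3, h4⟩, h5, h6⟩
    refine ⟨fun i => if j ≤ i ∧ i < l then x i - k else 0, ⟨?_, ?_, ?_, ?_⟩,
      fun i => if l' ≤ i then x i else 0, ⟨?_, ?_, ?_, ?_⟩, ?_⟩
    · intro i hi; simp [hi]
    · intro i hi; simp [hi]
    · intro i i' a b c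
      have := h3 i i' a b (by omega)
      simp only
      rw [if_pos (by omega), if_pos (by omega)]; linarith
    · intro i
      simp only
      split_ifs with h
      · have := h5 i h.1 (by omega)
        have := (h4 i).2
        constructor <;> linarith
      · simp
    · intro i hi
      exact if_neg (by omega)
    · intro i hi; simp only
      rw [if_pos (by omega), h2 i hi]
    · intro i i' a b c
      simp only
      rw [if_pos (by omega), if_pos (by omega)]
      exact h3 i i' (by omega) b c
    · intro i
      simp only
      split_ifs with h
      · exact ⟨(h4 i).1, h6 i (by omega)⟩
      · simp [hk]
    · intro i
      simp only [blk]
      rcases lt_or_ge i j with a | a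
      · rw [if_neg (by omega), if_neg (by omega), if_neg (by omega), h1 i a]; ring
      rcases lt_or_ge i l with b | b
      · rw [if_pos (by omega), if_pos (by omega), if_neg (by omega)]; ring
      rcases lt_or_ge i l' with c | c
      · rw [if_pos (by omega), if_neg (by omega), if_neg (by omega)]
        have := h5 i a c
        have := h6 i b
        linarith
      · rw [if_neg (by omega), if_neg (by omega), if_pos (by omega)]; ring
  · rintro ⟨y, ⟨a1, a2, a3, a4⟩, z, ⟨b1, b2, b3, b4⟩, h⟩
    simp only [blk] at h
    refine ⟨⟨fun i hi => ?_, fun i hi => ?_, fun i i' p q r => ?_, fun i => ?_⟩,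
      fun i p q => ?_, fun i p => ?_⟩
    · rw [← h i, a1 i hi, b1 i (by omega), if_neg (by omega)]; ring
    · rw [← h i, a2 i (by omega), b2 i (by omega), if_neg (by omega)]; ring
    · rw [← h i, ← h i']
      rcases lt_or_ge i' l' with c | c
      · rw [if_pos (by omega), if_pos (by omega), b1 i (by omega), b1 i' (by omega)]
        rcases lt_or_ge i' l with d | d
        · linarith [a3 i i' p q d]
        · linarith [a2 i' d, (a4 i).1]
      · rw [if_neg (by omega), a2 i' (by omega)]
        rcases lt_or_ge i l' with d | d
        · rw [if_pos (by omega)]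
          linarith [(b4 i').2, (b4 i).1, (a4 i).1]
        · rw [if_neg (by omega), a2 i (by omega)]
          linarith [b3 i i' d q r]
    · rw [← h i]
      rcases lt_or_ge i l' with d | d
      · rw [b1 i d]
        have := a4 i
        split_ifs <;> constructor <;> linarith
      · rw [a2 i (by omega), if_neg (by omega)]
        have := b4 i
        constructor <;> linarith
    · rw [← h i, if_pos (by omega)]
      linarith [(b4 i).1, (a4 i).1]
    · rw [← h i, a2 i p]
      rcases lt_or_ge i l' with d | d
      · rw [b1 i d]
        split_ifs <;> linarith
      · rw [if_neg (by omega)]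
        linarith [(b4 i).2]

theorem IsVal.A_step {ν : Set (ℕ → ℝ) → ℝ} (hν : IsVal ν) (hT : TransInv ν) {j m l : ℕ} {k : ℝ}
    (hk : 0 ≤ k) (hjl : j ≤ l) (hl : l < m) :
    ν (A j m l k) = (ν (M j l 1 + M l m k) - ν (M j l 1 + M (l + 1) m k)) + ν (A j m (l + 1) k) := by
  have e1 : {x ∈ A j m l k | x l ≤ k} = {blk j l k} + (M j l 1 + M l m k) := by
    rw [← A_decomp hk hjl le_rfl hl.le]
    ext x
    refine ⟨fun h => ⟨h.1.1, h.1.2, fun i hi => ?_⟩, fun h => ⟨⟨h.1, h.2.1⟩, h.2.2 l le_rfl⟩⟩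
    rcases lt_or_ge i m with d | d
    · exact (h.1.1.2.2.1 l i hjl hi d).trans h.2
    · rw [h.1.1.2.1 i d]; exact hk
  have e2 : {x ∈ A j m l k | x l ≤ k} ∩ A j m (l + 1) k =
      {blk j (l + 1) k} + (M j l 1 + M (l + 1) m k) := by
    rw [← A_decomp hk hjl (Nat.le_succ l) hl]
    ext x
    refine ⟨fun h => ⟨h.2.1, h.2.2, fun i hi => ?_⟩, fun h => ⟨⟨⟨h.1, ?_⟩, h.2.2 l le_rfl⟩, h.1, h.2.1⟩⟩
    · rcases lt_or_ge i m with d | d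
      · exact (h.2.1.2.2.1 l i hjl hi d).trans h.1.2
      · rw [h.2.1.2.1 i d]; exact hk
    · exact fun i a b => h.2.1 i a (by omega)
  have e3 : {x ∈ A j m l k | x l ≤ k} ∪ A j m (l + 1) k = A j m l k := by
    ext x
    constructor
    · rintro (h | h)
      · exact h.1
      · exact ⟨h.1, fun i a b => h.2 i a (by omega)⟩
    · intro h
      rcases le_total (x l) k with d | d
      · exact Or.inl ⟨h, d⟩
      · refine Or.inr ⟨h.1, fun i a b => ?_⟩
        rcases Nat.lt_succ_iff_lt_or_eq.1 b with c | rfl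
        · exact h.2 i a c
        · exact d
  have cA : ∀ l, CC (A j m l k) := fun l => by
    have : A j m l k = M j m (k + 1) ∩ ⋂ i, ⋂ (_ : j ≤ i), ⋂ (_ : i < l), {x | k ≤ x i} := by
      ext; simp [A]
    rw [this]
    refine (CC.M j m (k + 1)).inter ?_ ?_
    · exact isClosed_iInter fun i => isClosed_iInter fun _ => isClosed_iInter fun _ =>
        isClosed_le continuous_const (continuous_apply i)
    · exact convex_iInter fun i => convex_iInter fun _ => convex_iInter fun _ =>
        convex_halfSpace_ge (LinearMap.proj (R := ℝ) (φ := fun _ : ℕ => ℝ) i).isLinear k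
  have key := hν.union_add_inter {x ∈ A j m l k | x l ≤ k} (A j m (l + 1) k)
    (by rw [e1]; exact (CC.singleton _).add ((CC.M _ _ _).add (CC.M _ _ _))) (cA _)
    (by rw [e3]; exact (cA _).2)
  rw [e3, e2, e1, hT _ _ ((CC.M _ _ _).add (CC.M _ _ _)),
    hT _ _ ((CC.M _ _ _).add (CC.M _ _ _))] at key
  linarith

/-- Canonical dissection of dilated simplices. -/
theorem IsVal.dissect {ν : Set (ℕ → ℝ) → ℝ} (hν : IsVal ν) (hT : TransInv ν) {j m : ℕ} {k : ℝ}
    (hk : 0 ≤ k) (hjm : j ≤ m) :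
    ν (M j m (k + 1)) = ∑ l ∈ Finset.Ico j m,
      (ν (M j l 1 + M l m k) - ν (M j l 1 + M (l + 1) m k)) + ν (M j m 1 + M m m k) := by
  have h1 : ∀ p, j ≤ p → p ≤ m → ν (M j m (k + 1)) = ∑ l ∈ Finset.Ico j p,
      (ν (M j l 1 + M l m k) - ν (M j l 1 + M (l + 1) m k)) + ν (A j m p k) := by
    intro p hp
    induction p, hp using Nat.le_induction with
    | base => intro _; simp [A_eq]
    | succ p hp ih =>
      intro hpm
      rw [ih (by omega), Finset.sum_Ico_succ_top hp, hν.A_step hT hk hp hpm]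
      ring
  rw [h1 m hjm le_rfl]
  congr 1
  have : A j m m k = {x ∈ M j m (k + 1) | (∀ i, j ≤ i → i < m → k ≤ x i) ∧ ∀ i, m ≤ i → x i ≤ k} := by
    ext x
    refine ⟨fun h => ⟨h.1, h.2, fun i hi => ?_⟩, fun h => ⟨h.1, h.2.1⟩⟩
    rw [h.1.2.1 i hi]; exact hk
  rw [this, A_decomp hk hjm le_rfl le_rfl, hT _ _ ((CC.M _ _ _).add (CC.M _ _ _))]

/-- `f` is polynomial on `ℕ` of degree less than `N`. -/
def PolyN (N : ℕ) (f : ℕ → ℝ) : Prop := ∀ k, (fwdDiff 1)^[N] f k = 0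

theorem PolyN.sub_succ {N : ℕ} {f : ℕ → ℝ} (h : PolyN N fun k => f (k + 1) - f k) :
    PolyN (N + 1) f := h

theorem PolyN.zero (N : ℕ) : PolyN N fun _ => (0 : ℝ) := by
  induction N with
  | zero => exact fun _ => rfl
  | succ N ih => exact PolyN.sub_succ (by simpa using ih)

theorem PolyN.add {N : ℕ} {f g : ℕ → ℝ} (hf : PolyN N f) (hg : PolyN N g) :
    PolyN N fun k => f k + g k := fun k => by
  have := congrFun (fwdDiff_iter_add 1 f g N) k
  rw [show (fun k => f k + g k) = f + g from rfl, this, Pi.add_apply, hf k, hg k, add_zero]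

theorem PolyN.neg {N : ℕ} {f : ℕ → ℝ} (hf : PolyN N f) : PolyN N fun k => - f k := fun k => by
  have := congrFun (fwdDiff_iter_const_smul 1 (-1 : ℝ) f N) k
  rw [show (fun k => - f k) = (-1 : ℝ) • f by ext; simp, this, Pi.smul_apply, hf k, smul_zero]

theorem PolyN.sum {ι : Type*} (s : Finset ι) {N : ℕ} {f : ι → ℕ → ℝ} (hf : ∀ i ∈ s, PolyN N (f i)) :
    PolyN N fun k => ∑ i ∈ s, f i k := by
  classical
  induction s using Finset.induction_on with
  | empty => simpa using PolyN.zero N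
  | insert a s ha ih =>
    simp only [Finset.sum_insert ha]
    exact (hf a (by simp)).add (ih fun i hi => hf i (by simp [hi]))

theorem PolyN.succ {N : ℕ} {f : ℕ → ℝ} (h : PolyN N f) : PolyN (N + 1) f := fun k => by
  rw [Function.iterate_succ_apply', fwdDiff, h, h, sub_zero]

theorem PolyN.mono {N N' : ℕ} (hN : N ≤ N') {f : ℕ → ℝ} (h : PolyN N f) : PolyN N' f := by
  induction N', hN using Nat.le_induction with
  | base => exact h
  | succ _ _ ih => exact ih.succ

theorem IsVal.polyN_M (r : ℕ) {ν : Set (ℕ → ℝ) → ℝ} (hν : IsVal ν) (hT : TransInv ν) (j : ℕ) :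
    PolyN (r + 1) fun k : ℕ => ν (M j (j + r) k) := by
  induction r using Nat.strong_induction_on generalizing ν j with
  | _ r ih =>
  refine PolyN.sub_succ ?_
  have key : (fun k : ℕ => ν (M j (j + r) ((k + 1 : ℕ) : ℝ)) - ν (M j (j + r) k)) = fun k : ℕ =>
      ∑ l ∈ Finset.Ico j (j + r), (if l = j then 0 else ν (M j l 1 + M l (j + r) k)) +
      (∑ l ∈ Finset.Ico j (j + r), - ν (M j l 1 + M (l + 1) (j + r) k) +
      (if r = 0 then 0 else ν (M j (j + r) 1 + M (j + r) (j + r) k))) := by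
    ext k
    push_cast
    rw [hν.dissect hT (Nat.cast_nonneg k) (Nat.le_add_right j r), Finset.sum_sub_distrib,
      Finset.sum_neg_distrib]
    have h0 : M j j 1 = {0} := M_self j zero_le_one
    rcases Nat.eq_zero_or_pos r with rfl | hr
    · simp [M_self]
    · rw [if_neg hr.ne', Finset.sum_eq_sum_Ico_succ_bot (by omega),
        Finset.sum_eq_sum_Ico_succ_bot (by omega) (fun l => if l = j then 0 else _), if_pos rfl, h0,
        Set.singleton_zero, zero_add]
      have : ∑ l ∈ Finset.Ico (j + 1) (j + r), (if l = j then 0 else ν (M j l 1 + M l (j + r) k)) =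
          ∑ l ∈ Finset.Ico (j + 1) (j + r), ν (M j l 1 + M l (j + r) k) :=
        Finset.sum_congr rfl fun l hl => if_neg (by simp at hl; omega)
      rw [this]
      ring
  rw [key]
  have hval : ∀ l, IsVal (fun K => ν (M j l 1 + K)) := fun l => by
    simpa only [add_comm] using hν.add_right (CC.M j l 1)
  have htr : ∀ l, TransInv (fun K => ν (M j l 1 + K)) := fun l => by
    have := hT.add_right (CC.M j l 1)
    simpa only [TransInv, add_comm] using this
  refine (PolyN.sum _ fun l hl => ?_).add ((PolyN.sum _ fun l hl => ?_).add ?_)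
  · simp only [Finset.mem_Ico] at hl
    split_ifs with h
    · exact PolyN.zero _
    · have := ih (j + r - l) (by omega) (hval l) (htr l) l
      rw [show l + (j + r - l) = j + r by omega] at this
      exact this.mono (by omega)
  · simp only [Finset.mem_Ico] at hl
    have := ih (j + r - (l + 1)) (by omega) (hval l) (htr l) (l + 1)
    rw [show l + 1 + (j + r - (l + 1)) = j + r by omega] at this
    exact (this.mono (by omega)).neg
  · split_ifs with h
    · exact PolyN.zero _
    · exact (ih 0 (by omega) (hval (j + r)) (htr (j + r)) (j + r)).mono (by omega)

end Monotone

section Poly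

theorem PolyN.exists_polynomial {N : ℕ} {f : ℕ → ℝ} (h : PolyN N f) :
    ∃ P : Polynomial ℝ, P.degree < N ∧ ∀ k : ℕ, f k = P.eval (k : ℝ) := by
  refine ⟨∑ i ∈ Finset.range N, Polynomial.C ((fwdDiff 1)^[i] f 0 / (i.factorial : ℝ)) *
    descPochhammer ℝ i, ?_, fun k => ?_⟩
  · rw [← Polynomial.mem_degreeLT]
    refine Submodule.sum_mem _ fun i hi => ?_
    rw [← Polynomial.smul_eq_C_mul]
    refine Submodule.smul_mem _ _ (Polynomial.mem_degreeLT.2 ?_)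
    refine (Polynomial.degree_le_natDegree).trans_lt ?_
    rw [descPochhammer_natDegree]
    exact_mod_cast Finset.mem_range.1 hi
  · have h0 := shift_eq_sum_fwdDiff_iter 1 f k 0
    simp only [zero_add, smul_eq_mul, mul_one, nsmul_eq_mul] at h0
    have hz : ∀ i, N ≤ i → (fwdDiff 1)^[i] f 0 = 0 := fun i hi => h.mono hi 0
    have hz' : ∀ i, k < i → ((k.choose i : ℕ) : ℝ) = 0 := fun i hi => by
      rw [Nat.choose_eq_zero_of_lt hi]; simp
    have e1 : ∑ i ∈ Finset.range (k + 1), (k.choose i : ℝ) * (fwdDiff 1)^[i] f 0 =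
        ∑ i ∈ Finset.range (max (k + 1) N), (k.choose i : ℝ) * (fwdDiff 1)^[i] f 0 := by
      refine Finset.sum_subset (Finset.range_mono (le_max_left _ _)) fun i _ hi => ?_
      rw [hz' i (by simpa using hi), zero_mul]
    have e2 : ∑ i ∈ Finset.range N, (k.choose i : ℝ) * (fwdDiff 1)^[i] f 0 =
        ∑ i ∈ Finset.range (max (k + 1) N), (k.choose i : ℝ) * (fwdDiff 1)^[i] f 0 := by
      refine Finset.sum_subset (Finset.range_mono (le_max_right _ _)) fun i _ hi => ?_
      rw [hz i (by simpa using hi), mul_zero]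
    rw [h0, e1, ← e2, Polynomial.eval_finsetSum]
    refine Finset.sum_congr rfl fun i _ => ?_
    rw [Polynomial.eval_mul, Polynomial.eval_C, descPochhammer_eval_eq_descFactorial,
      Nat.descFactorial_eq_factorial_mul_choose]
    push_cast
    have := Nat.factorial_ne_zero i
    field_simp

/-- A polynomial with `o(k)` growth defect along powers of two is affine. -/
theorem PolyN.affine {N : ℕ} {f : ℕ → ℝ} (h : PolyN N f) {c : ℝ}
    (hf : Filter.Tendsto (fun j : ℕ => f (2 ^ j) / 2 ^ j) Filter.atTop (nhds c)) (k : ℕ) :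
    f k = k * c + f 0 := by
  obtain ⟨P, -, hP⟩ := h.exists_polynomial
  have hdvd : Polynomial.X ∣ P - Polynomial.C (f 0) := by
    rw [Polynomial.X_dvd_iff, Polynomial.coeff_zero_eq_eval_zero]
    have := hP 0
    simp at this
    simp [← this]
  obtain ⟨Q, hQ⟩ := hdvd
  have hQ' : ∀ x, P.eval x = x * Q.eval x + f 0 := fun x => by
    have := congrArg (Polynomial.eval x) hQ
    simp at this
    linarith
  have hp : Filter.Tendsto (fun j : ℕ => (2 : ℝ) ^ j) Filter.atTop Filter.atTop :=
    tendsto_pow_atTop_atTop_of_one_lt one_lt_two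
  have hlim : Filter.Tendsto (fun j : ℕ => Q.eval ((2 : ℝ) ^ j)) Filter.atTop (nhds c) := by
    have h2 : Filter.Tendsto (fun j : ℕ => f 0 / (2 : ℝ) ^ j) Filter.atTop (nhds 0) :=
      hp.const_div_atTop _
    have h3 := hf.sub h2
    rw [sub_zero] at h3
    refine h3.congr fun j => ?_
    rw [hP, hQ']
    push_cast
    field_simp
    ring
  have hdeg : Q.degree ≤ 0 := by
    by_contra hd
    have := (Q.abs_tendsto_atTop (not_le.1 hd)).comp hp
    exact not_tendsto_nhds_of_tendsto_atTop this _ hlim.abs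
  have hQc : ∀ x, Q.eval x = c := by
    rw [Polynomial.eq_C_of_degree_le_zero hdeg] at hlim ⊢
    simp only [Polynomial.eval_C] at hlim ⊢
    exact fun _ => tendsto_nhds_unique tendsto_const_nhds hlim
  rw [hP, hQ', hQc]

theorem abel_sum {N : Type*} [AddCommGroup N] [Module ℝ N] (y : ℕ → ℝ) (w : ℕ → N) (m : ℕ) :
    ∑ i ∈ Finset.range (m + 1), (y i - y (i + 1)) • w i =
      y 0 • w 0 + ∑ i ∈ Finset.range m, y (i + 1) • (w (i + 1) - w i) - y (m + 1) • w m := by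
  induction m with
  | zero => simp [sub_smul]
  | succ m ih =>
    rw [Finset.sum_range_succ, ih, Finset.sum_range_succ (fun i => y (i + 1) • (w (i + 1) - w i))]
    module

variable {V : Type*} [NormedAddCommGroup V] [NormedSpace ℝ V]

/-- The linear map sending the `i`-th unit sequence to `u i` for `i < m`. -/
def incMap (u : ℕ → V) (m : ℕ) : (ℕ → ℝ) →L[ℝ] V :=
  ∑ i ∈ Finset.range m, (ContinuousLinearMap.proj (R := ℝ) (φ := fun _ : ℕ => ℝ) i).smulRight (u i)

theorem incMap_apply (u : ℕ → V) (m : ℕ) (x : ℕ → ℝ) :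
    incMap u m x = ∑ i ∈ Finset.range m, x i • u i := by
  simp [incMap]

theorem hull_eq_image (v : ℕ → V) (m : ℕ) :
    convexHull ℝ (Set.range fun i : Fin (m + 1) => v i) =
      {v 0} + incMap (fun i => v (i + 1) - v i) m '' M 0 m 1 := by
  apply Set.Subset.antisymm
  · refine convexHull_min ?_ ((convex_singleton _).add ((CC.M 0 m 1).image _).2)
    rintro _ ⟨j, rfl⟩
    refine ⟨v 0, rfl, _, ⟨blk 0 j 1, ⟨by simp, ?_, ?_, ?_⟩, rfl⟩, ?_⟩
    · intro i hi; have := j.2; simp only [blk]; exact if_neg (by omega)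
    · intro i i' _ h2 _
      simp only [blk]; split_ifs <;> first | omega | norm_num
    · intro i; simp only [blk]; split_ifs <;> norm_num
    · simp only [incMap_apply, blk]
      have hj : (j : ℕ) ≤ m := Nat.lt_succ_iff.1 j.2
      rw [← Finset.sum_subset (Finset.range_mono hj)]
      · rw [Finset.sum_congr rfl (g := fun i => v (i + 1) - v i), Finset.sum_range_sub]
        · abel
        · intro i hi
          simp at hi
          simp [hi]
      · intro i _ hi
        simp at hi
        rw [if_neg (by omega), zero_smul]
  · rintro _ ⟨_, rfl, _, ⟨x, ⟨-, h2, h3, h4⟩, rfl⟩, rfl⟩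
    set y : ℕ → ℝ := fun i => Nat.casesOn i 1 x with hy
    have hy0 : y 0 = 1 := rfl
    have hys : ∀ i, y (i + 1) = x i := fun i => rfl
    refine mem_hull.2 ⟨fun i => y i - y (i + 1), fun i => ?_, ?_⟩
    · rw [sub_nonneg]
      rcases i with ⟨_ | i, hi⟩
      · exact (h4 0).2
      · simp only [hys]
        rcases lt_or_ge (i + 1) m with h | h
        · exact h3 i (i + 1) (by omega) (by omega) h
        · rw [h2 _ h]; exact (h4 i).1
    · rw [Fin.sum_univ_eq_sum_range (fun i => (y i - y (i + 1)) • lift (v i)) (m + 1), abel_sum,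
        hys m, h2 m le_rfl, hy0]
      simp only [hys, incMap_apply]
      ext
      · simp [lift, Prod.fst_sum]
      · simp [lift, Prod.snd_sum]

variable [FiniteDimensional ℝ V]

theorem Ind.card_le {ι : Type} [Fintype ι] {v : ι → V} (hv : Ind v) :
    Fintype.card ι ≤ Module.finrank ℝ V + 1 := by
  have := LinearIndependent.fintype_card_le_finrank hv
  simpa using this

/-- Natural number indexing of a nonempty finite family. -/
theorem exists_nat_family {ι : Type} [Fintype ι] [Nonempty ι] (v : ι → V) (hv : Ind v) :
    ∃ (m : ℕ) (w : ℕ → V), m + 1 = Fintype.card ι ∧ Set.range v = Set.range (fun i : Fin (m + 1) => w i) ∧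
      Ind (fun i : Fin (m + 1) => w i) := by
  obtain ⟨m, hm⟩ : ∃ m, Fintype.card ι = m + 1 :=
    Nat.exists_eq_succ_of_ne_zero Fintype.card_ne_zero
  set e := (Fintype.equivFinOfCardEq hm).symm with he
  have hw : ∀ i : Fin (m + 1), (fun i : ℕ => if h : i < m + 1 then v (e ⟨i, h⟩) else 0) i = v (e i) :=
    fun i => by simp [i.2]
  refine ⟨m, fun i => if h : i < m + 1 then v (e ⟨i, h⟩) else 0, hm.symm, ?_, ?_⟩
  · simp only [hw]
    exact (e.surjective.range_comp v).symm
  · simp only [hw]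
    exact LinearIndependent.comp hv e e.injective

theorem smul_translate_image (x : V) (F : (ℕ → ℝ) →L[ℝ] V) (m : ℕ) {k : ℝ} (hk : 0 ≤ k) :
    k • ({x} + F '' M 0 m 1) = {k • x} + F '' M 0 m k := by
  rw [smul_add, Set.smul_set_singleton, ← smul_M 0 m hk, Set.image_smul_comm]
  simp

/-- Polynomiality of translation invariant continuous valuations. -/
theorem IsVal.polyN_smul {ν : Set V → ℝ} (hν : IsVal ν) (hT : TransInv ν) (hc : HCont ν)
    {K : Set V} (hK : CC K) :
    PolyN (Module.finrank ℝ V + 1) fun k : ℕ => ν ((k : ℝ) • K) := by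
  intro k
  set N := Module.finrank ℝ V + 1 with hN
  set μ : Set V → ℝ := fun K => ∑ i ∈ Finset.range (N + 1),
    (((-1 : ℤ) ^ (N - i) * N.choose i : ℤ) : ℝ) * ν (((k + i : ℕ) : ℝ) • K) with hμ
  have hμe : ∀ K, (fwdDiff 1)^[N] (fun k : ℕ => ν ((k : ℝ) • K)) k = μ K := fun K => by
    rw [fwdDiff_iter_eq_sum_shift]
    simp [hμ]
  rw [hμe]
  refine IsVal.eq_zero_of_simplex (IsVal.sum _ fun i _ => (hν.smul _).const_mul _)
    (HCont.sum _ fun i _ => (hc.smul _).const_mul _) ?_ hK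
  intro ι _ v hv
  change μ _ = 0
  rw [← hμe]
  rcases isEmpty_or_nonempty ι with hι | hι
  · have : PolyN N fun k : ℕ => ν ((k : ℝ) • convexHull ℝ (Set.range v)) := by
      simpa [Set.range_eq_empty, hν.empty] using PolyN.zero N
    exact this k
  · obtain ⟨m, w, hm, hr, -⟩ := exists_nat_family v hv
    have hle := hv.card_le
    rw [hr, hull_eq_image]
    have := (hν.image (incMap (fun i => w (i + 1) - w i) m)).polyN_M m
      (hT.image (incMap (fun i => w (i + 1) - w i) m)) 0
    refine PolyN.mono (show m + 1 ≤ N by omega) ?_ k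
    simpa only [smul_translate_image _ _ _ (Nat.cast_nonneg _),
      hT _ _ ((CC.M _ _ _).image _), zero_add] using this

theorem HCont.tendsto {ν : Set V → ℝ} (hc : HCont ν) {K : Set V} (hK : CC K)
    (hK' : K.Nonempty) {L : ℕ → Set V} (hL : ∀ j, CC (L j)) (hL' : ∀ j, (L j).Nonempty)
    (h1 : ∀ δ > 0, ∀ᶠ j in Filter.atTop, K ⊆ L j + Metric.closedBall 0 δ)
    (h2 : ∀ δ > 0, ∀ᶠ j in Filter.atTop, L j ⊆ K + Metric.closedBall 0 δ) :
    Filter.Tendsto (fun j => ν (L j)) Filter.atTop (nhds (ν K)) := by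
  rw [Metric.tendsto_nhds]
  intro ε hε
  obtain ⟨δ, hδ, h⟩ := hc K hK hK' ε hε
  filter_upwards [h1 δ hδ, h2 δ hδ] with j a b
  exact h _ (hL j) (hL' j) a b

theorem eventually_smul_subset {L : Set V} (hL : IsCompact L) {c : ℕ → ℝ}
    (hc : Filter.Tendsto c Filter.atTop (nhds 0)) {δ : ℝ} (hδ : 0 < δ) :
    ∀ᶠ j in Filter.atTop, c j • L ⊆ Metric.closedBall 0 δ := by
  obtain ⟨R, hR⟩ := hL.isBounded.subset_closedBall 0
  have h1 : Filter.Tendsto (fun j => |c j| * (|R| + 1)) Filter.atTop (nhds 0) := by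
    simpa using hc.abs.mul_const (|R| + 1)
  filter_upwards [h1.eventually (gt_mem_nhds hδ)] with j hj
  rintro _ ⟨x, hx, rfl⟩
  have := hR hx
  rw [mem_closedBall_zero_iff] at this ⊢
  simp only [norm_smul, Real.norm_eq_abs]
  refine le_trans ?_ hj.le
  gcongr
  linarith [le_abs_self R]

theorem HCont.tendsto_add_smul {ν : Set V → ℝ} (hc : HCont ν) {K L : Set V} (hK : CC K)
    (hK' : K.Nonempty) (hL : CC L) (hL' : L.Nonempty) {c : ℕ → ℝ}
    (h0 : Filter.Tendsto c Filter.atTop (nhds 0)) :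
    Filter.Tendsto (fun j => ν (K + c j • L)) Filter.atTop (nhds (ν K)) := by
  refine hc.tendsto hK hK' (fun j => hK.add (hL.smul _)) (fun j => hK'.add hL'.smul_set)
    (fun δ hδ => ?_) fun δ hδ => ?_
  · filter_upwards [eventually_smul_subset hL.1 h0 hδ] with j hj
    intro x hx
    obtain ⟨l, hl⟩ := hL'
    have : c j • l ∈ Metric.closedBall (0 : V) δ := hj ⟨l, hl, rfl⟩
    exact ⟨x + c j • l, ⟨x, hx, _, ⟨l, hl, rfl⟩, rfl⟩, -(c j • l), by simpa using this,
      by simp⟩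
  · filter_upwards [eventually_smul_subset hL.1 h0 hδ] with j hj
    exact Set.add_subset_add_left hj

/-- Minkowski additivity of valuations with `ν (2K) = 2 ν K`. -/
theorem IsVal.additive {ν : Set V → ℝ} (hν : IsVal ν) (hT : TransInv ν) (hc : HCont ν)
    (h2 : ∀ K, CC K → K.Nonempty → ν ((2 : ℝ) • K) = 2 * ν K) {K L : Set V} (hK : CC K)
    (hK' : K.Nonempty) (hL : CC L) (hL' : L.Nonempty) : ν (K + L) = ν K + ν L := by
  have hp : PolyN (Module.finrank ℝ V + 1) fun k : ℕ => ν ((k : ℝ) • K + L) :=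
    (hν.add_right hL).polyN_smul (hT.add_right hL) (hc.add_right hL hL') hK
  have hpow : ∀ (j : ℕ) X, CC X → X.Nonempty → ν ((2 : ℝ) ^ j • X) = 2 ^ j * ν X := by
    intro j
    induction j with
    | zero => simp
    | succ j ih =>
      intro X hX hX'
      rw [pow_succ, mul_smul, ih _ (hX.smul _) hX'.smul_set, h2 X hX hX']
      ring
  have key := hp.affine (c := ν K) ?_ 1
  · simpa [Set.zero_smul_set hK', add_comm] using key
  · have h0 : Filter.Tendsto (fun j : ℕ => ((2 : ℝ) ^ j)⁻¹) Filter.atTop (nhds 0) :=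
      tendsto_inv_atTop_zero.comp (tendsto_pow_atTop_atTop_of_one_lt one_lt_two)
    refine (hc.tendsto_add_smul hK hK' hL hL' h0).congr fun j => ?_
    have e : ((2 ^ j : ℕ) : ℝ) • K + L = (2 : ℝ) ^ j • (K + ((2 : ℝ) ^ j)⁻¹ • L) := by
      rw [smul_add, smul_smul, mul_inv_cancel₀ (by positivity), one_smul]
      push_cast
      rfl
    rw [e, hpow j _ (hK.add (hL.smul _)) (hK'.add hL'.smul_set)]
    field_simp

end Poly

section Ortho

open Function

variable {V : Type} [NormedAddCommGroup V] [InnerProductSpace ℝ V]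

/-- Simple valuations vanish on sets contained in hyperplanes. -/
def Simple (ν : Set V → ℝ) : Prop :=
  ∀ (u : V) (c : ℝ) (K : Set V), u ≠ 0 → CC K → (∀ x ∈ K, inner ℝ u x = c) → ν K = 0

theorem sum_update_of_edge {ω : (ℕ → V) → ℝ} {d : ℕ}
    (hE : ∀ (v : ℕ → V) (a b : ℕ), a ≤ d → b ≤ d → a ≠ b → ∀ t : ℝ,
      ω v = ω (update v a ((1 - t) • v a + t • v b)) + ω (update v b ((1 - t) • v a + t • v b)))
    (s : Finset ℕ) (hs : ∀ i ∈ s, i ≤ d) (v : ℕ → V) (β : ℕ → ℝ) (hβ : ∑ i ∈ s, β i = 1) :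
    ω v = ∑ j ∈ s, ω (update v j (∑ i ∈ s, β i • v i)) := by
  induction hn : s.card generalizing s v β with
  | zero => simp [Finset.card_eq_zero.1 hn] at hβ
  | succ n ih =>
  by_cases h1 : ∀ k ∈ s, β k = 1
  · have hc : (s.card : ℝ) = 1 := by
      rw [← hβ, Finset.sum_congr rfl h1]; simp
    obtain ⟨a, rfl⟩ := Finset.card_eq_one.1 (by exact_mod_cast hc)
    simp [h1 a]
  · push Not at h1
    obtain ⟨k, hk, hk1⟩ := h1
    have hk1' : 1 - β k ≠ 0 := sub_ne_zero.2 hk1.symm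
    set r := s.erase k with hr
    have hrs : ∀ j ∈ r, j ≠ k ∧ j ∈ s := fun j hj => Finset.mem_erase.1 hj
    have hrc : r.card = n := by rw [hr, Finset.card_erase_of_mem hk, hn]; rfl
    have hβ' : ∑ i ∈ r, β i / (1 - β k) = 1 := by
      rw [← Finset.sum_div, div_eq_one_iff_eq hk1', ← hβ, ← Finset.add_sum_erase _ _ hk]
      ring
    set y := ∑ i ∈ r, (β i / (1 - β k)) • v i with hy
    set x := ∑ i ∈ s, β i • v i with hx
    have hxy : x = (1 - β k) • y + β k • v k := by
      rw [hx, ← Finset.add_sum_erase _ _ hk, hy, Finset.smul_sum, add_comm]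
      congr 1
      refine Finset.sum_congr rfl fun i _ => ?_
      rw [smul_smul, mul_div_cancel₀ _ hk1']
    have hrd : ∀ i ∈ r, i ≤ d := fun i hi => hs i (hrs i hi).2
    have e1 := ih r hrd v _ hβ' hrc
    have e2 := ih r hrd (update v k x) _ hβ' hrc
    have e3 : ∑ i ∈ r, (β i / (1 - β k)) • update v k x i = y := by
      refine Finset.sum_congr rfl fun i hi => ?_
      rw [update_of_ne (hrs i hi).1]
    rw [e3] at e2
    rw [e1, ← Finset.add_sum_erase _ _ hk, e2, ← Finset.sum_add_distrib]
    refine Finset.sum_congr rfl fun j hj => ?_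
    have hjk := (hrs j hj).1
    rw [hE (update v j y) j k (hrd j hj) (hs k hk) hjk (β k), update_self, update_of_ne hjk.symm,
      ← hxy, update_idem, update_comm hjk, add_comm]

theorem exists_foot (v : ℕ → V) (k : ℕ) (z : V) : ∃ β : ℕ → ℝ,
    ∑ i ∈ Finset.range (k + 1), β i = 1 ∧
    ∀ j ≤ k, inner ℝ (z - ∑ i ∈ Finset.range (k + 1), β i • v i)
      (v j - ∑ i ∈ Finset.range (k + 1), β i • v i) = 0 := by
  set U := Submodule.span ℝ ((fun i => v i - v 0) '' (Finset.range (k + 1) : Set ℕ)) with hU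
  have : FiniteDimensional ℝ U :=
    FiniteDimensional.span_of_finite ℝ ((Finset.finite_toSet _).image _)
  obtain ⟨p, hp, hpz⟩ := U.exists_norm_eq_iInf_of_complete_subspace
    (by exact (Submodule.complete_of_finiteDimensional U)) (z - v 0)
  rw [U.norm_eq_iInf_iff_real_inner_eq_zero hp] at hpz
  obtain ⟨c, hc⟩ := Submodule.mem_span_image_finset_iff_exists_fun' (R := ℝ) |>.1 hp
  have h0 : 0 ∈ Finset.range (k + 1) := by simp
  have e1 : ∑ i ∈ Finset.range (k + 1),
      (c i + Pi.single (M := fun _ => ℝ) 0 (1 - ∑ i ∈ Finset.range (k + 1), c i) i) = 1 := by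
    simp only [Finset.sum_add_distrib, Pi.single_apply, Finset.sum_ite_eq', h0, if_true]
    ring
  have e2 : ∑ i ∈ Finset.range (k + 1),
      (c i + Pi.single (M := fun _ => ℝ) 0 (1 - ∑ i ∈ Finset.range (k + 1), c i) i) • v i =
      v 0 + p := by
    rw [← hc]
    simp only [add_smul, smul_sub, Finset.sum_add_distrib, Finset.sum_sub_distrib,
      ← Finset.sum_smul, Pi.single_apply, ite_smul, zero_smul, Finset.sum_ite_eq', h0, if_true,
      sub_smul, one_smul]
    abel
  refine ⟨_, e1, fun j hj => ?_⟩
  rw [e2, ← sub_sub, ← sub_sub]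
  refine hpz _ (U.sub_mem ?_ hp)
  exact Submodule.subset_span ⟨j, by simp; omega, rfl⟩

/-- Alternating functions of simplices satisfying the edge relation vanish as soon as they vanish
on orthoschemes. -/
theorem eq_zero_of_orthoscheme {ω : (ℕ → V) → ℝ} {d : ℕ}
    (hE : ∀ (v : ℕ → V) (a b : ℕ), a ≤ d → b ≤ d → a ≠ b → ∀ t : ℝ,
      ω v = ω (update v a ((1 - t) • v a + t • v b)) + ω (update v b ((1 - t) • v a + t • v b)))
    (hs : ∀ (v : ℕ → V) (a b : ℕ), a ≤ d → b ≤ d → ω (v ∘ Equiv.swap a b) = 0 → ω v = 0)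
    (hO : ∀ v : ℕ → V, (∀ l, l + 2 ≤ d → ∀ j ≤ l + 1,
      inner ℝ (v (l + 2) - v (l + 1)) (v j - v (l + 1)) = 0) → ω v = 0) (v : ℕ → V) :
    ω v = 0 := by
  suffices H : ∀ k (v : ℕ → V), (∀ l, k ≤ l → l + 2 ≤ d → ∀ j ≤ l + 1,
      inner ℝ (v (l + 2) - v (l + 1)) (v j - v (l + 1)) = 0) → ω v = 0 from
    H d v fun l h1 h2 => by omega
  intro k
  induction k with
  | zero => exact fun v h => hO v fun l => h l (Nat.zero_le l)
  | succ k ih =>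
    intro v hv
    rcases lt_or_ge d (k + 2) with hd | hd
    · exact ih v fun l h1 h2 => by omega
    obtain ⟨β, hβ, hfoot⟩ := exists_foot v (k + 1) (v (k + 2))
    set x := ∑ i ∈ Finset.range (k + 1 + 1), β i • v i with hx
    have hmem : ∀ (p q : V), (∀ j ≤ k + 1, inner ℝ p (v j - q) = 0) → inner ℝ p (x - q) = 0 := by
      intro p q h
      have : x - q = ∑ i ∈ Finset.range (k + 1 + 1), β i • (v i - q) := by
        simp only [smul_sub, Finset.sum_sub_distrib, ← Finset.sum_smul, hβ, one_smul, hx]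
      rw [this, inner_sum]
      refine Finset.sum_eq_zero fun i hi => ?_
      rw [inner_smul_right, h i (by simp at hi; omega), mul_zero]
    rw [sum_update_of_edge hE (Finset.range (k + 1 + 1)) (by simp; omega) v β hβ]
    refine Finset.sum_eq_zero fun a ha => ?_
    have ha' : a ≤ k + 1 := by simp at ha; omega
    refine hs _ a (k + 1) (by omega) (by omega) (ih _ ?_)
    set u := update v a x ∘ Equiv.swap a (k + 1) with hu
    have hux : u (k + 1) = x := by simp [hu]
    have hul : ∀ l, k + 2 ≤ l → u l = v l := fun l hl => by
      simp only [hu, comp_apply]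
      rw [Equiv.swap_apply_of_ne_of_ne (by omega) (by omega), update_of_ne (by omega)]
    have huj : ∀ j ≤ k + 1, u j = x ∨ ∃ i ≤ k + 1, u j = v i := by
      intro j hj
      simp only [hu, comp_apply]
      by_cases h : Equiv.swap a (k + 1) j = a
      · left; rw [h, update_self]
      · right
        refine ⟨_, ?_, update_of_ne h _ _⟩
        rw [Equiv.swap_apply_def]
        split_ifs <;> omega
    intro l hl hld j hj
    rcases hl.eq_or_lt with rfl | hl
    · rw [hux, hul _ le_rfl]
      rcases huj j hj with h | ⟨i, hi, h⟩
      · rw [h, sub_self, inner_zero_right]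
      · rw [h, hfoot i hi]
    · rw [hul _ (by omega), hul (l + 1) (by omega)]
      rcases lt_or_ge (k + 1) j with hjk | hjk
      · rw [hul j hjk]; exact hv l hl hld j hj
      · rcases huj j hjk with h | ⟨i, hi, h⟩
        · rw [h]; exact hmem _ _ fun j hj => hv l hl hld j (by omega)
        · rw [h]; exact hv l hl hld i (by omega)

variable [FiniteDimensional ℝ V]

theorem exists_hyperplane {κ : Type} [Fintype κ] [Nonempty κ] (v : κ → V)
    (h : Fintype.card κ ≤ Module.finrank ℝ V) : ∃ u : V, u ≠ 0 ∧ ∃ c : ℝ, ∀ i, inner ℝ u (v i) = c := by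
  set f : V × ℝ →ₗ[ℝ] κ → ℝ := LinearMap.pi fun i =>
    (innerSL ℝ (v i)).toLinearMap.comp (LinearMap.fst ℝ V ℝ) - LinearMap.snd ℝ V ℝ with hf
  obtain ⟨⟨u, c⟩, hk, hne⟩ := Submodule.exists_mem_ne_zero_of_ne_bot
    (LinearMap.ker_ne_bot_of_finrank_lt (f := f) (by simp; omega))
  have hi : ∀ i, inner ℝ u (v i) = c := fun i => by
    have := congrFun (LinearMap.mem_ker.1 hk) i
    simp [hf, sub_eq_zero] at this
    rw [real_inner_comm, this]
  refine ⟨u, ?_, c, hi⟩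
  rintro rfl
  have := hi (Classical.arbitrary κ)
  simp at this
  simp [← this] at hne

theorem Simple.hull_eq_zero {ν : Set V → ℝ} (hν : IsVal ν) (hs : Simple ν) {κ : Type} [Fintype κ]
    (v : κ → V) (h : Fintype.card κ ≤ Module.finrank ℝ V) :
    ν (convexHull ℝ (Set.range v)) = 0 := by
  rcases isEmpty_or_nonempty κ with h0 | h0
  · simp [Set.range_eq_empty, hν.empty]
  obtain ⟨u, hu, c, hc⟩ := exists_hyperplane v h
  refine hs u c _ hu (CC.hull v) fun x hx => ?_
  have hsub : convexHull ℝ (Set.range v) ⊆ {x | inner ℝ u x = c} := by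
    refine convexHull_min ?_ (convex_hyperplane (innerSL ℝ u).toLinearMap.isLinear c)
    rintro _ ⟨i, rfl⟩
    exact hc i
  exact hsub hx

end Ortho

section SignedSimplex

open Function

variable {V : Type} [NormedAddCommGroup V] [InnerProductSpace ℝ V] [FiniteDimensional ℝ V]

/-- The basis of `V × ℝ` used to orient simplices. -/
def orientBasis (V : Type) [NormedAddCommGroup V] [InnerProductSpace ℝ V] [FiniteDimensional ℝ V] :
    Module.Basis (Fin (Module.finrank ℝ V + 1)) ℝ (V × ℝ) :=
  Module.finBasisOfFinrankEq ℝ (V × ℝ) (by simp)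

/-- Homogeneous determinant of a family of points. -/
def hdet (v : Fin (Module.finrank ℝ V + 1) → V) : ℝ := (orientBasis V).det fun i => lift (v i)

theorem hdet_ne_zero {v : Fin (Module.finrank ℝ V + 1) → V} : hdet v ≠ 0 ↔ Ind v := by
  constructor
  · intro h
    by_contra h'
    exact h ((orientBasis V).det.map_linearDependent _ h')
  · intro h
    have := (Module.Basis.is_basis_iff_det (orientBasis V) (v := fun i => lift (v i))).1
      ⟨h, LinearIndependent.span_eq_top_of_card_eq_finrank' h (by simp)⟩
    exact this.ne_zero

theorem hdet_update_left (v : Fin (Module.finrank ℝ V + 1) → V) {a b} (hab : a ≠ b) (t : ℝ) :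
    hdet (update v a ((1 - t) • v a + t • v b)) = (1 - t) * hdet v := by
  unfold hdet
  rw [lift_update, lift_comb, AlternatingMap.map_update_add, AlternatingMap.map_update_smul,
    AlternatingMap.map_update_smul, update_eq_self, AlternatingMap.map_update_self _ _ hab]
  simp

theorem hdet_update_right (v : Fin (Module.finrank ℝ V + 1) → V) {a b} (hab : a ≠ b) (t : ℝ) :
    hdet (update v b ((1 - t) • v a + t • v b)) = t * hdet v := by
  rw [show (1 - t) • v a + t • v b = (1 - (1 - t)) • v b + (1 - t) • v a by module,
    hdet_update_left v hab.symm]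
  ring

theorem hdet_swap (v : Fin (Module.finrank ℝ V + 1) → V) {a b} (hab : a ≠ b) :
    hdet (v ∘ Equiv.swap a b) = - hdet v :=
  (orientBasis V).det.map_swap (fun i => lift (v i)) hab

/-- The signed valuation of a simplex. -/
def sgnVal (ν : Set V → ℝ) (v : Fin (Module.finrank ℝ V + 1) → V) : ℝ :=
  (SignType.sign (hdet v) : ℝ) * ν (convexHull ℝ (Set.range v))

theorem sgnVal_swap (ν : Set V → ℝ) (v : Fin (Module.finrank ℝ V + 1) → V) {a b} (hab : a ≠ b) :
    sgnVal ν (v ∘ Equiv.swap a b) = - sgnVal ν v := by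
  unfold sgnVal
  rw [hdet_swap v hab, Left.sign_neg, (Equiv.swap a b).surjective.range_comp]
  simp

theorem sgnVal_of_hdet {ν : Set V → ℝ} {v : Fin (Module.finrank ℝ V + 1) → V} (h : hdet v = 0) :
    sgnVal ν v = 0 := by simp [sgnVal, h]

theorem Simple.edge_aux {ν : Set V → ℝ} (hν : IsVal ν) (hs : Simple ν)
    (v : Fin (Module.finrank ℝ V + 1) → V) {a b} (hab : a ≠ b) {t : ℝ} (h0 : 0 < t) (h1 : t < 1) :
    sgnVal ν v = sgnVal ν (update v a ((1 - t) • v a + t • v b)) +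
      sgnVal ν (update v b ((1 - t) • v a + t • v b)) := by
  by_cases hd : hdet v = 0
  · rw [sgnVal_of_hdet hd, sgnVal_of_hdet, sgnVal_of_hdet]
    · simp
    · rw [hdet_update_right v hab, hd, mul_zero]
    · rw [hdet_update_left v hab, hd, mul_zero]
  have hv := hdet_ne_zero.1 hd
  have s1 : SignType.sign (hdet (update v a ((1 - t) • v a + t • v b))) = SignType.sign (hdet v) := by
    rw [hdet_update_left v hab, sign_mul, sign_pos (by linarith), one_mul]
  have s2 : SignType.sign (hdet (update v b ((1 - t) • v a + t • v b))) = SignType.sign (hdet v) := by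
    rw [hdet_update_right v hab, sign_mul, sign_pos h0, one_mul]
  unfold sgnVal
  rw [s1, s2, ← mul_add]
  congr 1
  have hsplit := hull_split (v := v) hab h0 h1
  have key := hν.union_add_inter _ _ (CC.hull (update v a ((1 - t) • v a + t • v b)))
    (CC.hull (update v b ((1 - t) • v a + t • v b))) (by
      rw [← hsplit]; exact convex_convexHull _ _)
  rw [← hsplit, hull_inter hv hab h0 h1,
    hs.hull_eq_zero hν (fun i : {i // i ≠ b} => update v a ((1 - t) • v a + t • v b) i)
      (by simp [Fintype.card_subtype_compl]), add_zero] at key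
  exact key

theorem Simple.edge_gt {ν : Set V → ℝ} (hν : IsVal ν) (hs : Simple ν)
    (v : Fin (Module.finrank ℝ V + 1) → V) {a b} (hab : a ≠ b) {t : ℝ} (h1 : 1 < t) :
    sgnVal ν v = sgnVal ν (update v a ((1 - t) • v a + t • v b)) +
      sgnVal ν (update v b ((1 - t) • v a + t • v b)) := by
  set w := (1 - t) • v a + t • v b with hw
  have hb : (1 - t⁻¹) • (update v b w) a + t⁻¹ • (update v b w) b = v b := by
    rw [update_self, update_of_ne hab, hw, smul_add, smul_smul, smul_smul,
      inv_mul_cancel₀ (by linarith), one_smul, ← add_assoc, ← add_smul,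
      show 1 - t⁻¹ + t⁻¹ * (1 - t) = 0 by field_simp; ring, zero_smul, zero_add]
  have key := hs.edge_aux hν (update v b w) hab (t := t⁻¹) (by positivity) (inv_lt_one_of_one_lt₀ h1)
  rw [hb, update_idem, update_eq_self] at key
  have e : update (update v b w) a (v b) = update v a w ∘ Equiv.swap a b := by
    ext1 i
    simp only [comp_apply]
    by_cases hia : i = a
    · subst hia; simp [hab.symm]
    by_cases hib : i = b
    · subst hib; simp [hia]
    rw [Equiv.swap_apply_of_ne_of_ne hia hib]
    simp [hia, hib]
  rw [e, sgnVal_swap _ _ hab] at key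
  linarith

theorem Simple.edge {ν : Set V → ℝ} (hν : IsVal ν) (hs : Simple ν)
    (v : Fin (Module.finrank ℝ V + 1) → V) {a b} (hab : a ≠ b) (t : ℝ) :
    sgnVal ν v = sgnVal ν (update v a ((1 - t) • v a + t • v b)) +
      sgnVal ν (update v b ((1 - t) • v a + t • v b)) := by
  rcases lt_trichotomy t 0 with h | rfl | h
  · have := hs.edge_gt hν v hab.symm (t := 1 - t) (by linarith)
    rw [add_comm] at this
    rw [this, show (1 - (1 - t)) • v b + (1 - t) • v a = (1 - t) • v a + t • v b by module]
  · rw [sgnVal_of_hdet (v := update v b _) (by rw [hdet_update_right v hab, zero_mul])]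
    simp
  rcases lt_trichotomy t 1 with h' | rfl | h'
  · exact hs.edge_aux hν v hab h h'
  · rw [sgnVal_of_hdet (v := update v a _) (by rw [hdet_update_left v hab]; simp)]
    simp
  · exact hs.edge_gt hν v hab h'

/-- A simple continuous valuation vanishing on nondegenerate orthoschemes is zero. -/
theorem Simple.eq_zero_of_orthoscheme {ν : Set V → ℝ} (hν : IsVal ν) (hs : Simple ν) (hc : HCont ν)
    (hO : ∀ v : ℕ → V, Ind (fun i : Fin (Module.finrank ℝ V + 1) => v i) →
      (∀ l, l + 2 ≤ Module.finrank ℝ V → ∀ j ≤ l + 1,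
        inner ℝ (v (l + 2) - v (l + 1)) (v j - v (l + 1)) = 0) →
      ν (convexHull ℝ (Set.range fun i : Fin (Module.finrank ℝ V + 1) => v i)) = 0)
    {K : Set V} (hK : CC K) : ν K = 0 := by
  set d := Module.finrank ℝ V with hd
  have hupd : ∀ (v : ℕ → V) a (ha : a ≤ d) w, (fun i : Fin (d + 1) => update v a w i) =
      update (fun i : Fin (d + 1) => v i) ⟨a, by omega⟩ w := fun v a ha w =>
    update_comp_eq_of_injective v Fin.val_injective ⟨a, by omega⟩ w
  have hz : ∀ v : ℕ → V, sgnVal ν (fun i : Fin (d + 1) => v i) = 0 := by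
    refine Hadwiger.eq_zero_of_orthoscheme (d := d) (fun v a b ha hb hab t => ?_)
      (fun v a b ha hb h => ?_) fun v hv => ?_
    · rw [hupd v a ha, hupd v b hb]
      exact hs.edge hν (fun i : Fin (d + 1) => v i) (a := ⟨a, by omega⟩) (b := ⟨b, by omega⟩)
        (by simpa using hab) t
    · rcases eq_or_ne a b with rfl | hab
      · simpa using h
      have hne : (⟨a, by omega⟩ : Fin (d + 1)) ≠ ⟨b, by omega⟩ := by simpa using hab
      have e := sgnVal_swap ν (fun i : Fin (d + 1) => v i) hne
      rw [← neg_eq_zero, ← e, ← h]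
      congr 1
      ext1 i
      simp only [comp_apply, Equiv.swap_apply_def, Fin.ext_iff]
      split_ifs <;> rfl
    · by_cases h : hdet (fun i : Fin (d + 1) => v i) = 0
      · exact sgnVal_of_hdet h
      · rw [sgnVal, hO v (hdet_ne_zero.1 h) hv, mul_zero]
  refine hν.eq_zero_of_simplex hc (fun ι _ v hv => ?_) hK
  rcases isEmpty_or_nonempty ι with hι | hι
  · simp [Set.range_eq_empty, hν.empty]
  rcases hv.card_le.lt_or_eq with h | h
  · exact hs.hull_eq_zero hν v (Nat.lt_succ_iff.1 h)
  · obtain ⟨m, w, hm, hr, hw⟩ := exists_nat_family v hv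
    obtain rfl : m = d := by omega
    rw [hr]
    have h1 := hz w
    rw [sgnVal] at h1
    refine (mul_eq_zero.1 h1).resolve_left ?_
    rcases lt_or_gt_of_ne (hdet_ne_zero.2 hw) with h | h
    · rw [sign_neg h]; simp
    · rw [sign_pos h]; simp

/-- Simple valuations vanishing on orthogonal products are homogeneous of degree one. -/
theorem Simple.two_smul {ν : Set V → ℝ} (hν : IsVal ν) (hs : Simple ν) (hT : TransInv ν)
    (hc : HCont ν) (hd : 1 ≤ Module.finrank ℝ V)
    (hprod : ∀ E : Submodule ℝ V, E ≠ ⊥ → E ≠ ⊤ → ∀ F G, CC F → F.Nonempty → CC G → G.Nonempty →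
      F ⊆ E → G ⊆ Eᗮ → ν (F + G) = 0) {K : Set V} (hK : CC K) : ν ((2 : ℝ) • K) = 2 * ν K := by
  set μ : Set V → ℝ := fun K => ν ((2 : ℝ) • K) + (-2) * ν K with hμ
  suffices H : μ K = 0 by simp only [hμ] at H; linarith
  have hsμ : Simple μ := fun u c K hu hK h => by
    have h2 : ν ((2 : ℝ) • K) = 0 := hs u (2 * c) _ hu (hK.smul _) (by
      rintro _ ⟨x, hx, rfl⟩
      simp [inner_smul_right, h x hx])
    simp only [hμ, h2, hs u c K hu hK h]
    ring
  refine hsμ.eq_zero_of_orthoscheme ((hν.smul _).add (hν.const_mul _)) ((hc.smul _).add (hc.const_mul _))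
    (fun v hv ho => ?_) hK
  set m := Module.finrank ℝ V with hm
  set u : ℕ → V := fun i => v (i + 1) - v i with hu
  have hune : ∀ i < m, u i ≠ 0 := fun i hi h => by
    have := hv.injective.ne (a₁ := ⟨i + 1, by omega⟩) (a₂ := ⟨i, by omega⟩) (by simp)
    apply this
    simp only
    rw [sub_eq_zero.1 h]
  have horth' : ∀ i j, i < j → j < m → inner ℝ (u j) (u i) = 0 := fun i j hij hj => by
    obtain ⟨l, rfl⟩ : ∃ l, j = l + 1 := ⟨j - 1, by omega⟩
    have h1 := ho l (by omega) (i + 1) (by omega)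
    have h2 := ho l (by omega) i (by omega)
    simp only [hu]
    rw [show v (i + 1) - v i = (v (i + 1) - v (l + 1)) - (v i - v (l + 1)) by abel, inner_sub_right]
    simp only [add_assoc, one_add_one_eq_two] at h1 h2 ⊢
    rw [h1, h2, sub_zero]
  have horth : ∀ i j, i < m → j < m → i ≠ j → inner ℝ (u i) (u j) = 0 := fun i j hi hj hij => by
    rcases lt_or_gt_of_ne hij with h | h
    · rw [real_inner_comm]; exact horth' i j h hj
    · exact horth' j i h hi
  set F := incMap u m with hF
  have hFin : ∀ (w : V) (x : ℕ → ℝ), (∀ i < m, x i ≠ 0 → inner ℝ w (u i) = 0) → inner ℝ w (F x) = 0 := by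
    intro w x h
    rw [hF, incMap_apply, inner_sum]
    refine Finset.sum_eq_zero fun i hi => ?_
    rw [inner_smul_right]
    by_cases h0 : x i = 0
    · rw [h0, zero_mul]
    · rw [h i (Finset.mem_range.1 hi) h0, mul_zero]
  have hO1 : ν (convexHull ℝ (Set.range fun i : Fin (m + 1) => v i)) = ν (F '' M 0 m 1) := by
    rw [hull_eq_image, hT _ _ ((CC.M _ _ _).image _)]
  have hO2 : ν ((2 : ℝ) • convexHull ℝ (Set.range fun i : Fin (m + 1) => v i)) =
      ν (F '' M 0 m (1 + 1)) := by
    rw [hull_eq_image, smul_translate_image _ _ _ (by norm_num), hT _ _ ((CC.M _ _ _).image _)]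
    norm_num
    rfl
  have hM0 : ∀ j l : ℕ, (M j l 1).Nonempty := fun j l => ⟨0, by simp [M]⟩
  have hdis := (hν.image F).dissect (hT.image F) zero_le_one (Nat.zero_le m)
  have hlow : ∀ l < m, ν (F '' (M 0 l 1 + M (l + 1) m 1)) = 0 := fun l hl => by
    refine hs (u l) 0 _ (hune l hl) (((CC.M _ _ _).add (CC.M _ _ _)).image _) ?_
    rintro _ ⟨_, ⟨x, hx, y, hy, rfl⟩, rfl⟩
    refine hFin _ _ fun i hi h0 => horth _ _ hl hi ?_
    rintro rfl
    exact h0 (by simp [hx.2.1 l le_rfl, hy.1 l (by omega)])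
  have hmid : ∀ l < m, l ≠ 0 → ν (F '' (M 0 l 1 + M l m 1)) = 0 := fun l hl hl0 => by
    rw [Set.image_add]
    have hE : ∀ j < m, l ≤ j → u j ∈ (Submodule.span ℝ (u '' Set.Iio l))ᗮ := fun j hj hlj => by
      rw [Submodule.mem_orthogonal]
      intro x hx
      refine Submodule.span_induction ?_ (by simp) (fun x y _ _ hx hy => ?_) (fun c x _ hx => ?_) hx
      · rintro _ ⟨i, hi, rfl⟩
        simp only [Set.mem_Iio] at hi
        exact horth _ _ (by omega) hj (by omega)
      · rw [inner_add_left, hx, hy, add_zero]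
      · rw [inner_smul_left, hx, mul_zero]
    refine hprod (Submodule.span ℝ (u '' Set.Iio l)) ?_ ?_ _ _ ((CC.M _ _ _).image _)
      ((hM0 _ _).image _) ((CC.M _ _ _).image _) ((hM0 _ _).image _) ?_ ?_
    · intro h
      have : u 0 ∈ Submodule.span ℝ (u '' Set.Iio l) :=
        Submodule.subset_span ⟨0, Nat.pos_of_ne_zero hl0, rfl⟩
      rw [h, Submodule.mem_bot] at this
      exact hune 0 (by omega) this
    · intro h
      have := hE l hl le_rfl
      rw [h, Submodule.top_orthogonal_eq_bot, Submodule.mem_bot] at this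
      exact hune l hl this
    · rintro _ ⟨x, hx, rfl⟩
      rw [hF, incMap_apply]
      refine Submodule.sum_mem _ fun i hi => ?_
      rcases lt_or_ge i l with h | h
      · exact Submodule.smul_mem _ _ (Submodule.subset_span ⟨i, h, rfl⟩)
      · rw [hx.2.1 i h, zero_smul]; exact Submodule.zero_mem _
    · rintro _ ⟨x, hx, rfl⟩
      rw [hF, incMap_apply]
      refine Submodule.sum_mem _ fun i hi => ?_
      rcases lt_or_ge i l with h | h
      · rw [hx.1 i h, zero_smul]; exact Submodule.zero_mem _
      · exact Submodule.smul_mem _ _ (hE i (Finset.mem_range.1 hi) h)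
  have hsum : ∑ l ∈ Finset.Ico 0 m, (ν (F '' (M 0 l 1 + M l m 1)) -
      ν (F '' (M 0 l 1 + M (l + 1) m 1))) = ν (F '' M 0 m 1) := by
    rw [Finset.sum_eq_single 0]
    · rw [hlow 0 (by omega), M_self 0 zero_le_one, Set.singleton_zero, zero_add, sub_zero]
    · intro l hl h0
      have hl' : l < m := (Finset.mem_Ico.1 hl).2
      rw [hlow l hl', hmid l hl' h0, sub_zero]
    · intro h; simp at h; omega
  change ν _ + (-2) * ν _ = 0
  rw [hO1, hO2, hdis, hsum, M_self m zero_le_one, Set.singleton_zero, add_zero]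
  ring

end SignedSimplex

section Support

variable {V : Type} [NormedAddCommGroup V] [InnerProductSpace ℝ V]

/-- The support function. -/
def supp (K : Set V) (v : V) : ℝ := sSup ((fun x => inner ℝ v x) '' K)

theorem supp_bddAbove {K : Set V} (hK : CC K) (v : V) : BddAbove ((fun x => inner ℝ v x) '' K) :=
  (hK.1.image (by fun_prop)).bddAbove

theorem le_supp {K : Set V} (hK : CC K) {x : V} (hx : x ∈ K) (v : V) : inner ℝ v x ≤ supp K v :=
  le_csSup (supp_bddAbove hK v) ⟨x, hx, rfl⟩

theorem supp_le {K : Set V} (hK' : K.Nonempty) {v : V} {c : ℝ} (h : ∀ x ∈ K, inner ℝ v x ≤ c) :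
    supp K v ≤ c :=
  csSup_le (hK'.image _) (by rintro _ ⟨x, hx, rfl⟩; exact h x hx)

theorem supp_add {K L : Set V} (hK : CC K) (hK' : K.Nonempty) (hL : CC L) (hL' : L.Nonempty)
    (v : V) : supp (K + L) v = supp K v + supp L v := by
  have : (fun x => inner ℝ v x) '' (K + L) =
      (fun x => inner ℝ v x) '' K + (fun x => inner ℝ v x) '' L := Set.image_add (innerSL ℝ v)
  rw [supp, this, csSup_add (hK'.image _) (supp_bddAbove hK v) (hL'.image _) (supp_bddAbove hL v)]
  rfl

theorem supp_smul {t : ℝ} (ht : 0 ≤ t) (K : Set V) (v : V) : supp (t • K) v = t * supp K v := by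
  have : (fun x => inner ℝ v x) '' (t • K) = t • (fun x => inner ℝ v x) '' K :=
    Set.image_smul_comm (innerSL ℝ v) t K (by simp)
  rw [supp, this, Real.sSup_smul_of_nonneg ht]
  rfl

variable [FiniteDimensional ℝ V]

theorem CC.closedBall (x : V) (R : ℝ) : CC (Metric.closedBall x R) :=
  ⟨isCompact_closedBall x R, convex_closedBall x R⟩

theorem supp_singleton_add_closedBall (z v : V) {R : ℝ} (hR : 0 ≤ R) (hv : ‖v‖ = 1) :
    supp ({z} + Metric.closedBall 0 R) v = inner ℝ z v + R := by
  apply le_antisymm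
  · refine supp_le ((Set.singleton_nonempty z).add ⟨0, by simpa using hR⟩) ?_
    rintro _ ⟨_, rfl, b, hb, rfl⟩
    simp only [inner_add_right]
    rw [real_inner_comm]
    have := real_inner_le_norm v b
    rw [hv, one_mul] at this
    linarith [mem_closedBall_zero_iff.1 hb]
  · refine le_trans (le_of_eq ?_) (le_supp ((CC.singleton z).add (CC.closedBall 0 R))
      (x := z + R • v) ⟨z, rfl, R • v, ?_, rfl⟩ v)
    · simp only [inner_add_right, inner_smul_right, real_inner_self_eq_norm_sq, hv]
      rw [real_inner_comm]
      ring
    · simp [norm_smul, hv, abs_of_nonneg hR]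

theorem subset_of_supp_le {K L : Set V} (hK : CC K) (hL : CC L) (hL' : L.Nonempty) {δ : ℝ}
    (hδ : 0 ≤ δ) (h : ∀ v : V, ‖v‖ = 1 → supp K v ≤ supp L v + δ) :
    K ⊆ L + Metric.closedBall 0 δ := by
  have := FiniteDimensional.complete ℝ V
  intro x hx
  by_contra hx'
  have hB := CC.closedBall (0 : V) δ
  obtain ⟨f, c, h1, h2⟩ := geometric_hahn_banach_closed_point (hL.add hB).2 (hL.add hB).1.isClosed hx'
  obtain ⟨w, rfl⟩ := (InnerProductSpace.toDual ℝ V).surjective f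
  simp only [InnerProductSpace.toDual_apply_apply] at h1 h2
  have hw : w ≠ 0 := by
    rintro rfl
    obtain ⟨l, hl⟩ := hL'
    have := h1 (l + 0) ⟨l, hl, 0, by simpa using hδ, rfl⟩
    simp at this h2
    linarith
  have hw0 : 0 < ‖w‖ := norm_pos_iff.2 hw
  have hv : ‖‖w‖⁻¹ • w‖ = 1 := by rw [norm_smul, norm_inv, norm_norm, inv_mul_cancel₀ hw0.ne']
  have e1 : supp L (‖w‖⁻¹ • w) + δ ≤ ‖w‖⁻¹ * c := by
    have hL1 : supp L (‖w‖⁻¹ • w) ≤ ‖w‖⁻¹ * c - δ := by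
      refine supp_le hL' fun l hl => ?_
      have := h1 (l + (δ * ‖w‖⁻¹) • w) ⟨l, hl, _, by
        rw [mem_closedBall_zero_iff, norm_smul, norm_mul, norm_inv, norm_norm, mul_assoc,
          inv_mul_cancel₀ hw0.ne', mul_one, Real.norm_of_nonneg hδ], rfl⟩
      rw [inner_add_right, inner_smul_right, real_inner_self_eq_norm_sq] at this
      rw [inner_smul_left, conj_trivial, le_sub_iff_add_le]
      have h3 : ‖w‖⁻¹ * (inner ℝ w l + δ * ‖w‖⁻¹ * ‖w‖ ^ 2) ≤ ‖w‖⁻¹ * c := by gcongr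
      refine le_trans (le_of_eq ?_) h3
      field_simp
    linarith
  have e2 := le_supp hK hx (‖w‖⁻¹ • w)
  rw [inner_smul_left, conj_trivial] at e2
  have e3 : ‖w‖⁻¹ * c < ‖w‖⁻¹ * inner ℝ w x := by gcongr
  linarith [h _ hv]

end Support

section Continuity

variable {V : Type} [NormedAddCommGroup V] [InnerProductSpace ℝ V]

theorem HCont.continuous_image {ν : Set V → ℝ} (hc : HCont ν) {K : Set V} (hK : CC K)
    (hK' : K.Nonempty) : Continuous fun A : V →L[ℝ] V => ν (A '' K) := by
  rw [Metric.continuous_iff]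
  intro A ε hε
  obtain ⟨δ, hδ, h⟩ := hc _ (hK.image A) (hK'.image A) ε hε
  obtain ⟨R, hR⟩ := hK.1.isBounded.subset_closedBall 0
  have key : ∀ B C : V →L[ℝ] V, ‖B - C‖ < δ / (|R| + 1) →
      B '' K ⊆ C '' K + Metric.closedBall 0 δ := by
    rintro B C hBC _ ⟨x, hx, rfl⟩
    refine ⟨C x, ⟨x, hx, rfl⟩, (B - C) x, ?_, by simp⟩
    rw [mem_closedBall_zero_iff]
    have hxR := mem_closedBall_zero_iff.1 (hR hx)
    have : ‖B - C‖ * ‖x‖ ≤ δ / (|R| + 1) * (|R| + 1) := by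
      gcongr
      linarith [le_abs_self R]
    rw [div_mul_cancel₀ _ (by positivity)] at this
    exact ((B - C).le_opNorm x).trans this
  refine ⟨δ / (|R| + 1), by positivity, fun B hB => ?_⟩
  rw [dist_eq_norm] at hB
  exact h _ (hK.image B) (hK'.image B) (key A B (by rwa [norm_sub_rev])) (key B A hB)

theorem HCont.smul_of_additive {ν : Set V → ℝ} (hc : HCont ν)
    (hadd : ∀ K L, CC K → K.Nonempty → CC L → L.Nonempty → ν (K + L) = ν K + ν L)
    {K : Set V} (hK : CC K) (hK' : K.Nonempty) {t : ℝ} (ht : 0 ≤ t) : ν (t • K) = t * ν K := by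
  have hnat : ∀ (k : ℕ) L, CC L → L.Nonempty → ν ((k : ℝ) • L) = k * ν L := by
    intro k L hL hL'
    induction k with
    | zero =>
      have := hadd {0} {0} (CC.singleton 0) (by simp) (CC.singleton 0) (by simp)
      have h0 : ν {0} = 0 := by simpa using this
      simp [Set.zero_smul_set hL', ← Set.singleton_zero, h0]
    | succ k ih =>
      push_cast
      rw [hL.2.add_smul (Nat.cast_nonneg _) zero_le_one, one_smul,
        hadd _ _ (hL.smul _) hL'.smul_set hL hL', ih]
      ring
  have hrat : ∀ q : ℚ, 0 ≤ q → ν ((q : ℝ) • K) = q * ν K := by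
    intro q hq
    have hd : (q.den : ℝ) ≠ 0 := by exact_mod_cast q.den_ne_zero
    have e : (q.den : ℝ) * q = q.num.toNat := by
      have h1 : ((q.num.toNat : ℤ) : ℝ) = (q.num : ℝ) := by
        rw [Int.toNat_of_nonneg (Rat.num_nonneg.2 hq)]
      rw [Int.cast_natCast] at h1
      rw [h1, mul_comm]
      exact_mod_cast Rat.mul_den_eq_num q
    have h1 := hnat q.den ((q : ℝ) • K) (hK.smul _) hK'.smul_set
    rw [smul_smul, e, hnat _ _ hK hK', ← e] at h1
    have := mul_left_cancel₀ hd ((mul_assoc _ _ _).symm.trans h1)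
    exact this.symm
  have hcont : Continuous fun t : ℝ => ν (|t| • K) := by
    have := (hc.continuous_image hK hK').comp
      (show Continuous fun t : ℝ => |t| • ContinuousLinearMap.id ℝ V by fun_prop)
    simpa only [Function.comp_def, image_smul_id] using this
  have hall : ∀ t : ℝ, ν (|t| • K) = |t| * ν K := fun t => by
    refine Rat.denseRange_cast.induction_on (p := fun t : ℝ => ν (|t| • K) = |t| * ν K) t
      (isClosed_eq hcont (by fun_prop)) fun q => ?_
    have := hrat |q| (abs_nonneg q)
    push_cast at this
    exact this
  simpa [abs_of_nonneg ht] using hall t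

end Continuity

section Average

open MeasureTheory

variable {V : Type} [NormedAddCommGroup V] [InnerProductSpace ℝ V] [FiniteDimensional ℝ V]

theorem continuous_supp_image {K : Set V} (hK : CC K) :
    Continuous fun p : (V →L[ℝ] V) × V => supp (p.1 '' K) p.2 := by
  have := hK.1.continuous_sSup (f := fun (p : (V →L[ℝ] V) × V) x => (inner ℝ p.2 (p.1 x) : ℝ))
    (by fun_prop)
  simpa only [supp, Set.image_image] using this

/-- Additive continuous functionals commute with weighted averages over compact families of linear
maps. -/
theorem HCont.average {ν : Set V → ℝ} (hc : HCont ν)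
    (hadd : ∀ K L, CC K → K.Nonempty → CC L → L.Nonempty → ν (K + L) = ν K + ν L)
    {G : Type} [TopologicalSpace G] [CompactSpace G] [MeasurableSpace G] [BorelSpace G]
    (μ : Measure G) [IsProbabilityMeasure μ] {φ : G → V →L[ℝ] V} (hφ : Continuous φ)
    {ρ : G → ℝ} (hρ : Continuous ρ) (hρ0 : ∀ g, 0 ≤ ρ g) {K T : Set V} (hK : CC K)
    (hK' : K.Nonempty) (hT : CC T) (hT' : T.Nonempty)
    (h : ∀ v : V, ‖v‖ = 1 → supp T v = ∫ g, ρ g * supp (φ g '' K) v ∂μ) :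
    ν T = ∫ g, ρ g * ν (φ g '' K) ∂μ := by
  set S := Metric.sphere (0 : V) 1
  have hcont : Continuous fun p : G × S => ρ p.1 * supp (φ p.1 '' K) (p.2 : V) := by
    have h1 := (continuous_supp_image hK).comp
      (show Continuous fun p : G × S => (φ p.1, (p.2 : V)) by fun_prop)
    exact (hρ.comp continuous_fst).mul h1
  set F1 : C(G, C(S, ℝ)) := ContinuousMap.curry ⟨_, hcont⟩ with hF1
  have hν2 : Continuous fun g => ρ g * ν (φ g '' K) :=
    hρ.mul ((hc.continuous_image hK hK').comp hφ)
  set F : G → C(S, ℝ) × ℝ := fun g => (F1 g, ρ g * ν (φ g '' K)) with hF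
  have hFc : Continuous F := by fun_prop
  have hFi : Integrable F μ := hFc.integrable_of_hasCompactSupport (HasCompactSupport.of_compactSpace F)
  set A : Set (C(S, ℝ) × ℝ) := {q | ∃ L : Set V, CC L ∧ L.Nonempty ∧ (∀ v : S, q.1 v = supp L v) ∧ q.2 = ν L}
    with hA
  have hAconv : Convex ℝ A := by
    rintro q ⟨L, hL, hL', h1, h2⟩ r ⟨M, hM, hM', h3, h4⟩ a b ha hb -
    refine ⟨a • L + b • M, (hL.smul a).add (hM.smul b), hL'.smul_set.add hM'.smul_set, fun v => ?_, ?_⟩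
    · rw [supp_add (hL.smul a) hL'.smul_set (hM.smul b) hM'.smul_set, supp_smul ha, supp_smul hb,
        ← h1, ← h3]
      rfl
    · rw [hadd _ _ (hL.smul a) hL'.smul_set (hM.smul b) hM'.smul_set,
        hc.smul_of_additive hadd hL hL' ha, hc.smul_of_additive hadd hM hM' hb, ← h2, ← h4]
      rfl
  have hFA : ∀ g, F g ∈ A := fun g => by
    refine ⟨ρ g • (φ g '' K), (hK.image _).smul _, (hK'.image _).smul_set, fun v => ?_, ?_⟩
    · rw [supp_smul (hρ0 g)]; rfl
    · rw [hc.smul_of_additive hadd (hK.image _) (hK'.image _) (hρ0 g)]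
  have hmem : ∫ g, F g ∂μ ∈ closure A :=
    hAconv.closure.integral_mem isClosed_closure
      (Filter.Eventually.of_forall fun g => subset_closure (hFA g)) hFi
  have hq1 : ∀ v : S, (∫ g, F g ∂μ).1 v = supp T v := fun v => by
    have := ContinuousLinearMap.integral_comp_comm
      ((ContinuousMap.evalCLM ℝ v).comp (ContinuousLinearMap.fst ℝ C(S, ℝ) ℝ)) hFi
    rw [h v (by simp)]
    exact this.symm
  have hq2 : (∫ g, F g ∂μ).2 = ∫ g, ρ g * ν (φ g '' K) ∂μ :=
    (ContinuousLinearMap.integral_comp_comm (ContinuousLinearMap.snd ℝ C(S, ℝ) ℝ) hFi).symm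
  rw [← hq2]
  refine eq_of_forall_dist_le fun ε hε => ?_
  obtain ⟨δ, hδ, hδ'⟩ := hc T hT hT' (ε / 2) (by positivity)
  obtain ⟨q, ⟨L, hL, hL', h1, h2⟩, hq⟩ := Metric.mem_closure_iff.1 hmem (min δ (ε / 2)) (by positivity)
  have hd1 : ∀ v : V, ‖v‖ = 1 → |supp T v - supp L v| ≤ δ := fun v hv => by
    have hv' : v ∈ S := mem_sphere_zero_iff_norm.2 hv
    rw [← hq1 ⟨v, hv'⟩, ← h1 ⟨v, hv'⟩]
    calc _ = dist ((∫ g, F g ∂μ).1 ⟨v, hv'⟩) (q.1 ⟨v, hv'⟩) := rfl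
      _ ≤ dist (∫ g, F g ∂μ).1 q.1 := ContinuousMap.dist_apply_le_dist _
      _ ≤ dist (∫ g, F g ∂μ) q := le_max_left _ _
      _ ≤ δ := hq.le.trans (min_le_left _ _)
  have hd2 : dist (∫ g, F g ∂μ).2 (ν L) ≤ ε / 2 := by
    rw [← h2]
    exact (le_max_right _ _).trans (hq.le.trans (min_le_right _ _))
  have hd3 : dist (ν T) (ν L) ≤ ε / 2 := by
    rw [dist_comm]
    refine (hδ' L hL hL' ?_ ?_).le
    · exact subset_of_supp_le hT hL hL' hδ.le fun v hv => by
        linarith [(abs_le.1 (hd1 v hv)).2]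
    · exact subset_of_supp_le hL hT hT' hδ.le fun v hv => by
        linarith [(abs_le.1 (hd1 v hv)).1]
  have := dist_triangle_right (ν T) (∫ g, F g ∂μ).2 (ν L)
  linarith

end Average

section Reflection

variable {V : Type} [NormedAddCommGroup V] [InnerProductSpace ℝ V]

/-- The reflection in the hyperplane orthogonal to `u`. -/
def refl (u : V) : V →L[ℝ] V :=
  ContinuousLinearMap.id ℝ V - (2 / ‖u‖ ^ 2) • (innerSL ℝ u).smulRight u

theorem refl_apply (u x : V) : refl u x = x - (2 / ‖u‖ ^ 2 * inner ℝ u x) • u := by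
  simp [refl, smul_smul]

theorem refl_of_inner_eq_zero {u x : V} (h : inner ℝ u x = 0) : refl u x = x := by
  simp [refl_apply, h]

theorem refl_self (u : V) : refl u u = -u := by
  rcases eq_or_ne u 0 with rfl | hu
  · simp
  · have : ‖u‖ ≠ 0 := norm_ne_zero_iff.2 hu
    rw [refl_apply, real_inner_self_eq_norm_sq, div_mul_cancel₀ _ (by positivity), two_smul]
    abel

theorem inner_refl_left (u x y : V) : inner ℝ (refl u x) y = inner ℝ x (refl u y) := by
  simp only [refl_apply, inner_sub_left, inner_sub_right, inner_smul_left, inner_smul_right,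
    conj_trivial]
  rw [real_inner_comm x u]
  ring

theorem refl_refl (u x : V) : refl u (refl u x) = x := by
  rcases eq_or_ne u 0 with rfl | hu
  · simp [refl_apply]
  · have : ‖u‖ ≠ 0 := norm_ne_zero_iff.2 hu
    conv_lhs => rw [refl_apply u x]
    rw [map_sub, map_smul, refl_self, refl_apply u x]
    module

theorem inner_refl_refl (u x y : V) : inner ℝ (refl u x) (refl u y) = inner ℝ x y := by
  rw [inner_refl_left, refl_refl]

theorem norm_refl (u x : V) : ‖refl u x‖ = ‖x‖ := by
  rw [← sq_eq_sq₀ (norm_nonneg _) (norm_nonneg _), ← real_inner_self_eq_norm_sq,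
    inner_refl_refl, real_inner_self_eq_norm_sq]

theorem refl_sub {v v' : V} (h : ‖v‖ = ‖v'‖) : refl (v - v') v = v' := by
  rcases eq_or_ne v v' with rfl | hv
  · simp [refl_apply]
  · have h0 : ‖v - v'‖ ^ 2 ≠ 0 := by
      have := norm_ne_zero_iff.2 (sub_ne_zero.2 hv)
      positivity
    have : 2 * inner ℝ (v - v') v = ‖v - v'‖ ^ 2 := by
      rw [norm_sub_sq_real, inner_sub_left, real_inner_self_eq_norm_sq, real_inner_comm, h]
      ring
    rw [refl_apply, div_mul_eq_mul_div, this, div_self h0, one_smul, sub_sub_cancel]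

theorem refl_image_closedBall (u : V) (R : ℝ) :
    refl u '' Metric.closedBall 0 R = Metric.closedBall 0 R := by
  ext x
  simp only [Set.mem_image, mem_closedBall_zero_iff]
  exact ⟨by rintro ⟨y, hy, rfl⟩; rwa [norm_refl], fun h => ⟨refl u x, by rwa [norm_refl], refl_refl u x⟩⟩

theorem exists_ne_zero_orthogonal [FiniteDimensional ℝ V] (h : 2 ≤ Module.finrank ℝ V) (x : V) :
    ∃ z : V, z ≠ 0 ∧ inner ℝ z x = 0 := by
  have : (ℝ ∙ x)ᗮ ≠ ⊥ := fun h0 => by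
    have h1 := (ℝ ∙ x).finrank_add_finrank_orthogonal
    rw [h0, finrank_bot] at h1
    have := finrank_span_le_card (R := ℝ) ({x} : Set V)
    simp at this
    omega
  obtain ⟨z, hz, hz0⟩ := Submodule.exists_mem_ne_zero_of_ne_bot this
  exact ⟨z, hz0, Submodule.mem_orthogonal_singleton_iff_inner_left.1 hz⟩

theorem exists_ne_zero_orthogonal_pair [FiniteDimensional ℝ V] (h : 3 ≤ Module.finrank ℝ V)
    (x y : V) : ∃ z : V, z ≠ 0 ∧ inner ℝ z x = 0 ∧ inner ℝ z y = 0 := by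
  have : (Submodule.span ℝ {x, y})ᗮ ≠ ⊥ := fun h0 => by
    have h1 := (Submodule.span ℝ {x, y}).finrank_add_finrank_orthogonal
    rw [h0, finrank_bot] at h1
    classical
    have h2 := finrank_span_finset_le_card (R := ℝ) ({x, y} : Finset V)
    have h3 := Finset.card_le_two (a := x) (b := y)
    rw [Set.finrank, Finset.coe_insert, Finset.coe_singleton] at h2
    omega
  obtain ⟨z, hz, hz0⟩ := Submodule.exists_mem_ne_zero_of_ne_bot this
  rw [Submodule.mem_orthogonal'] at hz
  exact ⟨z, hz0, hz x (Submodule.subset_span (by simp)), hz y (Submodule.subset_span (by simp))⟩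

end Reflection

section Haar

open MeasureTheory

variable {V : Type} [NormedAddCommGroup V] [InnerProductSpace ℝ V] [FiniteDimensional ℝ V]
  [CompleteSpace V]

/-- The product of two hyperplane reflections as a unitary operator. -/
def rot (u w : V) : unitary (V →L[ℝ] V) := ⟨refl u ∘L refl w, by
  have h : ∀ u : V, star (refl u) = refl u := fun u => by
    rw [ContinuousLinearMap.star_eq_adjoint, eq_comm, ContinuousLinearMap.eq_adjoint_iff]
    exact inner_refl_left u
  have h2 : ∀ u : V, refl u ∈ unitary (V →L[ℝ] V) := fun u => by
    rw [Unitary.mem_iff, h]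
    constructor <;> ext x <;> exact refl_refl u x
  exact mul_mem (h2 u) (h2 w)⟩

@[simp] theorem coe_rot (u w x : V) : (rot u w : V →L[ℝ] V) x = refl u (refl w x) := rfl

theorem inner_unitary (g : unitary (V →L[ℝ] V)) (x y : V) :
    inner ℝ ((g : V →L[ℝ] V) x) ((g : V →L[ℝ] V) y) = inner ℝ x y :=
  (Unitary.linearIsometryEquiv g).inner_map_map x y

theorem supp_unitary (g h : unitary (V →L[ℝ] V)) (K : Set V) (v : V) :
    supp (((h * g : unitary (V →L[ℝ] V)) : V →L[ℝ] V) '' K) ((h : V →L[ℝ] V) v) =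
      supp ((g : V →L[ℝ] V) '' K) v := by
  simp only [supp, Set.image_image]
  congr 1
  refine Set.image_congr fun x _ => ?_
  exact inner_unitary h _ _

instance : CompactSpace (unitary (V →L[ℝ] V)) := by
  have : ProperSpace (V →L[ℝ] V) := FiniteDimensional.proper ℝ _
  refine isCompact_iff_compactSpace.1 (Metric.isCompact_of_isClosed_isBounded isClosed_unitary ?_)
  refine (Metric.isBounded_closedBall (x := (0 : V →L[ℝ] V)) (r := 1)).subset fun g hg => ?_
  rw [mem_closedBall_zero_iff]
  exact (Unitary.linearIsometryEquiv ⟨g, hg⟩).toLinearIsometry.norm_toContinuousLinearMap_le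

/-- Invariant averages over a closed group of isometries. -/
structure IsMean (H : Subgroup (unitary (V →L[ℝ] V))) [MeasurableSpace H] (μ : Measure H) :
    Prop where
  prob : IsProbabilityMeasure μ
  left : ∀ (f : H → ℝ) h, ∫ g, f (h * g) ∂μ = ∫ g, f g ∂μ
  pos : ∀ f : H → ℝ, Continuous f → (∀ g, 0 ≤ f g) → f 1 ≠ 0 → 0 < ∫ g, f g ∂μ

theorem exists_isMean (H : Subgroup (unitary (V →L[ℝ] V)))
    (hH : IsClosed (H : Set (unitary (V →L[ℝ] V)))) :
    ∃ (_ : MeasurableSpace H) (_ : BorelSpace H) (μ : Measure H), CompactSpace H ∧ IsMean H μ := by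
  have : CompactSpace H := isCompact_iff_compactSpace.1 hH.isCompact
  let m : MeasurableSpace H := borel H
  have hm : BorelSpace H := ⟨rfl⟩
  refine ⟨m, hm, Measure.haarMeasure ⊤, this, ⟨?_⟩, ?_, ?_⟩
  · simpa using Measure.haarMeasure_self (K₀ := (⊤ : TopologicalSpace.PositiveCompacts H))
  · exact fun f h => integral_mul_left_eq_self f h
  · exact fun f hf h0 h1 => hf.integral_pos_of_hasCompactSupport_nonneg_nonzero
      (HasCompactSupport.of_compactSpace f) h0 h1

theorem continuous_supp_coe {K : Set V} (hK : CC K) (H : Subgroup (unitary (V →L[ℝ] V))) (v : V) :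
    Continuous fun g : H => supp (((g : unitary (V →L[ℝ] V)) : V →L[ℝ] V) '' K) v :=
  (continuous_supp_image hK).comp
    (show Continuous fun g : H => (((g : unitary (V →L[ℝ] V)) : V →L[ℝ] V), v) by fun_prop)

theorem exists_rot_eq (hd : 2 ≤ Module.finrank ℝ V) {v v' : V} (h : ‖v‖ = ‖v'‖) :
    ∃ u w : V, u ≠ 0 ∧ w ≠ 0 ∧ (rot u w : V →L[ℝ] V) v = v' := by
  obtain ⟨z, hz0, hz⟩ := exists_ne_zero_orthogonal hd v
  rcases eq_or_ne v v' with rfl | hv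
  · exact ⟨z, z, hz0, hz0, by rw [coe_rot, refl_refl]⟩
  · exact ⟨v - v', z, sub_ne_zero.2 hv, hz0, by rw [coe_rot, refl_of_inner_eq_zero hz, refl_sub h]⟩

theorem IsMean.exists_radius {H : Subgroup (unitary (V →L[ℝ] V))} [MeasurableSpace H] [BorelSpace H]
    [CompactSpace H] {μ : Measure H} (hμ : IsMean H μ) (hrot : ∀ u w, u ≠ 0 → w ≠ 0 → rot u w ∈ H)
    (hd : 2 ≤ Module.finrank ℝ V) {K : Set V} (hK : CC K) (hK' : K.Nonempty) :
    ∃ R, 0 ≤ R ∧ ∀ v : V, ‖v‖ = 1 →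
      ∫ g : H, supp (((g : unitary (V →L[ℝ] V)) : V →L[ℝ] V) '' K) v ∂μ = R := by
  have := hμ.prob
  set R : V → ℝ := fun v => ∫ g : H, supp (((g : unitary (V →L[ℝ] V)) : V →L[ℝ] V) '' K) v ∂μ
  have hinv : ∀ v v' : V, ‖v‖ = ‖v'‖ → R v' = R v := fun v v' h => by
    obtain ⟨u, w, hu, hw, rfl⟩ := exists_rot_eq hd h
    have h1 := hμ.left (fun g : H => supp (((g : unitary (V →L[ℝ] V)) : V →L[ℝ] V) '' K)
      ((rot u w : V →L[ℝ] V) v)) ⟨rot u w, hrot u w hu hw⟩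
    refine h1.symm.trans ?_
    exact integral_congr_ae (Filter.Eventually.of_forall fun g =>
      supp_unitary (g : unitary (V →L[ℝ] V)) (rot u w) K v)
  have hi : ∀ v, Integrable
      (fun g : H => supp (((g : unitary (V →L[ℝ] V)) : V →L[ℝ] V) '' K) v) μ := fun v =>
    (continuous_supp_coe hK H v).integrable_of_hasCompactSupport (HasCompactSupport.of_compactSpace _)
  have h0 : ∀ v, 0 ≤ R v := fun v => by
    have h1 : 0 ≤ R v + R (-v) := by
      rw [← integral_add (hi v) (hi (-v))]
      refine integral_nonneg fun g => ?_
      obtain ⟨x, hx⟩ := hK'.image ((g : unitary (V →L[ℝ] V)) : V →L[ℝ] V)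
      have h2 := le_supp (hK.image _) hx v
      have h3 := le_supp (hK.image _) hx (-v)
      rw [inner_neg_left] at h3
      simp only [Pi.zero_apply]
      linarith
    rw [hinv v (-v) (by simp)] at h1
    linarith
  have : Nontrivial V := Module.nontrivial_of_finrank_pos (R := ℝ) (by omega)
  obtain ⟨v₀, hv₀⟩ := exists_norm_eq V (zero_le_one (α := ℝ))
  exact ⟨R v₀, h0 v₀, fun v hv => hinv v₀ v (by rw [hv, hv₀])⟩

/-- A rotation invariant Minkowski additive functional which vanishes on segments is trivial. -/
theorem HCont.eq_zero_of_rot {ν : Set V → ℝ} (hc : HCont ν)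
    (hadd : ∀ K L, CC K → K.Nonempty → CC L → L.Nonempty → ν (K + L) = ν K + ν L)
    (hd : 2 ≤ Module.finrank ℝ V)
    (hrot : ∀ (u w : V) (K : Set V), u ≠ 0 → w ≠ 0 → CC K → ν (refl u '' (refl w '' K)) = ν K)
    (hseg : ∀ x : V, ν (segment ℝ (-x) x) = 0) {K : Set V} (hK : CC K) (hK' : K.Nonempty) :
    ν K = 0 := by
  let H : Subgroup (unitary (V →L[ℝ] V)) :=
    { carrier := {g | ∀ K, CC K → K.Nonempty → ν ((g : V →L[ℝ] V) '' K) = ν K}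
      mul_mem' := fun {g h} hg hh K hK hK' => by
        have : ((g * h : unitary (V →L[ℝ] V)) : V →L[ℝ] V) '' K =
            (g : V →L[ℝ] V) '' ((h : V →L[ℝ] V) '' K) := by
          rw [Set.image_image]; rfl
        rw [this, hg _ (hK.image _) (hK'.image _), hh K hK hK']
      one_mem' := fun K _ _ => by
        have : ((1 : unitary (V →L[ℝ] V)) : V →L[ℝ] V) '' K = K := Set.image_id K
        rw [this]
      inv_mem' := fun {g} hg K hK hK' => by
        have : (g : V →L[ℝ] V) '' (((g⁻¹ : unitary (V →L[ℝ] V)) : V →L[ℝ] V) '' K) = K := by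
          have h1 : (g : V →L[ℝ] V) * ((g⁻¹ : unitary (V →L[ℝ] V)) : V →L[ℝ] V) = 1 := by
            rw [← Submonoid.coe_mul, mul_inv_cancel, Submonoid.coe_one]
          rw [Set.image_image]
          exact (Set.image_congr fun x _ => congrArg (fun f : V →L[ℝ] V => f x) h1).trans
            (Set.image_id K)
        rw [← hg _ (hK.image _) (hK'.image _), this] }
  have hH : IsClosed (H : Set (unitary (V →L[ℝ] V))) := by
    have : (H : Set (unitary (V →L[ℝ] V))) = ⋂ (K : Set V) (_ : CC K) (_ : K.Nonempty),
        {g : unitary (V →L[ℝ] V) | ν ((g : V →L[ℝ] V) '' K) = ν K} := by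
      ext g; simp [H]
    rw [this]
    refine isClosed_iInter fun K => isClosed_iInter fun hK => isClosed_iInter fun hK' => ?_
    exact isClosed_eq ((hc.continuous_image hK hK').comp continuous_subtype_val) continuous_const
  have hrotH : ∀ u w, u ≠ 0 → w ≠ 0 → rot u w ∈ H := fun u w hu hw K hK _ => by
    rw [← hrot u w K hu hw hK, Set.image_image]; rfl
  obtain ⟨_, _, μ, _, hμ⟩ := exists_isMean H hH
  have := hμ.prob
  have key : ∀ {K : Set V}, CC K → K.Nonempty → ∃ R, 0 ≤ R ∧ (∀ v : V, ‖v‖ = 1 →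
      ∫ g : H, supp (((g : unitary (V →L[ℝ] V)) : V →L[ℝ] V) '' K) v ∂μ = R) ∧
      ν K = R * ν (Metric.closedBall 0 1) := by
    intro K hK hK'
    obtain ⟨R, hR, h⟩ := hμ.exists_radius hrotH hd hK hK'
    refine ⟨R, hR, h, ?_⟩
    have h1 := hc.average hadd μ (φ := fun g : H => ((g : unitary (V →L[ℝ] V)) : V →L[ℝ] V))
      (by fun_prop) (ρ := fun _ => 1) continuous_const (by simp) hK hK'
      ((CC.singleton 0).add (CC.closedBall (0 : V) R))
      ((Set.singleton_nonempty _).add ⟨0, by simpa using hR⟩) fun v hv => by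
        rw [supp_singleton_add_closedBall 0 v hR hv]
        simp [h v hv]
    have h2 : ∀ g : H, ν (((g : unitary (V →L[ℝ] V)) : V →L[ℝ] V) '' K) = ν K := fun g =>
      g.2 K hK hK'
    simp only [h2, integral_const, one_mul, probReal_univ, smul_eq_mul,
      Set.singleton_zero, zero_add] at h1
    rw [← h1, ← hc.smul_of_additive hadd (CC.closedBall 0 1) (by simp) hR,
      smul_unitClosedBall_of_nonneg hR]
  have hB : ν (Metric.closedBall 0 1) = 0 := by
    have : Nontrivial V := Module.nontrivial_of_finrank_pos (R := ℝ) (by omega)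
    obtain ⟨y, hy⟩ := exists_norm_eq V (zero_le_one (α := ℝ))
    have hS : CC (segment ℝ (-y) y) := ⟨by
      rw [← convexHull_pair (𝕜 := ℝ)]
      exact (Set.toFinite ({-y, y} : Set V)).isCompact_convexHull ℝ, convex_segment _ _⟩
    have hS' : (segment ℝ (-y) y).Nonempty := ⟨y, right_mem_segment ℝ _ _⟩
    obtain ⟨R, -, h, h1⟩ := key hS hS'
    have hpos : 0 < R := by
      rw [← h y hy]
      refine hμ.pos _ (continuous_supp_coe hS H y) (fun g => ?_) ?_
      · have h2 := le_supp (hS.image ((g : unitary (V →L[ℝ] V)) : V →L[ℝ] V))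
          ⟨y, right_mem_segment ℝ _ _, rfl⟩ y
        have h3 := le_supp (hS.image ((g : unitary (V →L[ℝ] V)) : V →L[ℝ] V))
          ⟨-y, left_mem_segment ℝ _ _, rfl⟩ y
        rw [map_neg, inner_neg_right] at h3
        linarith
      · have h2 := le_supp (hS.image (((1 : H) : unitary (V →L[ℝ] V)) : V →L[ℝ] V))
          ⟨y, right_mem_segment ℝ _ _, rfl⟩ y
        have h3 : inner ℝ y ((((1 : H) : unitary (V →L[ℝ] V)) : V →L[ℝ] V) y) = (1 : ℝ) := by
          have := real_inner_self_eq_norm_sq y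
          rw [hy, one_pow] at this
          exact this
        rw [h3] at h2
        linarith
    rw [hseg] at h1
    exact (mul_eq_zero.1 h1.symm).resolve_left hpos.ne'
  obtain ⟨R, -, -, h⟩ := key hK hK'
  rw [h, hB, mul_zero]

end Haar

section Vector

open MeasureTheory

variable {V : Type} [NormedAddCommGroup V] [InnerProductSpace ℝ V] [FiniteDimensional ℝ V]
  [CompleteSpace V]

/-- A translation invariant, rotation equivariant Minkowski additive vector valued functional is
trivial. -/
theorem HCont.vector_eq_zero {p : Set V → V} (hc : ∀ w, HCont fun K => inner ℝ (p K) w)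
    (hadd : ∀ K L, CC K → K.Nonempty → CC L → L.Nonempty → p (K + L) = p K + p L)
    (hT : ∀ (x : V) (K : Set V), CC K → p ({x} + K) = p K)
    (hd : 2 ≤ Module.finrank ℝ V)
    (hrot : ∀ (u w : V) (K : Set V), u ≠ 0 → w ≠ 0 → CC K →
      p (refl u '' (refl w '' K)) = refl u (refl w (p K)))
    (hrefl : Module.finrank ℝ V = 2 → ∀ (u : V) (K : Set V), CC K → p (refl u '' K) = refl u (p K))
    {K : Set V} (hK : CC K) (hK' : K.Nonempty) : p K = 0 := by
  let H : Subgroup (unitary (V →L[ℝ] V)) :=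
    { carrier := {g | ∀ K, CC K → K.Nonempty → p ((g : V →L[ℝ] V) '' K) = (g : V →L[ℝ] V) (p K)}
      mul_mem' := fun {g h} hg hh K hK hK' => by
        have : ((g * h : unitary (V →L[ℝ] V)) : V →L[ℝ] V) '' K =
            (g : V →L[ℝ] V) '' ((h : V →L[ℝ] V) '' K) := by
          rw [Set.image_image]; rfl
        rw [this, hg _ (hK.image _) (hK'.image _), hh K hK hK']
        rfl
      one_mem' := fun K _ _ => by
        have : ((1 : unitary (V →L[ℝ] V)) : V →L[ℝ] V) '' K = K := Set.image_id K
        rw [this]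
        rfl
      inv_mem' := fun {g} hg K hK hK' => by
        have h1 : ∀ x, (g : V →L[ℝ] V) (((g⁻¹ : unitary (V →L[ℝ] V)) : V →L[ℝ] V) x) = x := by
          have h1 : (g : V →L[ℝ] V) * ((g⁻¹ : unitary (V →L[ℝ] V)) : V →L[ℝ] V) = 1 := by
            rw [← Submonoid.coe_mul, mul_inv_cancel, Submonoid.coe_one]
          exact fun x => congrArg (fun f : V →L[ℝ] V => f x) h1
        have h2 : ∀ x, ((g⁻¹ : unitary (V →L[ℝ] V)) : V →L[ℝ] V) ((g : V →L[ℝ] V) x) = x := by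
          have h1 : ((g⁻¹ : unitary (V →L[ℝ] V)) : V →L[ℝ] V) * (g : V →L[ℝ] V) = 1 := by
            rw [← Submonoid.coe_mul, inv_mul_cancel, Submonoid.coe_one]
          exact fun x => congrArg (fun f : V →L[ℝ] V => f x) h1
        have h3 := hg _ (hK.image ((g⁻¹ : unitary (V →L[ℝ] V)) : V →L[ℝ] V)) (hK'.image _)
        rw [Set.image_image] at h3
        simp only [h1, Set.image_id'] at h3
        rw [h3, h2] }
  have hH : IsClosed (H : Set (unitary (V →L[ℝ] V))) := by
    have : (H : Set (unitary (V →L[ℝ] V))) = ⋂ (w : V) (K : Set V) (_ : CC K) (_ : K.Nonempty),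
        {g : unitary (V →L[ℝ] V) |
          inner ℝ (p ((g : V →L[ℝ] V) '' K)) w = inner ℝ ((g : V →L[ℝ] V) (p K)) w} := by
      ext g
      simp only [Set.mem_iInter, Set.mem_ofPred_eq]
      exact ⟨fun h w K hK hK' => by rw [h K hK hK'],
        fun h K hK hK' => ext_inner_right ℝ fun w => h w K hK hK'⟩
    rw [this]
    refine isClosed_iInter fun w => isClosed_iInter fun K => isClosed_iInter fun hK =>
      isClosed_iInter fun hK' => isClosed_eq
        (((hc w).continuous_image hK hK').comp continuous_subtype_val) ?_
    fun_prop
  have hrotH : ∀ u w, u ≠ 0 → w ≠ 0 → rot u w ∈ H := fun u w hu hw K hK _ => by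
    rw [coe_rot, ← hrot u w K hu hw hK, Set.image_image]; rfl
  obtain ⟨_, _, μ, _, hμ⟩ := exists_isMean H hH
  have := hμ.prob
  have hadd' : ∀ w K L, CC K → K.Nonempty → CC L → L.Nonempty →
      inner ℝ (p (K + L)) w = inner ℝ (p K) w + inner ℝ (p L) w :=
    fun w K L hK hK' hL hL' => by rw [hadd K L hK hK' hL hL', inner_add_left]
  have hball : ∀ R : ℝ, p (Metric.closedBall 0 R) = 0 := fun R => by
    set z := p (Metric.closedBall 0 R) with hz
    obtain ⟨y, hy0, hy⟩ := exists_ne_zero_orthogonal hd z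
    by_contra hz0
    have h1 := hrot z y _ hz0 hy0 (CC.closedBall (0 : V) R)
    rw [refl_image_closedBall, refl_image_closedBall, ← hz, refl_of_inner_eq_zero hy,
      refl_self] at h1
    have h2 : (2 : ℝ) • z = 0 := by rw [two_smul, ← sub_neg_eq_add, ← h1, sub_self]
    exact hz0 ((smul_eq_zero.1 h2).resolve_left two_ne_zero)
  obtain ⟨R, hR, hRv⟩ := hμ.exists_radius hrotH hd hK hK'
  set w := p K with hw
  set G : H → V →L[ℝ] V := fun g => ((g : unitary (V →L[ℝ] V)) : V →L[ℝ] V) with hG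
  have hGc : Continuous G := by fun_prop
  have hpG : ∀ g, p (G g '' K) = G g w := fun g => g.2 K hK hK'
  have hzc : ∀ z : V, p ({z} + Metric.closedBall 0 R) = 0 := fun z => by
    rw [hT z _ (CC.closedBall 0 R), hball]
  have hnz : ∀ z : V, ({z} + Metric.closedBall (0 : V) R).Nonempty := fun z =>
    (Set.singleton_nonempty _).add ⟨0, by simpa using hR⟩
  have hzero : ∫ g, inner ℝ (G g w) w ∂μ = 0 := by
    have h1 := (hc w).average (hadd' w) μ hGc (ρ := fun _ => 1) continuous_const (by simp) hK hK'
      ((CC.singleton 0).add (CC.closedBall (0 : V) R)) (hnz 0) fun v hv => by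
        rw [supp_singleton_add_closedBall 0 v hR hv]
        simp [hG, hRv v hv]
    simp only [hpG, hzc, one_mul, inner_zero_left] at h1
    exact h1.symm
  have hi : ∀ f : H → ℝ, Continuous f → Integrable f μ := fun f hf =>
    hf.integrable_of_hasCompactSupport (HasCompactSupport.of_compactSpace _)
  have hsupp : ∀ v, Continuous fun g => supp (G g '' K) v := continuous_supp_coe hK H
  set Y : V → V → ℝ := fun v z => ∫ g, supp (G g '' K) v * inner ℝ (G g w) z ∂μ with hY
  have hYadd : ∀ v z z', Y v (z + z') = Y v z + Y v z' := fun v z z' => by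
    simp only [hY, inner_add_right, mul_add]
    exact integral_add (hi _ (by fun_prop)) (hi _ (by fun_prop))
  have hYsmul : ∀ v (t : ℝ) z, Y v (t • z) = t * Y v z := fun v t z => by
    simp only [hY, inner_smul_right, mul_left_comm _ t]
    exact integral_const_mul t _
  have hYinv : ∀ (h : H) v z, Y (G h v) (G h z) = Y v z := fun h v z => by
    refine (hμ.left (fun g => supp (G g '' K) (G h v) * inner ℝ (G g w) (G h z)) h).symm.trans ?_
    refine integral_congr_ae (Filter.Eventually.of_forall fun g => ?_)
    have e1 := supp_unitary (g : unitary (V →L[ℝ] V)) h K v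
    have e2 := inner_unitary (h : unitary (V →L[ℝ] V)) (G g w) z
    exact congrArg₂ (· * ·) e1 e2
  have hrefl0 : ∀ x : V, refl 0 x = x := fun x => by simp [refl_apply]
  have hYneg : ∀ v y : V, ∀ h ∈ H, (h : V →L[ℝ] V) v = v → (h : V →L[ℝ] V) y = -y → Y v y = 0 := by
    intro v y h hh h1 h2
    have h3 := hYinv ⟨h, hh⟩ v y
    have h4 : G ⟨h, hh⟩ v = v := h1
    have h5 : G ⟨h, hh⟩ y = (-1 : ℝ) • y := by rw [neg_one_smul]; exact h2
    rw [h4, h5, hYsmul] at h3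
    linarith
  have hYperp : ∀ v y : V, inner ℝ y v = 0 → Y v y = 0 := fun v y hvy => by
    by_cases h3 : 3 ≤ Module.finrank ℝ V
    · rcases eq_or_ne y 0 with rfl | hy0
      · simp [hY]
      obtain ⟨z, hz0, hz1, hz2⟩ := exists_ne_zero_orthogonal_pair h3 v y
      refine hYneg v y (rot y z) (hrotH y z hy0 hz0) ?_ ?_
      · rw [coe_rot, refl_of_inner_eq_zero hz1, refl_of_inner_eq_zero hvy]
      · rw [coe_rot, refl_of_inner_eq_zero hz2, refl_self]
    · refine hYneg v y (rot y 0) (fun K hK _ => ?_) ?_ ?_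
      · have h4 : ((rot y 0 : unitary (V →L[ℝ] V)) : V →L[ℝ] V) '' K = refl y '' K :=
          Set.image_congr fun x _ => by rw [coe_rot, hrefl0]
        rw [h4, coe_rot, hrefl0]
        exact hrefl (by omega) y K hK
      · rw [coe_rot, hrefl0, refl_of_inner_eq_zero hvy]
      · rw [coe_rot, hrefl0, refl_self]
  have : Nontrivial V := Module.nontrivial_of_finrank_pos (R := ℝ) (by omega)
  obtain ⟨v₀, hv₀⟩ := exists_norm_eq V (zero_le_one (α := ℝ))
  have hYw : ∀ v z : V, ‖v‖ = 1 → Y v z = Y v₀ v₀ * inner ℝ v z := fun v z hv => by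
    obtain ⟨a, b, ha, hb, hab⟩ := exists_rot_eq hd (hv₀.trans hv.symm)
    have h1 : Y v v = Y v₀ v₀ := by
      rw [← hYinv ⟨rot a b, hrotH a b ha hb⟩ v₀ v₀]
      exact (congrArg₂ Y hab hab).symm
    have h2 : z = (inner ℝ v z : ℝ) • v + (z - (inner ℝ v z : ℝ) • v) := by abel
    conv_lhs => rw [h2]
    rw [hYadd, hYsmul, h1, hYperp v, add_zero, mul_comm]
    rw [inner_sub_left, inner_smul_left, real_inner_self_eq_norm_sq, hv, conj_trivial,
      real_inner_comm]
    ring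
  have hρ0 : ∀ g, 0 ≤ ‖w‖ ^ 2 + inner ℝ (G g w) w := fun g => by
    have h1 := (abs_le.1 (abs_real_inner_le_norm (G g w) w)).1
    have h2 : ‖G g w‖ = ‖w‖ := (Unitary.linearIsometryEquiv (g : unitary (V →L[ℝ] V))).norm_map w
    rw [h2] at h1
    linarith [sq ‖w‖]
  have hfin := (hc w).average (hadd' w) μ hGc (ρ := fun g => ‖w‖ ^ 2 + inner ℝ (G g w) w)
    (by fun_prop) hρ0 hK hK'
    ((CC.singleton (Y v₀ v₀ • w)).add (CC.closedBall (0 : V) (‖w‖ ^ 2 * R)))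
    ((Set.singleton_nonempty _).add ⟨0, by simp; positivity⟩) fun v hv => by
      rw [supp_singleton_add_closedBall _ v (by positivity) hv]
      simp only [add_mul]
      rw [integral_add (hi _ (by fun_prop)) (hi _ (by fun_prop)), integral_const_mul, hRv v hv,
        inner_smul_left, conj_trivial, add_comm, real_inner_comm, ← hYw v w hv]
      simp only [hY, mul_comm]
  have hfin' : ∫ g, inner ℝ (G g w) w * inner ℝ (G g w) w ∂μ = 0 := by
    simp only [hT _ _ (CC.closedBall (0 : V) (‖w‖ ^ 2 * R)), hball, inner_zero_left, hpG,
      add_mul] at hfin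
    rw [integral_add (hi _ (by fun_prop)) (hi _ (by fun_prop)), integral_const_mul, hzero] at hfin
    linarith
  by_contra hw0
  refine (hμ.pos (fun g => inner ℝ (G g w) w * inner ℝ (G g w) w) (by fun_prop)
    (fun g => mul_self_nonneg _) ?_).ne' hfin'
  have h1 : G 1 w = w := rfl
  simp [h1, hw0]

end Vector

section Cube

variable {V : Type} [NormedAddCommGroup V] [InnerProductSpace ℝ V]

/-- The parallelepiped spanned by `e`; a cube if `e` is orthonormal. -/
def cub {ι : Type} [Fintype ι] (e : ι → V) : Set V :=
  (fun t : ι → ℝ => ∑ i, t i • e i) '' Set.Icc 0 1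

theorem CC.cub {ι : Type} [Fintype ι] (e : ι → V) : CC (cub e) := by
  have h : CC (Set.Icc (0 : ι → ℝ) 1) := ⟨isCompact_Icc, convex_Icc 0 1⟩
  have := h.image (∑ i, (ContinuousLinearMap.proj i : (ι → ℝ) →L[ℝ] ℝ).smulRight (e i))
  rwa [show ⇑(∑ i, (ContinuousLinearMap.proj i : (ι → ℝ) →L[ℝ] ℝ).smulRight (e i)) =
    fun t : ι → ℝ => ∑ i, t i • e i from funext fun t => by simp] at this

theorem cub_nonempty {ι : Type} [Fintype ι] (e : ι → V) : (cub e).Nonempty :=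
  Set.Nonempty.image _ ⟨0, by simp⟩

theorem cub_subset {ι : Type} [Fintype ι] {e : ι → V} {E : Submodule ℝ V} (h : ∀ i, e i ∈ E) :
    cub e ⊆ E := by
  rintro _ ⟨t, -, rfl⟩
  exact E.sum_mem fun i _ => E.smul_mem _ (h i)

theorem cub_sumElim {ι κ : Type} [Fintype ι] [Fintype κ] (e : ι → V) (f : κ → V) :
    cub (Sum.elim e f) = cub e + cub f := by
  ext x
  constructor
  · rintro ⟨t, ht, rfl⟩
    refine ⟨_, ⟨fun i => t (Sum.inl i), ⟨fun i => ht.1 _, fun i => ht.2 _⟩, rfl⟩,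
      _, ⟨fun i => t (Sum.inr i), ⟨fun i => ht.1 _, fun i => ht.2 _⟩, rfl⟩, ?_⟩
    simp
  · rintro ⟨_, ⟨t, ht, rfl⟩, _, ⟨s, hs, rfl⟩, rfl⟩
    refine ⟨Sum.elim t s, ⟨?_, ?_⟩, by simp⟩
    · rintro (i | i)
      exacts [ht.1 i, hs.1 i]
    · rintro (i | i)
      exacts [ht.2 i, hs.2 i]

theorem image_cub {W : Type} [NormedAddCommGroup W] [InnerProductSpace ℝ W] {ι : Type} [Fintype ι]
    (e : ι → V) (f : V →L[ℝ] W) : f '' cub e = cub fun i => f (e i) := by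
  simp only [cub, Set.image_image, map_sum, map_smul]

theorem orthonormal_sumElim {E : Submodule ℝ V} {ι κ : Type} {e : ι → E} {f : κ → Eᗮ}
    (he : Orthonormal ℝ e) (hf : Orthonormal ℝ f) :
    Orthonormal ℝ (Sum.elim (fun i => (e i : V)) fun i => (f i : V)) := by
  refine ⟨?_, ?_⟩
  · rintro (i | i)
    exacts [he.1 i, hf.1 i]
  · rintro (i | i) (j | j) hij
    · exact he.2 fun h => hij (by rw [h])
    · exact E.inner_right_of_mem_orthogonal (e i).2 (f j).2
    · exact E.inner_left_of_mem_orthogonal (e j).2 (f i).2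
    · exact hf.2 fun h => hij (by rw [h])

theorem coe_refl (E : Submodule ℝ V) (u x : E) : ((refl u x : E) : V) = refl (u : V) (x : V) := by
  simp [refl_apply]

theorem refl_image_coe (E : Submodule ℝ V) (u : E) (F : Set E) :
    refl (u : V) '' (E.subtypeL '' F) = E.subtypeL '' (refl u '' F) := by
  rw [Set.image_image, Set.image_image]
  exact Set.image_congr fun x _ => (coe_refl E u x).symm

theorem refl_image_of_orthogonal {E : Submodule ℝ V} {u : V} (hu : u ∈ E) {Q : Set V}
    (hQ : Q ⊆ Eᗮ) : refl u '' Q = Q :=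
  (Set.image_congr fun _ hx =>
    refl_of_inner_eq_zero (E.inner_right_of_mem_orthogonal hu (hQ hx))).trans (Set.image_id Q)

theorem refl_image_add {E : Submodule ℝ V} (u : E) (F : Set E) {Q : Set V} (hQ : Q ⊆ Eᗮ) :
    refl (u : V) '' (E.subtypeL '' F + Q) = E.subtypeL '' (refl u '' F) + Q := by
  rw [Set.image_add, refl_image_coe, refl_image_of_orthogonal u.2 hQ]

end Cube

section Scalar

/-- Continuous, translation and rotation invariant valuations. -/
structure InvVal {V : Type} [NormedAddCommGroup V] [InnerProductSpace ℝ V] (ν : Set V → ℝ) :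
    Prop where
  isVal : IsVal ν
  transInv : TransInv ν
  hcont : HCont ν
  rot : ∀ (u w : V) (K : Set V), u ≠ 0 → w ≠ 0 → CC K → ν (refl u '' (refl w '' K)) = ν K

variable {V : Type} [NormedAddCommGroup V] [InnerProductSpace ℝ V]

theorem InvVal.sub {ν : Set V → ℝ} (h : InvVal ν) (E : Submodule ℝ V) {Q : Set V} (hQ : CC Q)
    (hQ' : Q.Nonempty) (hQE : Q ⊆ Eᗮ) : InvVal fun F : Set E => ν (E.subtypeL '' F + Q) where
  isVal := (h.isVal.add_right hQ).image E.subtypeL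
  transInv := (h.transInv.add_right hQ).image E.subtypeL
  hcont := (h.hcont.add_right hQ hQ').image E.subtypeL
  rot u w K hu hw hK := by
    rw [← refl_image_add _ _ hQE, ← refl_image_add _ _ hQE,
      h.rot _ _ _ (by simpa using hu) (by simpa using hw) ((hK.image _).add hQ)]

theorem Simple.sub {ν : Set V → ℝ} (h : Simple ν) (E : Submodule ℝ V) {Q : Set V} (hQ : CC Q)
    (hQE : Q ⊆ Eᗮ) : Simple fun F : Set E => ν (E.subtypeL '' F + Q) := by
  intro u c K hu hK hc
  refine h (u : V) c _ (by simpa using hu) ((hK.image _).add hQ) ?_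
  rintro _ ⟨_, ⟨x, hx, rfl⟩, q, hq, rfl⟩
  have := hc x hx
  simp only [inner_add_right, E.inner_right_of_mem_orthogonal u.2 (hQE hq), add_zero]
  exact this

theorem subtypeL_image_preimage {E : Submodule ℝ V} {F : Set V} (h : F ⊆ E) :
    E.subtypeL '' (E.subtypeL ⁻¹' F) = F :=
  Set.image_preimage_eq_of_subset fun _ hx => ⟨⟨_, h hx⟩, rfl⟩

theorem CC.preimage_subtypeL [FiniteDimensional ℝ V] {E : Submodule ℝ V} {F : Set V} (hF : CC F) :
    CC (E.subtypeL ⁻¹' F) :=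
  ⟨(Topology.IsClosedEmbedding.isCompact_preimage
    (E.closed_of_finiteDimensional.isClosedEmbedding_subtypeVal) hF.1),
    hF.2.linear_preimage E.subtype⟩

theorem Simple.eq_zero_of_finrank_one [FiniteDimensional ℝ V] (hd : Module.finrank ℝ V = 1)
    {ν : Set V → ℝ} (hT : TransInv ν) (hc : HCont ν)
    (hadd : ∀ K L, CC K → K.Nonempty → CC L → L.Nonempty → ν (K + L) = ν K + ν L)
    (hcub : ∀ (ι : Type) [Fintype ι] (e : ι → V), Orthonormal ℝ e →
      Fintype.card ι = Module.finrank ℝ V → ν (cub e) = 0)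
    {K : Set V} (hK : CC K) (hK' : K.Nonempty) : ν K = 0 := by
  have : Nontrivial V := Module.nontrivial_of_finrank_pos (R := ℝ) (by omega)
  obtain ⟨e, he⟩ := exists_norm_eq V (zero_le_one (α := ℝ))
  have he0 : e ≠ 0 := by rintro rfl; simp at he
  have hx : ∀ x : V, (inner ℝ e x : ℝ) • e = x := fun x => by
    obtain ⟨c, rfl⟩ := exists_smul_eq_of_finrank_eq_one hd he0 x
    rw [inner_smul_right, real_inner_self_eq_norm_sq, he, one_pow, mul_one]
  set S : Set ℝ := (fun x => inner ℝ e x) '' K with hS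
  have hSK : (fun t : ℝ => t • e) '' S = K := by
    rw [hS, Set.image_image]
    simp [hx]
  have hSI := eq_Icc_of_connected_compact
    ⟨hK'.image _, (hK.2.isPreconnected).image _ (by fun_prop)⟩
    (hK.1.image (f := fun x => (inner ℝ e x : ℝ)) (by fun_prop))
  rw [← hS] at hSI
  set a := sInf S
  set b := sSup S
  have hab : a ≤ b := Set.nonempty_Icc.1 (hSI ▸ hK'.image _)
  have hKe : K = {a • e} + (b - a) • cub fun _ : Unit => e := by
    rw [← hSK, hSI]
    ext x
    simp only [cub, Set.singleton_add, Set.mem_image, ← Set.image_smul]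
    constructor
    · rintro ⟨t, ht, rfl⟩
      rcases hab.eq_or_lt with h | h
      · exact ⟨_, ⟨_, ⟨0, by simp, rfl⟩, rfl⟩, by simp; rw [le_antisymm (h ▸ ht.2) ht.1]⟩
      · have h0 : 0 < b - a := sub_pos.2 h
        refine ⟨_, ⟨_, ⟨fun _ => (t - a) / (b - a), ⟨fun _ => ?_, fun _ => ?_⟩, rfl⟩, rfl⟩, ?_⟩
        · exact div_nonneg (by linarith [ht.1]) h0.le
        · exact (div_le_one h0).2 (by linarith [ht.2])
        · simp only [Finset.univ_unique, Finset.sum_const, Finset.card_singleton, one_smul,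
            smul_smul, mul_div_cancel₀ _ h0.ne', ← add_smul]
          congr 1
          ring
    · rintro ⟨_, ⟨_, ⟨t, ht, rfl⟩, rfl⟩, rfl⟩
      refine ⟨a + (b - a) * t (), ⟨?_, ?_⟩, ?_⟩
      · have := mul_nonneg (sub_nonneg.2 hab) (ht.1 ())
        linarith
      · have := mul_le_mul_of_nonneg_left (ht.2 ()) (sub_nonneg.2 hab)
        simp at this
        linarith
      · simp [add_smul, smul_smul]
  have ho : Orthonormal ℝ fun _ : Unit => e :=
    ⟨fun _ => he, fun i j hij => absurd (Subsingleton.elim i j) hij⟩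
  rw [hKe, hT _ _ ((CC.cub _).smul _),
    hc.smul_of_additive hadd (CC.cub _) (cub_nonempty _) (sub_nonneg.2 hab),
    hcub Unit _ ho (by simp [hd]), mul_zero]

theorem InvVal.eq_zero_of_simple {V : Type} [NormedAddCommGroup V] [InnerProductSpace ℝ V]
    [FiniteDimensional ℝ V] (hd : 1 ≤ Module.finrank ℝ V) {ν : Set V → ℝ} (h : InvVal ν)
    (hs : Simple ν) (hcub : ∀ (ι : Type) [Fintype ι] (e : ι → V), Orthonormal ℝ e →
      Fintype.card ι = Module.finrank ℝ V → ν (cub e) = 0) {K : Set V} (hK : CC K) : ν K = 0 := by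
  induction hm : Module.finrank ℝ V using Nat.strong_induction_on generalizing V with
  | _ m ih =>
  subst hm
  rcases K.eq_empty_or_nonempty with rfl | hK'
  · exact h.isVal.empty
  have hprod : ∀ E : Submodule ℝ V, E ≠ ⊥ → E ≠ ⊤ → ∀ F G, CC F → F.Nonempty → CC G →
      G.Nonempty → F ⊆ E → G ⊆ Eᗮ → ν (F + G) = 0 := by
    intro E h0 h1 F G hF hF' hG hG' hFE hGE
    have hsum := E.finrank_add_finrank_orthogonal
    have h2 : Module.finrank ℝ E < Module.finrank ℝ V := Submodule.finrank_lt h1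
    have h3 : 0 < Module.finrank ℝ E := Submodule.one_le_finrank_iff.2 h0
    have step : ∀ (κ : Type) [Fintype κ] (f : κ → Eᗮ), Orthonormal ℝ f →
        Fintype.card κ = Module.finrank ℝ Eᗮ → ν (F + cub fun i => (f i : V)) = 0 := by
      intro κ _ f hf hκ
      have hQ := CC.cub fun i => (f i : V)
      have hQE : (cub fun i => (f i : V)) ⊆ Eᗮ := cub_subset fun i => (f i).2
      have := ih _ h2 h3 (h.sub E hQ (cub_nonempty _) hQE) (hs.sub E hQ hQE) (fun ι _ e he hι => by
        rw [image_cub]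
        have := hcub (ι ⊕ κ) _ (orthonormal_sumElim he hf) (by
          rw [Fintype.card_sum, hι, hκ, hsum])
        rw [cub_sumElim] at this
        exact this) hF.preimage_subtypeL rfl
      rwa [subtypeL_image_preimage hFE] at this
    have hFE' : F ⊆ Eᗮᗮ := by rwa [Submodule.orthogonal_orthogonal]
    have := ih _ (by omega) (by omega) (h.sub Eᗮ hF hF' hFE') (hs.sub Eᗮ hF hFE')
      (fun κ _ f hf hκ => by
        rw [image_cub, add_comm]
        exact step κ f hf hκ) hG.preimage_subtypeL rfl
    rwa [subtypeL_image_preimage hGE, add_comm] at this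
  have hadd : ∀ K L, CC K → K.Nonempty → CC L → L.Nonempty → ν (K + L) = ν K + ν L :=
    fun K L hK hK' hL hL' => h.isVal.additive h.transInv h.hcont
      (fun K hK _ => hs.two_smul h.isVal h.transInv h.hcont hd hprod hK) hK hK' hL hL'
  rcases hd.eq_or_lt with h1 | h1
  · exact Simple.eq_zero_of_finrank_one h1.symm h.transInv h.hcont hadd hcub hK hK'
  · have := FiniteDimensional.complete ℝ V
    refine h.hcont.eq_zero_of_rot hadd h1 h.rot (fun x => ?_) hK hK'
    obtain ⟨z, hz, hzx⟩ := exists_ne_zero_orthogonal h1 x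
    refine hs z 0 _ hz ?_ ?_
    · rw [← convexHull_pair (𝕜 := ℝ)]
      exact ⟨(Set.toFinite ({-x, x} : Set V)).isCompact_convexHull ℝ, convex_convexHull _ _⟩
    · rintro _ ⟨a, b, -, -, -, rfl⟩
      simp [inner_add_right, inner_smul_right, hzx]

end Scalar

section VectorValued

variable {V : Type} [NormedAddCommGroup V] [InnerProductSpace ℝ V]

theorem refl_zero (x : V) : refl 0 x = x := by simp [refl_apply]

theorem refl_cub {ι : Type} [Fintype ι] {e : ι → V} (he : Orthonormal ℝ e) (i : ι) :
    refl (e i) '' cub e = {-e i} + cub e := by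
  classical
  have h1 : ‖e i‖ = 1 := he.1 i
  have key : ∀ s : ι → ℝ, refl (e i) (∑ j, s j • e j) =
      -e i + ∑ j, (s + Pi.single i (1 - 2 * s i) : ι → ℝ) j • e j := fun s => by
    rw [refl_apply, he.inner_right_fintype, h1]
    simp only [Pi.add_apply, add_smul, Finset.sum_add_distrib, Pi.single_apply, ite_smul, zero_smul,
      Finset.sum_ite_eq', Finset.mem_univ, if_true]
    module
  have hmem : ∀ s : ι → ℝ, s ∈ Set.Icc (0 : ι → ℝ) 1 →
      s + Pi.single i (1 - 2 * s i) ∈ Set.Icc (0 : ι → ℝ) 1 := fun s hs => by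
    constructor
    all_goals
      intro j
      have h2 := hs.1 j
      have h3 := hs.2 j
      rcases eq_or_ne j i with rfl | hj
      · simp at h2 h3 ⊢
        linarith
      · simpa [Pi.single_eq_of_ne hj] using by assumption
  rw [Set.singleton_add]
  ext x
  constructor
  · rintro ⟨_, ⟨s, hs, rfl⟩, rfl⟩
    exact ⟨_, ⟨_, hmem s hs, rfl⟩, (key s).symm⟩
  · rintro ⟨_, ⟨s, hs, rfl⟩, rfl⟩
    refine ⟨_, ⟨_, hmem s hs, rfl⟩, ?_⟩
    have h2 : s + Pi.single i (1 - 2 * s i) +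
        Pi.single i (1 - 2 * (s + Pi.single i (1 - 2 * s i) : ι → ℝ) i) = s := by
      ext j
      rcases eq_or_ne j i with rfl | hj
      · simp; ring
      · simp [Pi.single_eq_of_ne hj]
    simp only [key, h2]

/-- Continuous, translation invariant and rotation equivariant vector valued valuations. -/
structure VecVal (p : Set V → V) : Prop where
  isVal : ∀ w, IsVal fun K => inner ℝ (p K) w
  transInv : ∀ (x : V) (K : Set V), CC K → p ({x} + K) = p K
  hcont : ∀ w, HCont fun K => inner ℝ (p K) w
  rot : ∀ (u w : V) (K : Set V), u ≠ 0 → w ≠ 0 → CC K →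
    p (refl u '' (refl w '' K)) = refl u (refl w (p K))

variable [FiniteDimensional ℝ V]

theorem inner_proj (E : Submodule ℝ V) (x : V) (u : E) :
    inner ℝ (E.orthogonalProjectionOnto x) u = inner ℝ x (u : V) :=
  Submodule.inner_orthogonalProjectionOnto_eq_of_mem_right u x

theorem proj_refl (E : Submodule ℝ V) (u : E) (x : V) :
    E.orthogonalProjectionOnto (refl (u : V) x) = refl u (E.orthogonalProjectionOnto x) := by
  refine ext_inner_right ℝ fun w => ?_
  rw [inner_proj, inner_refl_left, inner_refl_left, inner_proj, coe_refl]

theorem proj_refl_of_orthogonal (E : Submodule ℝ V) {y : V} (hy : y ∈ Eᗮ) (x : V) :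
    E.orthogonalProjectionOnto (refl y x) = E.orthogonalProjectionOnto x := by
  refine ext_inner_right ℝ fun w => ?_
  rw [inner_proj, inner_refl_left, inner_proj,
    refl_of_inner_eq_zero (E.inner_left_of_mem_orthogonal w.2 hy)]

theorem VecVal.sub {p : Set V → V} (h : VecVal p) (E : Submodule ℝ V) {Q : Set V} (hQ : CC Q)
    (hQ' : Q.Nonempty) (hQE : Q ⊆ Eᗮ) :
    VecVal fun F : Set E => E.orthogonalProjectionOnto (p (E.subtypeL '' F + Q)) where
  isVal w := by
    simp only [inner_proj]
    exact ((h.isVal w).add_right hQ).image E.subtypeL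
  transInv x K hK := by
    rw [Set.image_add, Set.image_singleton, add_assoc, h.transInv _ _ ((hK.image _).add hQ)]
  hcont w := by
    simp only [inner_proj]
    exact ((h.hcont w).add_right hQ hQ').image E.subtypeL
  rot u w K hu hw hK := by
    rw [← refl_image_add _ _ hQE, ← refl_image_add _ _ hQE,
      h.rot _ _ _ (by simpa using hu) (by simpa using hw) ((hK.image _).add hQ), proj_refl,
      proj_refl]

theorem VecVal.inner_sub {p : Set V → V} (h : VecVal p) (E : Submodule ℝ V) {Q : Set V} (hQ : CC Q)
    (hQ' : Q.Nonempty) (hQE : Q ⊆ Eᗮ) {w : V} (hw : w ∈ Eᗮ) :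
    InvVal fun F : Set E => inner ℝ (p (E.subtypeL '' F + Q)) w where
  isVal := ((h.isVal w).add_right hQ).image E.subtypeL
  transInv x K hK := by
    dsimp only
    rw [Set.image_add, Set.image_singleton, add_assoc, h.transInv _ _ ((hK.image _).add hQ)]
  hcont := ((h.hcont w).add_right hQ hQ').image E.subtypeL
  rot u y K hu hy hK := by
    have hE : ∀ u : E, refl (u : V) w = w := fun u =>
      refl_of_inner_eq_zero (E.inner_right_of_mem_orthogonal u.2 hw)
    rw [← refl_image_add _ _ hQE, ← refl_image_add _ _ hQE,
      h.rot _ _ _ (by simpa using hu) (by simpa using hy) ((hK.image _).add hQ), inner_refl_left,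
      inner_refl_left, hE, hE]

theorem VecVal.eq_zero_of_simple {V : Type} [NormedAddCommGroup V] [InnerProductSpace ℝ V]
    [FiniteDimensional ℝ V] (hd : 1 ≤ Module.finrank ℝ V) {p : Set V → V} (h : VecVal p)
    (hrefl : Module.finrank ℝ V ≤ 2 → ∀ (u : V) (K : Set V), u ≠ 0 → CC K →
      p (refl u '' K) = refl u (p K))
    (hs : ∀ w, Simple fun K => inner ℝ (p K) w)
    (hcub : ∀ (ι : Type) [Fintype ι] (e : ι → V), Orthonormal ℝ e →
      Fintype.card ι = Module.finrank ℝ V → p (cub e) = 0) {K : Set V} (hK : CC K) : p K = 0 := by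
  induction hm : Module.finrank ℝ V using Nat.strong_induction_on generalizing V with
  | _ m ih =>
  subst hm
  rcases K.eq_empty_or_nonempty with rfl | hK'
  · exact ext_inner_right ℝ fun w => by rw [(h.isVal w).empty, inner_zero_left]
  have hprod : ∀ E : Submodule ℝ V, E ≠ ⊥ → E ≠ ⊤ → ∀ F G, CC F → F.Nonempty → CC G →
      G.Nonempty → F ⊆ E → G ⊆ Eᗮ → ∀ w ∈ Eᗮ, inner ℝ (p (F + G)) w = 0 := by
    intro E h0 h1 F G hF hF' hG hG' hFE hGE w hw
    have hsum := E.finrank_add_finrank_orthogonal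
    have h2 : Module.finrank ℝ E < Module.finrank ℝ V := Submodule.finrank_lt h1
    have h3 : 0 < Module.finrank ℝ E := Submodule.one_le_finrank_iff.2 h0
    refine Eq.trans ?_ ((h.inner_sub E hG hG' hGE hw).eq_zero_of_simple h3 ((hs w).sub E hG hGE)
      (fun ι _ e he hι => ?_) hF.preimage_subtypeL)
    · rw [subtypeL_image_preimage hFE]
    rw [image_cub]
    have hQ := CC.cub fun i => (e i : V)
    have hQE : (cub fun i => (e i : V)) ⊆ Eᗮᗮ := by
      rw [Submodule.orthogonal_orthogonal]
      exact cub_subset fun i => (e i).2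
    have heV : Orthonormal ℝ fun i => (e i : V) := he.comp_linearIsometry E.subtypeₗᵢ
    have i₀ : Nonempty ι := Fintype.card_pos_iff.1 (by omega)
    obtain ⟨i₀⟩ := i₀
    have hi₀ : (e i₀ : V) ≠ 0 := heV.ne_zero i₀
    have hi₀E : (e i₀ : V) ∈ Eᗮᗮ := E.le_orthogonal_orthogonal (e i₀).2
    have hq := ih _ (by omega) (by omega) (h.sub Eᗮ hQ (cub_nonempty _) hQE)
      (fun _ u K hu hK => by
        have e1 := h.rot u (e i₀) _ (by simpa using hu) hi₀ ((hK.image Eᗮ.subtypeL).add hQ)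
        rw [Set.image_add (refl (e i₀ : V)), refl_cub heV,
          refl_image_of_orthogonal (E := Eᗮᗮ) hi₀E (by
            rintro _ ⟨x, -, rfl⟩
            exact Eᗮ.le_orthogonal_orthogonal x.2), add_left_comm, Set.image_add,
          Set.image_singleton, h.transInv _ _ ((((hK.image _).add hQ)).image _),
          refl_image_add _ _ hQE] at e1
        rw [e1, proj_refl, proj_refl_of_orthogonal _ hi₀E])
      (fun w => by
        simp only [inner_proj]
        exact (hs w).sub Eᗮ hQ hQE)
      (fun κ _ f hf hκ => by
        have := hcub (ι ⊕ κ) _ (orthonormal_sumElim he hf) (by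
          rw [Fintype.card_sum, hι, hκ, hsum])
        rw [cub_sumElim, add_comm] at this
        rw [image_cub]
        exact (congrArg _ this).trans (map_zero _)) hG.preimage_subtypeL rfl
    rw [subtypeL_image_preimage hGE] at hq
    have := inner_proj Eᗮ (p (G + cub fun i => (e i : V))) ⟨w, hw⟩
    rw [hq, inner_zero_left] at this
    rw [add_comm]
    exact this.symm
  have hprod' : ∀ E : Submodule ℝ V, E ≠ ⊥ → E ≠ ⊤ → ∀ F G, CC F → F.Nonempty → CC G →
      G.Nonempty → F ⊆ E → G ⊆ Eᗮ → ∀ w, inner ℝ (p (F + G)) w = 0 := by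
    intro E h0 h1 F G hF hF' hG hG' hFE hGE w
    obtain ⟨a, ha, b, hb, rfl⟩ := E.exists_add_mem_mem_orthogonal w
    rw [inner_add_right, hprod E h0 h1 F G hF hF' hG hG' hFE hGE b hb, add_zero, add_comm]
    refine hprod Eᗮ ?_ ?_ G F hG hG' hF hF' hGE ?_ a ?_
    · rwa [Ne, Submodule.orthogonal_eq_bot_iff]
    · rwa [Ne, Submodule.orthogonal_eq_top_iff]
    · rwa [Submodule.orthogonal_orthogonal]
    · rwa [Submodule.orthogonal_orthogonal]
  have hadd : ∀ K L, CC K → K.Nonempty → CC L → L.Nonempty → p (K + L) = p K + p L :=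
    fun K L hK hK' hL hL' => ext_inner_right ℝ fun w => by
      rw [inner_add_left]
      exact (h.isVal w).additive (fun x K hK => by simp only [h.transInv x K hK]) (h.hcont w)
        (fun K hK _ => (hs w).two_smul (h.isVal w) (fun x K hK => by simp only [h.transInv x K hK])
          (h.hcont w) hd (fun E h0 h1 F G hF hF' hG hG' hFE hGE =>
            hprod' E h0 h1 F G hF hF' hG hG' hFE hGE w) hK) hK hK' hL hL'
  rcases hd.eq_or_lt with h1 | h1
  · refine ext_inner_right ℝ fun w => ?_
    rw [inner_zero_left]
    refine Simple.eq_zero_of_finrank_one (ν := fun K => inner ℝ (p K) w) h1.symm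
      (fun x K hK => by simp only [h.transInv x K hK]) (h.hcont w)
      (fun K L hK hK' hL hL' => by rw [hadd K L hK hK' hL hL', inner_add_left])
      (fun ι _ e he hι => by rw [hcub ι e he hι, inner_zero_left]) hK hK'
  · have := FiniteDimensional.complete ℝ V
    refine HCont.vector_eq_zero h.hcont hadd h.transInv h1 h.rot (fun h2 u K hK => ?_) hK hK'
    rcases eq_or_ne u 0 with rfl | hu
    · simp only [refl_zero, Set.image_id']
    · exact hrefl h2.le u K hu hK

end VectorValued

section Volume

open MeasureTheory Filter Topology

variable {V : Type} [NormedAddCommGroup V] [InnerProductSpace ℝ V] [FiniteDimensional ℝ V]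

theorem mem_of_ball_subset {x : V} {L : Set V} (hL : CC L) (hL' : L.Nonempty) {δ : ℝ} (hδ : 0 ≤ δ)
    (h : {x} + Metric.closedBall 0 δ ⊆ L + Metric.closedBall 0 δ) : x ∈ L := by
  have hB := CC.closedBall (0 : V) δ
  have hB' : (Metric.closedBall (0 : V) δ).Nonempty := ⟨0, by simpa using hδ⟩
  have := subset_of_supp_le (CC.singleton x) hL hL' le_rfl (fun v _ => by
    have h1 : supp ({x} + Metric.closedBall 0 δ) v ≤ supp (L + Metric.closedBall 0 δ) v :=
      supp_le ((Set.singleton_nonempty x).add hB') fun y hy => le_supp (hL.add hB) (h hy) v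
    rw [supp_add (CC.singleton x) (Set.singleton_nonempty x) hB hB', supp_add hL hL' hB hB'] at h1
    linarith)
  rw [Metric.closedBall_zero, Set.singleton_zero, add_zero] at this
  exact this rfl

theorem refl_det_abs (u : V) : |LinearMap.det (refl u : V →ₗ[ℝ] V)| = 1 := by
  have h : (refl u : V →ₗ[ℝ] V) ∘ₗ (refl u : V →ₗ[ℝ] V) = LinearMap.id := by
    ext x
    exact refl_refl u x
  have h2 := congrArg LinearMap.det h
  rw [LinearMap.det_comp, LinearMap.det_id] at h2
  exact (abs_eq zero_le_one).2 (mul_self_eq_one_iff.1 h2)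

variable [MeasurableSpace V] [BorelSpace V] (μ : Measure V) [μ.IsAddHaarMeasure]

theorem isVal_measure : IsVal fun K : Set V => μ.real K where
  empty := by simp
  union_add_inter A B hA hB _ :=
    measureReal_union_add_inter hB.1.measurableSet hA.1.measure_lt_top.ne hB.1.measure_lt_top.ne

theorem transInv_measure : TransInv fun K : Set V => μ.real K := fun x K _ => by
  simp only [Set.singleton_add, Measure.real, measure_preimage_add, Set.image_add_left]

theorem measure_refl (u : V) (K : Set V) : μ.real (refl u '' K) = μ.real K := by
  have := Measure.addHaar_image_linearMap μ (refl u : V →ₗ[ℝ] V) K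
  rw [refl_det_abs, ENNReal.ofReal_one, one_mul] at this
  exact congrArg ENNReal.toReal this

theorem hcont_measure : HCont fun K : Set V => μ.real K := by
  intro K hK hK' ε hε
  have h1 : Tendsto (fun r => μ.real (K + Metric.closedBall 0 r)) (𝓝[>] 0) (𝓝 (μ.real K)) := by
    have := (ENNReal.tendsto_toReal hK.1.measure_lt_top.ne).comp
      ((tendsto_measure_cthickening_of_isCompact (μ := μ) hK.1).mono_left
        (nhdsWithin_le_nhds (s := Set.Ioi 0)))
    refine this.congr' ?_
    filter_upwards [self_mem_nhdsWithin] with r hr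
    rw [hK.1.add_closedBall_zero (le_of_lt hr)]
    rfl
  let P : ℕ → Set V := fun k => {x | {x} + Metric.closedBall 0 (1 / ((k : ℝ) + 1)) ⊆ K}
  have hP : Monotone P := fun k l hkl x hx =>
    (Set.add_subset_add_left (Metric.closedBall_subset_closedBall (by gcongr))).trans hx
  have hPK : ∀ k, P k ⊆ K := fun k x hx => hx ⟨x, rfl, 0, by simp; positivity, by simp⟩
  have hint : interior K ⊆ ⋃ k, P k := fun x hx => by
    obtain ⟨r, hr, hr'⟩ := Metric.isOpen_iff.1 isOpen_interior x hx
    obtain ⟨k, hk⟩ := exists_nat_one_div_lt hr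
    refine Set.mem_iUnion.2 ⟨k, fun y hy => interior_subset (hr' ?_)⟩
    obtain ⟨_, rfl, b, hb, rfl⟩ := hy
    rw [Metric.mem_ball, dist_eq_norm, add_sub_cancel_left]
    exact (mem_closedBall_zero_iff.1 hb).trans_lt hk
  have h2 : Tendsto (fun k => μ.real (P k)) atTop (𝓝 (μ.real K)) := by
    have h3 : μ (⋃ k, P k) = μ K := by
      refine le_antisymm (measure_mono (Set.iUnion_subset hPK)) ?_
      rw [← measure_congr (interior_ae_eq_of_null_frontier (hK.2.addHaar_frontier μ))]
      exact measure_mono hint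
    have := tendsto_measure_iUnion_atTop (μ := μ) hP
    rw [h3] at this
    exact (ENNReal.tendsto_toReal hK.1.measure_lt_top.ne).comp this
  obtain ⟨k, hk⟩ := ((tendsto_order.1 h2).1 (μ.real K - ε) (by linarith)).exists
  obtain ⟨r, hr1, hr0, hr2⟩ := (((tendsto_order.1 h1).2 (μ.real K + ε) (by linarith)).and
    (Ioo_mem_nhdsGT (show (0 : ℝ) < 1 / ((k : ℝ) + 1) by positivity))).exists
  refine ⟨r, hr0, fun L hL hL' hKL hLK => abs_lt.2 ⟨?_, ?_⟩⟩
  · have : P k ⊆ L := fun x hx => mem_of_ball_subset hL hL' hr0.le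
      ((Set.add_subset_add_left (Metric.closedBall_subset_closedBall hr2.le)).trans (hx.trans hKL))
    have := measureReal_mono (μ := μ) this hL.1.measure_lt_top.ne
    simp only
    linarith
  · have := measureReal_mono (μ := μ) hLK (hK.add (CC.closedBall 0 r)).1.measure_lt_top.ne
    simp only
    linarith

/-- Volume of `a • K + b • B` as a function of `K`. -/
theorem invVal_measure_add (a b : ℝ) (hb : 0 ≤ b) :
    InvVal fun K : Set V => μ.real (a • K + Metric.closedBall 0 b) where
  isVal := ((isVal_measure μ).add_right (CC.closedBall 0 b)).smul a
  transInv := ((transInv_measure μ).add_right (CC.closedBall 0 b)).smul a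
  hcont := ((hcont_measure μ).add_right (CC.closedBall 0 b) ⟨0, by simpa using hb⟩).smul a
  rot u w K _ _ _ := by
    have h : ∀ (u : V) (K : Set V), μ.real (a • (refl u '' K) + Metric.closedBall 0 b) =
        μ.real (a • K + Metric.closedBall 0 b) := fun u K => by
      rw [← Set.image_smul_comm (refl u) a K (by simp), ← refl_image_closedBall u b,
        ← Set.image_add, measure_refl, refl_image_closedBall]
    simp only [h]

/-- Steiner's formula. -/
theorem exists_steiner {K : Set V} (hK : CC K) : ∃ q : ℕ → ℝ,
    ∀ a b : ℕ, μ.real ((a : ℝ) • K + Metric.closedBall 0 (b : ℝ)) =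
      ∑ d ∈ Finset.range (Module.finrank ℝ V + 1),
        q d * (a : ℝ) ^ d * (b : ℝ) ^ (Module.finrank ℝ V - d) := by
  set n := Module.finrank ℝ V with hn
  have hpoly : ∀ b : ℕ, ∃ P : Polynomial ℝ, P.degree < (n + 1 : ℕ) ∧ ∀ a : ℕ,
      μ.real ((a : ℝ) • K + Metric.closedBall 0 (b : ℝ)) = P.eval (a : ℝ) := fun b =>
    (IsVal.polyN_smul ((isVal_measure μ).add_right (CC.closedBall 0 (b : ℝ)))
      ((transInv_measure μ).add_right (CC.closedBall 0 (b : ℝ)))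
      ((hcont_measure μ).add_right (CC.closedBall 0 (b : ℝ)) ⟨0, by simp⟩) hK).exists_polynomial
  have hpoly' : ∀ a : ℕ, ∃ P : Polynomial ℝ, ∀ b : ℕ,
      μ.real ((a : ℝ) • K + Metric.closedBall 0 (b : ℝ)) = P.eval (b : ℝ) := fun a => by
    obtain ⟨P, -, hP⟩ := (IsVal.polyN_smul ((isVal_measure μ).add_right (hK.smul (a : ℝ)))
      ((transInv_measure μ).add_right (hK.smul (a : ℝ))) (K := Metric.closedBall 0 1)
      (by
        rcases K.eq_empty_or_nonempty with rfl | hK'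
        · simp only [Set.smul_set_empty, Set.add_empty, measureReal_empty]
          exact HCont.zero
        · exact (hcont_measure μ).add_right (hK.smul (a : ℝ)) hK'.smul_set)
      (CC.closedBall 0 1)).exists_polynomial
    refine ⟨P, fun b => ?_⟩
    rw [← hP b, add_comm, smul_unitClosedBall, Real.norm_of_nonneg b.cast_nonneg]
  have hnat : Set.Infinite (Set.range fun k : ℕ => (k : ℝ)) :=
    Set.infinite_range_of_injective Nat.cast_injective
  have hext : ∀ P Q : Polynomial ℝ, (∀ k : ℕ, P.eval (k : ℝ) = Q.eval (k : ℝ)) → P = Q :=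
    fun P Q h => Polynomial.eq_of_infinite_eval_eq P Q
      (hnat.mono (by rintro _ ⟨k, rfl⟩; exact h k))
  choose P hPd hP using hpoly
  choose R hR using hpoly'
  refine ⟨(P 1).coeff, fun a b => ?_⟩
  have hpos : ∀ b : ℕ, P (b + 1) =
      Polynomial.C (((b : ℝ) + 1) ^ n) * (P 1).comp (Polynomial.C ((b : ℝ) + 1)⁻¹ * Polynomial.X) := by
    intro b
    have hb : ((b : ℝ) + 1) ≠ 0 := by positivity
    have key : (P (b + 1)).comp (Polynomial.C ((b : ℝ) + 1) * Polynomial.X) =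
        Polynomial.C (((b : ℝ) + 1) ^ n) * P 1 := hext _ _ fun k => by
      have e1 := hP (b + 1) ((b + 1) * k)
      push_cast at e1
      have e2 := hP 1 k
      simp only [Polynomial.eval_comp, Polynomial.eval_mul, Polynomial.eval_C, Polynomial.eval_X]
      rw [← e1, ← e2, Nat.cast_one]
      have : (((b : ℝ) + 1) * k) • K + Metric.closedBall (0 : V) ((b : ℝ) + 1) =
          ((b : ℝ) + 1) • ((k : ℝ) • K + Metric.closedBall (0 : V) 1) := by
        rw [smul_add, smul_smul, smul_unitClosedBall, Real.norm_of_nonneg (by positivity)]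
      rw [this, Measure.real, Measure.addHaar_smul_of_nonneg μ (by positivity), ENNReal.toReal_mul,
        ENNReal.toReal_ofReal (by positivity)]
      rfl
    have := congrArg (fun Q => Q.comp (Polynomial.C ((b : ℝ) + 1)⁻¹ * Polynomial.X)) key
    simp only [Polynomial.comp_assoc, Polynomial.mul_comp, Polynomial.C_comp, Polynomial.X_comp,
      ← mul_assoc, ← Polynomial.C_mul, mul_inv_cancel₀ hb, Polynomial.C_1, one_mul,
      Polynomial.comp_X] at this
    exact this
  have hval : ∀ a b : ℕ, μ.real ((a : ℝ) • K + Metric.closedBall 0 ((b + 1 : ℕ) : ℝ)) =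
      ∑ d ∈ Finset.range (n + 1), (P 1).coeff d * (a : ℝ) ^ d * ((b + 1 : ℕ) : ℝ) ^ (n - d) := by
    intro a b
    have hb : ((b : ℝ) + 1) ≠ 0 := by positivity
    rw [hP, hpos, Polynomial.eval_mul, Polynomial.eval_C, Polynomial.eval_comp, Polynomial.eval_mul,
      Polynomial.eval_C, Polynomial.eval_X,
      Polynomial.eval_eq_sum_range' (n := n + 1), Finset.mul_sum]
    · refine Finset.sum_congr rfl fun d hd => ?_
      have hd' : d ≤ n := by simpa [Nat.lt_succ_iff] using hd
      push_cast
      rw [pow_sub₀ _ hb hd', mul_pow, inv_pow]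
      ring
    · rcases eq_or_ne (P 1) 0 with h | h
      · simp [h]
      · exact (Polynomial.natDegree_lt_iff_degree_lt h).2 (hPd 1)
  have hRa : R a = ∑ d ∈ Finset.range (n + 1),
      Polynomial.C ((P 1).coeff d * (a : ℝ) ^ d) * Polynomial.X ^ (n - d) := by
    refine Polynomial.eq_of_infinite_eval_eq _ _
      ((Set.infinite_range_of_injective (f := fun k : ℕ => ((k + 1 : ℕ) : ℝ))
        (Nat.cast_injective.comp (add_left_injective 1))).mono ?_)
    rintro _ ⟨k, rfl⟩
    rw [Set.mem_ofPred_eq, ← hR, hval, Polynomial.eval_finsetSum]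
    simp
  rw [hR, hRa, Polynomial.eval_finsetSum]
  simp

end Volume

section Quermass

open MeasureTheory Filter Topology

theorem sum_powerset_pow {α : Type*} (I : Finset α) {d : ℕ} (hd : d ≤ I.card) :
    ∑ S ∈ I.powerset, (-1 : ℝ) ^ (I.card - S.card) * (S.card : ℝ) ^ d =
      if d = I.card then (I.card.factorial : ℝ) else 0 := by
  rw [Finset.sum_powerset_apply_card fun k => (-1 : ℝ) ^ (I.card - k) * (k : ℝ) ^ d]
  have h1 : (fwdDiff (1 : ℝ))^[I.card] (fun r : ℝ => r ^ d) 0 =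
      ∑ k ∈ Finset.range (I.card + 1), I.card.choose k • ((-1 : ℝ) ^ (I.card - k) * (k : ℝ) ^ d) := by
    rw [fwdDiff_iter_eq_sum_shift]
    refine Finset.sum_congr rfl fun k _ => ?_
    simp
    ring
  rw [← h1]
  split_ifs with h
  · rw [h, fwdDiff_iter_eq_factorial]
    simp
  · rw [fwdDiff_iter_pow_eq_zero_of_lt (lt_of_le_of_ne hd h)]
    rfl

theorem sum_filter_mul {n : ℕ} (p : Fin n → Prop) [DecidablePred p] (f g : ℕ → ℝ) :
    ∑ S : Finset (Fin n), (-1 : ℝ) ^ (n - S.card) *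
      (f (S.filter p).card * g (S.filter fun l => ¬ p l).card) =
    (∑ S ∈ (Finset.univ.filter p).powerset,
      (-1 : ℝ) ^ ((Finset.univ.filter p).card - S.card) * f S.card) *
    ∑ S ∈ (Finset.univ.filter fun l => ¬ p l).powerset,
      (-1 : ℝ) ^ ((Finset.univ.filter fun l => ¬ p l).card - S.card) * g S.card := by
  rw [Finset.sum_mul_sum, ← Finset.sum_product']
  have hn : (Finset.univ.filter p).card + (Finset.univ.filter fun l => ¬ p l).card = n := by
    rw [Finset.card_filter_add_card_filter_not]
    simp
  refine Finset.sum_nbij' (fun S => (S.filter p, S.filter fun l => ¬ p l)) (fun T => T.1 ∪ T.2)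
    ?_ ?_ ?_ ?_ ?_
  · intro S _
    simp only [Finset.mem_product, Finset.mem_powerset]
    exact ⟨Finset.filter_subset_filter _ (Finset.subset_univ _),
      Finset.filter_subset_filter _ (Finset.subset_univ _)⟩
  · intro T _
    exact Finset.mem_univ _
  · intro S _
    exact Finset.filter_union_filter_not_eq p S
  · rintro ⟨T1, T2⟩ hT
    simp only [Finset.mem_product, Finset.mem_powerset] at hT
    have h1 : ∀ x ∈ T1, p x := fun x hx => (Finset.mem_filter.1 (hT.1 hx)).2
    have h2 : ∀ x ∈ T2, ¬ p x := fun x hx => (Finset.mem_filter.1 (hT.2 hx)).2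
    ext x
    · simp only [Finset.mem_filter, Finset.mem_union]
      have := h1 x
      have := h2 x
      tauto
    · simp only [Finset.mem_filter, Finset.mem_union]
      have := h1 x
      have := h2 x
      tauto
  · intro S _
    have h1 : (S.filter p).card ≤ (Finset.univ.filter p).card :=
      Finset.card_le_card (Finset.filter_subset_filter _ (Finset.subset_univ _))
    have h2 : (S.filter fun l => ¬ p l).card ≤ (Finset.univ.filter fun l => ¬ p l).card :=
      Finset.card_le_card (Finset.filter_subset_filter _ (Finset.subset_univ _))
    have h3 : (S.filter p).card + (S.filter fun l => ¬ p l).card = S.card :=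
      Finset.card_filter_add_card_filter_not ..
    have h4 : n - S.card = ((Finset.univ.filter p).card - (S.filter p).card) +
        ((Finset.univ.filter fun l => ¬ p l).card - (S.filter fun l => ¬ p l).card) := by omega
    simp only
    rw [h4, pow_add]
    ring

variable {V : Type} [NormedAddCommGroup V] [InnerProductSpace ℝ V] [FiniteDimensional ℝ V]
  [MeasurableSpace V] [BorelSpace V] (μ : Measure V) [μ.IsAddHaarMeasure]

/-- The mixed volume of `i` copies of `K` and `n - i` copies of the unit ball, where `n` is the
dimension. -/
def querSet (n i : ℕ) (K : Set V) : ℝ :=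
  (n.factorial : ℝ)⁻¹ * ∑ S : Finset (Fin n), (-1 : ℝ) ^ (n - S.card) *
    μ.real (((S.filter fun l : Fin n => (l : ℕ) < i).card : ℝ) • K +
      Metric.closedBall 0 ((S.filter fun l : Fin n => ¬ (l : ℕ) < i).card : ℝ))

theorem invVal_querSet (n i : ℕ) : InvVal (querSet μ n i) := by
  have h := fun S : Finset (Fin n) => invVal_measure_add μ
    ((S.filter fun l : Fin n => (l : ℕ) < i).card : ℝ)
    ((S.filter fun l : Fin n => ¬ (l : ℕ) < i).card : ℝ) (Nat.cast_nonneg _)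
  refine ⟨(IsVal.sum _ fun S _ => (h S).isVal.const_mul _).const_mul _, fun x K hK => ?_,
    (HCont.sum _ fun S _ => (h S).hcont.const_mul _).const_mul _, fun u w K hu hw hK => ?_⟩
  · simp only [querSet]
    congr 1
    exact Finset.sum_congr rfl fun S _ => congrArg _ ((h S).transInv x K hK)
  · simp only [querSet]
    congr 1
    exact Finset.sum_congr rfl fun S _ => congrArg _ ((h S).rot u w K hu hw hK)

theorem querSet_eq {n i : ℕ} (hi : i ≤ n) {K : Set V} {q : ℕ → ℝ}
    (hq : ∀ a b : ℕ, μ.real ((a : ℝ) • K + Metric.closedBall 0 (b : ℝ)) =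
      ∑ d ∈ Finset.range (n + 1), q d * (a : ℝ) ^ d * (b : ℝ) ^ (n - d)) :
    querSet μ n i K = (n.factorial : ℝ)⁻¹ * (i.factorial * (n - i).factorial) * q i := by
  have hI : (Finset.univ.filter fun l : Fin n => (l : ℕ) < i).card = i := by
    rw [Fin.card_filter_val_lt]
    omega
  have hJ : (Finset.univ.filter fun l : Fin n => ¬ (l : ℕ) < i).card = n - i := by
    have := Finset.card_filter_add_card_filter_not (s := (Finset.univ : Finset (Fin n)))
      (fun l : Fin n => (l : ℕ) < i)
    rw [hI, Finset.card_univ, Fintype.card_fin] at this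
    omega
  rw [querSet, mul_assoc]
  congr 1
  simp only [hq, Finset.mul_sum]
  rw [Finset.sum_comm]
  have key : ∀ d ∈ Finset.range (n + 1), (∑ S : Finset (Fin n), (-1 : ℝ) ^ (n - S.card) *
      (q d * ((S.filter fun l : Fin n => (l : ℕ) < i).card : ℝ) ^ d *
        ((S.filter fun l : Fin n => ¬ (l : ℕ) < i).card : ℝ) ^ (n - d))) =
      if d = i then i.factorial * (n - i).factorial * q i else 0 := by
    intro d hd
    have hd' : d ≤ n := by simpa [Nat.lt_succ_iff] using hd
    have := sum_filter_mul (fun l : Fin n => (l : ℕ) < i) (fun k => (k : ℝ) ^ d)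
      (fun k => (k : ℝ) ^ (n - d))
    have h2 : (∑ S : Finset (Fin n), (-1 : ℝ) ^ (n - S.card) *
      (q d * ((S.filter fun l : Fin n => (l : ℕ) < i).card : ℝ) ^ d *
        ((S.filter fun l : Fin n => ¬ (l : ℕ) < i).card : ℝ) ^ (n - d))) = q d *
      ∑ S : Finset (Fin n), (-1 : ℝ) ^ (n - S.card) *
      (((S.filter fun l : Fin n => (l : ℕ) < i).card : ℝ) ^ d *
        ((S.filter fun l : Fin n => ¬ (l : ℕ) < i).card : ℝ) ^ (n - d)) := by
      rw [Finset.mul_sum]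
      exact Finset.sum_congr rfl fun S _ => by ring
    rw [h2, this]
    rcases lt_trichotomy d i with h | rfl | h
    · rw [sum_powerset_pow _ (by omega), if_neg (by omega), if_neg (by omega)]
      ring
    · rw [sum_powerset_pow _ (by omega), sum_powerset_pow _ (by omega), if_pos hI.symm,
        if_pos hJ.symm, if_pos rfl, hI, hJ]
      ring
    · rw [sum_powerset_pow (Finset.univ.filter fun l : Fin n => ¬ (l : ℕ) < i) (by omega),
        if_neg (by omega), if_neg (by omega)]
      ring
  rw [Finset.sum_congr rfl key, Finset.sum_ite_eq', if_pos (by simpa using by omega)]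

theorem exists_querSet {n : ℕ} (hn : Module.finrank ℝ V = n) {K : Set V} (hK : CC K) :
    ∃ q : ℕ → ℝ, (∀ a b : ℕ, μ.real ((a : ℝ) • K + Metric.closedBall 0 (b : ℝ)) =
      ∑ d ∈ Finset.range (n + 1), q d * (a : ℝ) ^ d * (b : ℝ) ^ (n - d)) ∧
      ∀ i ≤ n, querSet μ n i K = (n.factorial : ℝ)⁻¹ * (i.factorial * (n - i).factorial) * q i := by
  obtain ⟨q, hq⟩ := exists_steiner μ hK
  rw [hn] at hq
  exact ⟨q, hq, fun i hi => querSet_eq μ hi hq⟩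

theorem querSet_two_smul {n i : ℕ} (hn : Module.finrank ℝ V = n) (hi : i ≤ n) {K : Set V}
    (hK : CC K) : querSet μ n i ((2 : ℝ) • K) = 2 ^ i * querSet μ n i K := by
  obtain ⟨q, hq, hq'⟩ := exists_querSet μ hn hK
  rw [hq' i hi, querSet_eq μ hi (q := fun d => 2 ^ d * q d)]
  · ring
  intro a b
  have := hq (a * 2) b
  push_cast at this
  rw [smul_smul, this]
  refine Finset.sum_congr rfl fun d _ => ?_
  ring

/-- The first nontrivial quermassintegral as a limit. -/
theorem tendsto_querSet_one {n : ℕ} (hn : Module.finrank ℝ V = n) (hn1 : 1 ≤ n) {K : Set V}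
    (hK : CC K) (hK' : K.Nonempty) : Tendsto (fun b : ℕ => (n : ℝ)⁻¹ *
      ((μ.real (K + Metric.closedBall 0 (b : ℝ)) - μ.real (Metric.closedBall (0 : V) (b : ℝ))) *
        ((b : ℝ) ^ (n - 1))⁻¹)) atTop (𝓝 (querSet μ n 1 K)) := by
  obtain ⟨q, hq, hq'⟩ := exists_querSet μ hn hK
  obtain ⟨m, rfl⟩ : ∃ m, n = m + 1 := ⟨n - 1, by omega⟩
  have hfac : querSet μ (m + 1) 1 K = ((m + 1 : ℕ) : ℝ)⁻¹ * q 1 := by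
    rw [hq' 1 hn1, Nat.factorial_succ]
    have : ((m.factorial : ℕ) : ℝ) ≠ 0 := by exact_mod_cast m.factorial_ne_zero
    push_cast
    simp only [Nat.factorial_one]
    field_simp
    simp
  rw [hfac]
  refine Tendsto.const_mul _ ?_
  have hb : ∀ b : ℕ, μ.real (Metric.closedBall (0 : V) (b : ℝ)) = q 0 * (b : ℝ) ^ (m + 1) := by
    intro b
    have := hq 0 b
    rw [Finset.sum_range_succ'] at this
    simpa [Set.zero_smul_set hK'] using this
  have hlim : Tendsto (fun b : ℕ => ∑ d ∈ Finset.range (m + 1), q (d + 1) * ((b : ℝ)⁻¹) ^ d) atTop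
      (𝓝 (∑ d ∈ Finset.range (m + 1), q (d + 1) * 0 ^ d)) :=
    tendsto_finsetSum _ fun d _ => (tendsto_inv_atTop_nhds_zero_nat.pow d).const_mul _
  rw [Finset.sum_range_succ'] at hlim
  simp only [ne_eq, Nat.add_eq_zero_iff, one_ne_zero, and_false, not_false_eq_true, zero_pow,
    mul_zero, Finset.sum_const_zero, zero_add, pow_zero, mul_one] at hlim
  refine hlim.congr' ?_
  filter_upwards [eventually_gt_atTop 0] with b hb0
  have hb0' : (b : ℝ) ≠ 0 := by exact_mod_cast hb0.ne'
  have e1 := hq 1 b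
  rw [Nat.cast_one, one_smul, Finset.sum_range_succ'] at e1
  rw [e1, hb]
  simp only [one_pow, mul_one, pow_zero, Nat.sub_zero, add_sub_cancel_right, Nat.add_sub_cancel,
    Nat.add_sub_add_right]
  rw [Finset.sum_mul]
  refine Finset.sum_congr rfl fun d hd => ?_
  have hd' : d ≤ m := by simpa [Nat.lt_succ_iff] using hd
  rw [pow_sub₀ _ hb0' hd', inv_pow]
  field_simp

theorem querSet_one_mono {n : ℕ} (hn : Module.finrank ℝ V = n) (hn1 : 1 ≤ n) {K L : Set V}
    (hK : CC K) (hK' : K.Nonempty) (hL : CC L) (hKL : K ⊆ L) :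
    querSet μ n 1 K ≤ querSet μ n 1 L := by
  refine le_of_tendsto_of_tendsto' (tendsto_querSet_one μ hn hn1 hK hK')
    (tendsto_querSet_one μ hn hn1 hL (hK'.mono hKL)) fun b => ?_
  have := measureReal_mono (μ := μ) (Set.add_subset_add_right (t := Metric.closedBall (0 : V) b) hKL)
    (hL.add (CC.closedBall 0 (b : ℝ))).1.measure_lt_top.ne
  gcongr

theorem querSet_one_additive {n : ℕ} (hn : Module.finrank ℝ V = n) (hn1 : 1 ≤ n) {K L : Set V}
    (hK : CC K) (hK' : K.Nonempty) (hL : CC L) (hL' : L.Nonempty) :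
    querSet μ n 1 (K + L) = querSet μ n 1 K + querSet μ n 1 L := by
  have h := invVal_querSet μ n 1
  refine h.isVal.additive h.transInv h.hcont (fun K hK _ => ?_) hK hK' hL hL'
  rw [querSet_two_smul μ hn hn1 hK, pow_one]

theorem querSet_one_singleton {n : ℕ} (hn : Module.finrank ℝ V = n) (hn1 : 1 ≤ n) (x : V) :
    querSet μ n 1 {x} = 0 := by
  have h1 := querSet_two_smul μ hn hn1 (CC.singleton (0 : V))
  have h2 := (invVal_querSet μ n 1).transInv x {0} (CC.singleton 0)
  rw [Set.smul_set_singleton, smul_zero] at h1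
  rw [Set.singleton_add_singleton, add_zero] at h2
  linarith

theorem querSet_one_nonneg {n : ℕ} (hn : Module.finrank ℝ V = n) (hn1 : 1 ≤ n) {K : Set V}
    (hK : CC K) (hK' : K.Nonempty) : 0 ≤ querSet μ n 1 K := by
  obtain ⟨x, hx⟩ := hK'
  rw [← querSet_one_singleton μ hn hn1 x]
  exact querSet_one_mono μ hn hn1 (CC.singleton x) (Set.singleton_nonempty x) hK (by simpa using hx)

theorem querSet_unitBall_pos {n i : ℕ} (hn : Module.finrank ℝ V = n) (hi : i ≤ n) :
    0 < querSet μ n i (Metric.closedBall 0 1) := by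
  have hB : 0 < μ.real (Metric.closedBall (0 : V) 1) :=
    ENNReal.toReal_pos (Metric.measure_closedBall_pos μ 0 one_pos).ne'
      (CC.closedBall (0 : V) 1).1.measure_lt_top.ne
  rw [querSet_eq μ hi (q := fun d => n.choose d * μ.real (Metric.closedBall (0 : V) 1))]
  · have := Nat.choose_pos hi
    positivity
  intro a b
  have : (a : ℝ) • Metric.closedBall (0 : V) 1 + Metric.closedBall 0 (b : ℝ) =
      ((a : ℝ) + b) • Metric.closedBall (0 : V) 1 := by
    rw [(convex_closedBall (0 : V) 1).add_smul a.cast_nonneg b.cast_nonneg,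
      smul_unitClosedBall (b : ℝ), Real.norm_of_nonneg b.cast_nonneg]
  rw [this, Measure.real, Measure.addHaar_smul_of_nonneg μ (by positivity), ENNReal.toReal_mul,
    ENNReal.toReal_ofReal (by positivity), hn, add_pow, Finset.sum_mul]
  refine Finset.sum_congr rfl fun d _ => ?_
  rw [Measure.real]
  ring

theorem convex_sum_segment {ι : Type*} (s : Finset ι) (e : ι → V) :
    CC (∑ i ∈ s, segment ℝ 0 (e i)) ∧ (∑ i ∈ s, segment ℝ 0 (e i)).Nonempty := by
  classical
  have hseg : ∀ v : V, CC (segment ℝ 0 v) := fun v => by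
    rw [← convexHull_pair]
    exact ⟨(Set.toFinite _).isCompact_convexHull ℝ, convex_convexHull _ _⟩
  induction s using Finset.induction_on with
  | empty => exact ⟨CC.singleton 0, Set.singleton_nonempty 0⟩
  | insert i s hi ih =>
    rw [Finset.sum_insert hi]
    exact ⟨(hseg _).add ih.1, Set.Nonempty.add ⟨0, left_mem_segment ℝ _ _⟩ ih.2⟩

theorem eq_singleton_of_querSet_one_eq_zero {n : ℕ} (hn : Module.finrank ℝ V = n) (hn2 : 2 ≤ n)
    {K : Set V} (hK : CC K) {x : V} (hx : x ∈ K) (h0 : querSet μ n 1 K = 0) : K = {x} := by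
  classical
  have hn1 : 1 ≤ n := by omega
  have hI := invVal_querSet μ n 1
  refine Set.eq_singleton_iff_unique_mem.2 ⟨hx, fun y hy => ?_⟩
  by_contra hyx
  have hv : y - x ≠ 0 := sub_ne_zero.2 hyx
  have hseg : ∀ v : V, CC (segment ℝ 0 v) ∧ (segment ℝ 0 v).Nonempty := fun v => by
    simpa using convex_sum_segment {()} fun _ => v
  have h1 : querSet μ n 1 (segment ℝ 0 (y - x)) = 0 := by
    refine le_antisymm ?_ (querSet_one_nonneg μ hn hn1 (hseg _).1 (hseg _).2)
    rw [← hI.transInv x _ (hseg _).1, ← h0]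
    refine querSet_one_mono μ hn hn1 ((CC.singleton x).add (hseg _).1)
      ((Set.singleton_nonempty x).add (hseg _).2) hK ?_
    rw [Set.singleton_add, segment_translate_image, add_zero, add_sub_cancel]
    exact hK.2.segment_subset hx hy
  have h2 : ∀ w : V, querSet μ n 1 (segment ℝ 0 w) = 0 := fun w => by
    have hs : segment ℝ 0 ((‖w‖ / ‖y - x‖) • (y - x)) = (‖w‖ / ‖y - x‖) • segment ℝ 0 (y - x) := by
      have := image_segment ℝ ((‖w‖ / ‖y - x‖) • LinearMap.id : V →ₗ[ℝ] V).toAffineMap 0 (y - x)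
      simpa using this.symm
    have h3 : querSet μ n 1 (segment ℝ 0 ((‖w‖ / ‖y - x‖) • (y - x))) = 0 := by
      rw [hs, hI.hcont.smul_of_additive (fun K L hK hK' hL hL' =>
        querSet_one_additive μ hn hn1 hK hK' hL hL') (hseg _).1 (hseg _).2 (by positivity), h1,
        mul_zero]
    obtain ⟨a, b, ha, hb, hab⟩ := exists_rot_eq (v := (‖w‖ / ‖y - x‖) • (y - x)) (v' := w)
      (by omega) (by
        rw [norm_smul, norm_div, norm_norm, norm_norm, div_mul_cancel₀ _ (norm_ne_zero_iff.2 hv)])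
    have hab' : refl a (refl b ((‖w‖ / ‖y - x‖) • (y - x))) = w := hab
    have := hI.rot a b _ ha hb (hseg ((‖w‖ / ‖y - x‖) • (y - x))).1
    rw [h3] at this
    have im : ∀ (u v : V), refl u '' segment ℝ 0 v = segment ℝ 0 (refl u v) := fun u v => by
      have := image_segment ℝ (refl u : V →ₗ[ℝ] V).toAffineMap 0 v
      simpa using this
    rwa [im, im, hab'] at this
  let e := stdOrthonormalBasis ℝ V
  have h3 : ∀ s : Finset (Fin (Module.finrank ℝ V)),
      querSet μ n 1 (∑ i ∈ s, segment ℝ 0 ((2 : ℝ) • e i)) = 0 := fun s => by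
    induction s using Finset.induction_on with
    | empty => exact querSet_one_singleton μ hn hn1 0
    | insert i s hi ih =>
      have := convex_sum_segment s fun i => (2 : ℝ) • e i
      rw [Finset.sum_insert hi, querSet_one_additive μ hn hn1 (hseg _).1 (hseg _).2 this.1 this.2,
        h2, ih, add_zero]
  have h4 := convex_sum_segment Finset.univ fun i => (2 : ℝ) • e i
  have h5 : Metric.closedBall (0 : V) 1 ⊆
      {-∑ i, e i} + ∑ i, segment ℝ 0 ((2 : ℝ) • e i) := by
    intro z hz
    refine ⟨_, rfl, ∑ i, (inner ℝ (e i) z + 1) • e i, ?_, ?_⟩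
    · refine Set.finsetSum_mem_finsetSum _ _ _ fun i _ => ?_
      have hi : |inner ℝ (e i) z| ≤ 1 := (abs_real_inner_le_norm _ _).trans (by
        rw [e.orthonormal.1 i, one_mul]
        exact mem_closedBall_zero_iff.1 hz)
      rw [abs_le] at hi
      rw [segment_eq_image]
      exact ⟨(inner ℝ (e i) z + 1) / 2, ⟨by linarith, by linarith⟩, by
        simp only [smul_zero, zero_add, smul_smul]
        congr 1
        ring⟩
    · simp only [add_smul, Finset.sum_add_distrib, one_smul, e.sum_repr']
      abel
  have h6 := querSet_one_mono μ hn hn1 (CC.closedBall 0 1) ⟨0, by simp⟩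
    ((CC.singleton _).add h4.1) h5
  rw [hI.transInv _ _ h4.1, h3] at h6
  linarith [querSet_unitBall_pos μ hn hn1]

end Quermass

section Classification

variable {V : Type} [NormedAddCommGroup V] [InnerProductSpace ℝ V]

theorem cub_comp_equiv {ι κ : Type} [Fintype ι] [Fintype κ] (e : ι → V) (σ : κ ≃ ι) :
    cub (e ∘ σ) = cub e := by
  ext x
  constructor
  · rintro ⟨t, ht, rfl⟩
    refine ⟨t ∘ σ.symm, ⟨fun i => ht.1 _, fun i => ht.2 _⟩, ?_⟩
    exact (Fintype.sum_equiv σ _ _ fun i => by simp).symm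
  · rintro ⟨t, ht, rfl⟩
    refine ⟨t ∘ σ, ⟨fun i => ht.1 _, fun i => ht.2 _⟩, ?_⟩
    exact Fintype.sum_equiv σ _ _ fun i => by simp

theorem refl_image_cub_of_orthogonal {ι : Type} [Fintype ι] {e : ι → V} {z : V}
    (hz : ∀ i, inner ℝ z (e i) = 0) : refl z '' cub e = cub e := by
  rw [image_cub]
  congr 1
  exact funext fun i => refl_of_inner_eq_zero (hz i)

/-- The image of a box with sides parallel to the vectors `e i`. -/
def box {ι : Type} [Fintype ι] (e : ι → V) (s : ι → ℝ) : Set V :=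
  (fun t : ι → ℝ => ∑ i, t i • e i) '' Set.Icc 0 s

theorem CC.box {ι : Type} [Fintype ι] (e : ι → V) (s : ι → ℝ) : CC (box e s) := by
  have h : CC (Set.Icc (0 : ι → ℝ) s) := ⟨isCompact_Icc, convex_Icc 0 s⟩
  have := h.image (∑ i, (ContinuousLinearMap.proj i : (ι → ℝ) →L[ℝ] ℝ).smulRight (e i))
  rwa [show ⇑(∑ i, (ContinuousLinearMap.proj i : (ι → ℝ) →L[ℝ] ℝ).smulRight (e i)) =
    fun t : ι → ℝ => ∑ i, t i • e i from funext fun t => by simp] at this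

theorem Simple.box_update {ι : Type} [Fintype ι] [DecidableEq ι] {ν : Set V → ℝ} (hν : IsVal ν)
    (hT : TransInv ν) (hs : Simple ν) {e : ι → V} (he : Orthonormal ℝ e) {s : ι → ℝ}
    {j : ι} (hj : s j = 1) :
    ν (box e (Function.update s j 2)) = 2 * ν (box e s) := by
  have hsum : ∀ t : ι → ℝ, e j + ∑ i, t i • e i = ∑ i, (t + Pi.single j 1 : ι → ℝ) i • e i := by
    intro t
    simp only [Pi.add_apply, add_smul, Finset.sum_add_distrib, Pi.single_apply, ite_smul, zero_smul,
      one_smul, Finset.sum_ite_eq', Finset.mem_univ, if_true]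
    rw [add_comm]
  have hin : ∀ t : ι → ℝ, inner ℝ (e j) (∑ i, t i • e i) = t j := fun t =>
    he.inner_right_fintype t j
  have hU : box e (Function.update s j 2) = box e s ∪ ({e j} + box e s) := by
    rw [Set.singleton_add]
    ext x
    constructor
    · rintro ⟨t, ht, rfl⟩
      rcases le_total (t j) 1 with h | h
      · refine Or.inl ⟨t, ⟨ht.1, fun i => ?_⟩, rfl⟩
        rcases eq_or_ne i j with rfl | hi
        · rwa [hj]
        · simpa [hi] using ht.2 i
      · refine Or.inr ⟨_, ⟨t - Pi.single j 1, ⟨fun i => ?_, fun i => ?_⟩, rfl⟩, ?_⟩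
        · rcases eq_or_ne i j with rfl | hi
          · simpa using h
          · simpa [hi] using ht.1 i
        · have := ht.2 i
          rcases eq_or_ne i j with rfl | hi
          · simp at this
            simp only [Pi.sub_apply, Pi.single_eq_same, hj]
            linarith
          · simpa [hi] using this
        · simp only [hsum, sub_add_cancel]
    · rintro (⟨t, ht, rfl⟩ | ⟨_, ⟨t, ht, rfl⟩, rfl⟩)
      · refine ⟨t, ⟨ht.1, fun i => (ht.2 i).trans ?_⟩, rfl⟩
        rcases eq_or_ne i j with rfl | hi
        · simp [hj]
        · simp [hi]
      · refine ⟨t + Pi.single j 1, ⟨fun i => ?_, fun i => ?_⟩, (hsum t).symm⟩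
        · have := ht.1 i
          rcases eq_or_ne i j with rfl | hi
          · simp at this ⊢
            linarith
          · simpa [hi] using this
        · have := ht.2 i
          rcases eq_or_ne i j with rfl | hi
          · simp [hj] at this ⊢
            linarith
          · simpa [hi] using this
  have hA := CC.box e s
  have h1 := hν.union_add_inter _ _ hA ((CC.singleton (e j)).add hA) (hU ▸ (CC.box e _).2)
  have h2 : ν (box e s ∩ ({e j} + box e s)) = 0 := by
    have hcl := ((CC.singleton (e j)).add hA)
    refine hs (e j) 1 _ (he.ne_zero j) (hA.inter hcl.1.isClosed hcl.2) ?_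
    rw [Set.singleton_add]
    rintro _ ⟨⟨t, ht, rfl⟩, ⟨_, ⟨t', ht', rfl⟩, h⟩⟩
    have h3 := congrArg (inner ℝ (e j)) h
    simp only [hsum, hin] at h3 ⊢
    have h4 := ht.2 j
    have h5 := ht'.1 j
    simp at h3 h5
    rw [hj] at h4
    linarith
  rw [← hU, h2, hT _ _ hA] at h1
  linarith

theorem Simple.two_smul_cub {ι : Type} [Fintype ι] {ν : Set V → ℝ} (hν : IsVal ν)
    (hT : TransInv ν) (hs : Simple ν) {e : ι → V} (he : Orthonormal ℝ e) :
    ν ((2 : ℝ) • cub e) = 2 ^ Fintype.card ι * ν (cub e) := by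
  classical
  have h : ∀ S : Finset ι, ν (box e fun i => if i ∈ S then 2 else 1) = 2 ^ S.card * ν (cub e) := by
    intro S
    induction S using Finset.induction_on with
    | empty => simp [box, cub, Pi.one_def]
    | insert j S hj ih =>
      rw [Finset.card_insert_of_notMem hj, pow_succ', mul_assoc, ← ih,
        ← Simple.box_update hν hT hs he (j := j) (if_neg hj)]
      congr 2
      ext i
      rcases eq_or_ne i j with rfl | hi
      · simp
      · simp [hi]
  have h2 : box e (fun i => if i ∈ Finset.univ then 2 else 1) = (2 : ℝ) • cub e := by
    ext x
    rw [Set.mem_smul_set]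
    constructor
    · rintro ⟨t, ht, rfl⟩
      refine ⟨_, ⟨fun i => t i / 2, ⟨fun i => ?_, fun i => ?_⟩, rfl⟩, ?_⟩
      · have := ht.1 i
        simp at this ⊢
        linarith
      · have := ht.2 i
        simp at this ⊢
        linarith
      · simp only [Finset.smul_sum, smul_smul]
        exact Finset.sum_congr rfl fun i _ => by congr 1; ring
    · rintro ⟨_, ⟨t, ht, rfl⟩, rfl⟩
      refine ⟨fun i => 2 * t i, ⟨fun i => ?_, fun i => ?_⟩, ?_⟩
      · have := ht.1 i
        simp at this ⊢
        linarith
      · have := ht.2 i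
        simp at this ⊢
        linarith
      · simp only [Finset.smul_sum, smul_smul]
  rw [← h2, h, Finset.card_univ]

variable [FiniteDimensional ℝ V]

theorem simple_of_lower {ν : Set V → ℝ} (h0 : ν ∅ = 0) (hT : TransInv ν) (E : Submodule ℝ V)
    (ih : ∀ E' : Submodule ℝ V, Module.finrank ℝ E' < Module.finrank ℝ E → ∀ F : Set V, CC F →
      F ⊆ E' → ν F = 0) : Simple fun F : Set E => ν (E.subtypeL '' F + {0}) := by
  intro u c F hu hF hc
  simp only [Set.singleton_zero, add_zero]
  rcases F.eq_empty_or_nonempty with rfl | ⟨x, hx⟩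
  · simpa using h0
  rw [← hT (-(x : V)) _ (hF.image _)]
  refine ih (E ⊓ (ℝ ∙ (u : V))ᗮ) (Submodule.finrank_lt_finrank_of_lt
    (lt_of_le_of_ne inf_le_left fun h => ?_)) _ ((CC.singleton _).add (hF.image _)) ?_
  · have hu' : (u : V) ∈ (ℝ ∙ (u : V))ᗮ := (h.symm ▸ u.2 : (u : V) ∈ E ⊓ (ℝ ∙ (u : V))ᗮ).2
    rw [Submodule.mem_orthogonal_singleton_iff_inner_right, inner_self_eq_zero] at hu'
    exact hu (by simpa using hu')
  · rw [Set.singleton_add]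
    rintro _ ⟨_, ⟨y, hy, rfl⟩, rfl⟩
    refine ⟨E.add_mem (E.neg_mem x.2) y.2, ?_⟩
    rw [SetLike.mem_coe, Submodule.mem_orthogonal_singleton_iff_inner_right, inner_add_right,
      inner_neg_right]
    have h1 := hc x hx
    have h2 := hc y hy
    rw [Submodule.coe_inner] at h1 h2
    rw [h1, Submodule.subtypeL_apply, h2]
    ring

/-- A homogeneous invariant valuation vanishes if it vanishes on unit cubes of the right
dimension. -/
theorem InvVal.eq_zero_of_cub {ν : Set V → ℝ} (h : InvVal ν) {i : ℕ} (hi : 1 ≤ i)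
    (h2 : ∀ K, CC K → ν ((2 : ℝ) • K) = 2 ^ i * ν K)
    (hcub : ∀ (ι : Type) [Fintype ι] (e : ι → V), Orthonormal ℝ e → Fintype.card ι = i →
      ν (cub e) = 0) {K : Set V} (hK : CC K) : ν K = 0 := by
  have key : ∀ (m : ℕ) (E : Submodule ℝ V), Module.finrank ℝ E = m → ∀ F : Set V, CC F →
      F ⊆ E → ν F = 0 := by
    intro m
    induction m using Nat.strong_induction_on with
    | _ m ih =>
    rintro E rfl F hF hFE
    rcases Nat.eq_zero_or_pos (Module.finrank ℝ E) with hE | hE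
    · rw [Submodule.finrank_eq_zero.1 hE, Submodule.bot_coe, Set.subset_singleton_iff_eq] at hFE
      rcases hFE with rfl | rfl
      · exact h.isVal.empty
      · have := h2 {0} (CC.singleton 0)
        rw [Set.smul_set_singleton, smul_zero] at this
        have h3 : (2 : ℝ) ≤ 2 ^ i := by
          calc (2 : ℝ) = 2 ^ 1 := by norm_num
            _ ≤ 2 ^ i := pow_le_pow_right₀ (by norm_num) hi
        have h4 : ((2 : ℝ) ^ i - 1) * ν {0} = 0 := by linarith
        exact (mul_eq_zero.1 h4).resolve_left (by linarith)
    have hQ := CC.singleton (0 : V)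
    have hQE : ({0} : Set V) ⊆ Eᗮ := by simp
    have hs := simple_of_lower h.isVal.empty h.transInv E fun E' hE' F hF hFE' =>
      ih _ hE' E' rfl F hF hFE'
    have hI := h.sub E hQ (Set.singleton_nonempty 0) hQE
    have := hI.eq_zero_of_simple hE hs (fun ι _ e he hι => by
      have heV : Orthonormal ℝ fun i => (e i : V) := he.comp_linearIsometry E.subtypeₗᵢ
      by_cases hιi : Fintype.card ι = i
      · rw [image_cub, Set.singleton_zero, add_zero]
        exact hcub ι _ heV hιi
      have h3 := Simple.two_smul_cub hI.isVal hI.transInv hs he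
      have h4 : E.subtypeL '' ((2 : ℝ) • cub e) = (2 : ℝ) • (E.subtypeL '' cub e) :=
        Set.image_smul_comm E.subtypeL (2 : ℝ) _ (by simp)
      rw [h4] at h3
      simp only [Set.singleton_zero, add_zero] at h3 ⊢
      rw [h2 _ ((CC.cub e).image _)] at h3
      have h5 : ((2 : ℝ) ^ i - 2 ^ Fintype.card ι) * ν (E.subtypeL '' cub e) = 0 := by linarith
      refine (mul_eq_zero.1 h5).resolve_left fun h6 => hιi ?_
      exact (pow_right_injective₀ (by norm_num) (by norm_num) (sub_eq_zero.1 h6)).symm)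
      hF.preimage_subtypeL
    rwa [subtypeL_image_preimage hFE, Set.singleton_zero, add_zero] at this
  exact key _ ⊤ rfl K hK (by simp)

theorem exists_orthogonal_family {ι : Type} [Fintype ι] (e : ι → V)
    (hι : Fintype.card ι < Module.finrank ℝ V) : ∃ z : V, z ≠ 0 ∧ ∀ i, inner ℝ z (e i) = 0 := by
  have h : Submodule.span ℝ (Set.range e) < ⊤ := by
    refine lt_top_iff_ne_top.2 fun h => ?_
    have := finrank_range_le_card (R := ℝ) e
    rw [Set.finrank, h, finrank_top] at this
    omega
  have h' : (Submodule.span ℝ (Set.range e))ᗮ ≠ ⊥ := by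
    rw [Ne, Submodule.orthogonal_eq_bot_iff]
    exact h.ne
  obtain ⟨z, hz, hz0⟩ := Submodule.exists_mem_ne_zero_of_ne_bot h'
  exact ⟨z, hz0, fun i => Submodule.inner_left_of_mem_orthogonal
    (Submodule.subset_span (Set.mem_range_self i)) hz⟩

theorem InvVal.cub_eq {ν : Set V → ℝ} (h : InvVal ν) {ι : Type} [Fintype ι]
    (hι : Fintype.card ι < Module.finrank ℝ V) {e f : ι → V} (he : Orthonormal ℝ e)
    (hf : Orthonormal ℝ f) : ν (cub e) = ν (cub f) := by
  classical
  have key : ∀ S : Finset ι, ∃ e' : ι → V, Orthonormal ℝ e' ∧ ν (cub e') = ν (cub e) ∧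
      ∀ j ∈ S, e' j = f j := by
    intro S
    induction S using Finset.induction_on with
    | empty => exact ⟨e, he, rfl, by simp⟩
    | insert k S hk ih =>
      obtain ⟨e', he', hν, hS⟩ := ih
      set u := e' k - f k with hu
      refine ⟨fun i => refl u (e' i), ⟨fun i => ?_, fun i j hij => ?_⟩, ?_, ?_⟩
      · rw [norm_refl, he'.1]
      · simp only [inner_refl_refl]
        exact he'.2 hij
      · rw [← image_cub, ← hν]
        rcases eq_or_ne u 0 with h0 | h0
        · rw [h0]
          simp [refl_zero]
        obtain ⟨z, hz, hz'⟩ := exists_orthogonal_family e' hι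
        rw [← h.rot u z _ h0 hz (CC.cub e'), refl_image_cub_of_orthogonal hz']
      · intro j hj
        rcases Finset.mem_insert.1 hj with rfl | hj
        · exact refl_sub (by rw [he'.1, hf.1])
        · have hjk : j ≠ k := fun h => hk (h ▸ hj)
          dsimp only
          rw [refl_of_inner_eq_zero, hS j hj]
          rw [hu, inner_sub_left, he'.2 hjk.symm, hS j hj, hf.2 hjk.symm, sub_zero]
  obtain ⟨e', -, h1, h2⟩ := key Finset.univ
  rw [← h1, funext fun j => h2 j (Finset.mem_univ j)]

/-- Two homogeneous invariant valuations of the same degree are proportional. -/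
theorem InvVal.proportional {ν ω : Set V → ℝ} (hν : InvVal ν) (hω : InvVal ω) {i : ℕ} (hi : 1 ≤ i)
    (hi' : i < Module.finrank ℝ V) (hν2 : ∀ K, CC K → ν ((2 : ℝ) • K) = 2 ^ i * ν K)
    (hω2 : ∀ K, CC K → ω ((2 : ℝ) • K) = 2 ^ i * ω K) {B : Set V} (hB : CC B) (hB0 : ν B ≠ 0) :
    ∃ r : ℝ, ∀ K, CC K → ω K = r * ν K := by
  let e₀ : Fin i → V := stdOrthonormalBasis ℝ V ∘ Fin.castLE hi'.le
  have he₀ : Orthonormal ℝ e₀ :=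
    (stdOrthonormalBasis ℝ V).orthonormal.comp _ (Fin.castLE_injective _)
  have hcub : ∀ {σ : Set V → ℝ}, InvVal σ → ∀ (ι : Type) [Fintype ι] (e : ι → V),
      Orthonormal ℝ e → Fintype.card ι = i → σ (cub e) = σ (cub e₀) := by
    intro σ hσ ι _ e he hι
    have τ := (Fintype.equivFinOfCardEq hι).symm
    rw [← cub_comp_equiv e τ]
    exact hσ.cub_eq (by simpa using hi') (he.comp _ τ.injective) he₀
  have h0 : ν (cub e₀) ≠ 0 := fun h => hB0 (hν.eq_zero_of_cub hi hν2
    (fun ι _ e he hι => (hcub hν ι e he hι).trans h) hB)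
  refine ⟨ω (cub e₀) / ν (cub e₀), fun K hK => ?_⟩
  set r := ω (cub e₀) / ν (cub e₀) with hr
  have hg : InvVal fun K => ω K + -r * ν K :=
    ⟨hω.isVal.add (hν.isVal.const_mul _), hω.transInv.add (hν.transInv.const_mul _),
      hω.hcont.add (hν.hcont.const_mul _), fun u w K hu hw hK => by
        simp only [hω.rot u w K hu hw hK, hν.rot u w K hu hw hK]⟩
  have := hg.eq_zero_of_cub hi (fun K hK => by rw [hν2 K hK, hω2 K hK]; ring)
    (fun ι _ e he hι => by
      rw [hcub hν ι e he hι, hcub hω ι e he hι, hr, neg_mul, div_mul_cancel₀ _ h0, add_neg_cancel])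
    hK
  linarith

theorem VecVal.cub_eq_zero (hd : 2 ≤ Module.finrank ℝ V) {p : Set V → V} (h : VecVal p) {ι : Type}
    [Fintype ι] {e : ι → V} (he : Orthonormal ℝ e) : p (cub e) = 0 := by
  classical
  have hflip : ∀ a b : V, a ≠ 0 → b ≠ 0 → inner ℝ b a = 0 →
      (∃ x, refl a '' cub e = {x} + cub e) → (∃ x, refl b '' cub e = {x} + cub e) →
      inner ℝ (p (cub e)) a = 0 := by
    rintro a b ha hb hab ⟨x, hx⟩ ⟨y, hy⟩
    have h1 := h.rot a b _ ha hb (CC.cub e)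
    rw [hy, Set.image_add, Set.image_singleton, hx, ← add_assoc, Set.singleton_add_singleton,
      h.transInv _ _ (CC.cub e)] at h1
    have h2 := congrArg (fun v => inner ℝ v a) h1
    simp only [inner_refl_left, refl_self, refl_of_inner_eq_zero hab,
      inner_neg_right] at h2
    linarith
  have hz : ∀ z : V, (∀ i, inner ℝ z (e i) = 0) → ∃ x, refl z '' cub e = {x} + cub e := fun z hz =>
    ⟨0, by rw [refl_image_cub_of_orthogonal hz, Set.singleton_zero, zero_add]⟩
  have he' : ∀ i, ∃ x, refl (e i) '' cub e = {x} + cub e := fun i => ⟨_, refl_cub he i⟩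
  have h1 : ∀ i, inner ℝ (p (cub e)) (e i) = 0 := by
    intro i
    by_cases hi : ∃ k, k ≠ i
    · obtain ⟨k, hk⟩ := hi
      exact hflip _ _ (he.ne_zero i) (he.ne_zero k) (he.2 hk) (he' i) (he' k)
    · push Not at hi
      obtain ⟨z, hz0, hzi⟩ := exists_ne_zero_orthogonal hd (e i)
      exact hflip _ _ (he.ne_zero i) hz0 hzi (he' i) (hz z fun k => by rw [hi k, hzi])
  have h2 : ∀ z : V, (∀ i, inner ℝ z (e i) = 0) → inner ℝ (p (cub e)) z = 0 := by
    intro z hz1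
    rcases eq_or_ne z 0 with rfl | hz0
    · exact inner_zero_right _
    rcases isEmpty_or_nonempty ι with hι | ⟨⟨i⟩⟩
    · obtain ⟨y, hy0, hyz⟩ := exists_ne_zero_orthogonal hd z
      exact hflip _ _ hz0 hy0 hyz (hz z hz1) (hz y fun i => (hι.false i).elim)
    · exact hflip _ _ hz0 (he.ne_zero i) (by rw [real_inner_comm, hz1]) (hz z hz1) (he' i)
  refine ext_inner_right ℝ fun w => ?_
  obtain ⟨a, ha, b, hb, rfl⟩ := (Submodule.span ℝ (Set.range e)).exists_add_mem_mem_orthogonal w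
  rw [inner_zero_left, inner_add_right, h2 b fun i => Submodule.inner_left_of_mem_orthogonal
    (Submodule.subset_span (Set.mem_range_self i)) hb, add_zero]
  induction ha using Submodule.span_induction with
  | mem x hx =>
    obtain ⟨i, rfl⟩ := hx
    exact h1 i
  | zero => exact inner_zero_right _
  | add x y _ _ hx hy => rw [inner_add_right, hx, hy, add_zero]
  | smul t x _ hx => rw [inner_smul_right, hx, mul_zero]

/-- Rotation equivariant, translation invariant vector valued valuations vanish. -/
theorem VecVal.eq_zero (hd : 3 ≤ Module.finrank ℝ V) {p : Set V → V} (h : VecVal p) {K : Set V}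
    (hK : CC K) : p K = 0 := by
  have h0 : p ∅ = 0 := ext_inner_right ℝ fun w => by rw [(h.isVal w).empty, inner_zero_left]
  have hT : ∀ w, TransInv fun K => inner ℝ (p K) w := fun w x K hK => by
    simp only [h.transInv x K hK]
  have hs : ∀ (E : Submodule ℝ V), (∀ E' : Submodule ℝ V,
      Module.finrank ℝ E' < Module.finrank ℝ E → ∀ F : Set V, CC F → F ⊆ E' → p F = 0) →
      ∀ w, Simple fun F : Set E => inner ℝ (p (E.subtypeL '' F + {0})) w := fun E ih w =>
    simple_of_lower (ν := fun F => inner ℝ (p F) w) (h.isVal w).empty (hT w) E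
      fun E' hE' F hF hFE' => by rw [ih E' hE' F hF hFE', inner_zero_left]
  have hQ := CC.singleton (0 : V)
  have key : ∀ (m : ℕ) (E : Submodule ℝ V), Module.finrank ℝ E = m → ∀ F : Set V, CC F →
      F ⊆ E → p F = 0 := by
    intro m
    induction m using Nat.strong_induction_on with
    | _ m ih =>
    rintro E rfl F hF hFE
    have hQE : ({0} : Set V) ⊆ Eᗮ := by simp
    have hsE := hs E fun E' hE' F hF hFE' => ih _ hE' E' rfl F hF hFE'
    rcases Nat.eq_zero_or_pos (Module.finrank ℝ E) with hE | hE
    · rw [Submodule.finrank_eq_zero.1 hE, Submodule.bot_coe, Set.subset_singleton_iff_eq] at hFE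
      rcases hFE with rfl | rfl
      · exact h0
      · have := h.cub_eq_zero (by omega) (e := fun i : Empty => i.elim)
          ⟨fun i => i.elim, fun i => i.elim⟩
        simpa [cub] using this
    have hcubE : ∀ (ι : Type) [Fintype ι] (e : ι → E), Orthonormal ℝ e →
        p (E.subtypeL '' cub e + {0}) = 0 := fun ι _ e he => by
      have heV : Orthonormal ℝ fun i => (e i : V) := he.comp_linearIsometry E.subtypeₗᵢ
      rw [image_cub, Set.singleton_zero, add_zero]
      exact h.cub_eq_zero (by omega) heV
    have hFF : E.subtypeL '' (E.subtypeL ⁻¹' F) + {0} = F := by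
      rw [subtypeL_image_preimage hFE, Set.singleton_zero, add_zero]
    have h1 : ∀ w ∈ Eᗮ, inner ℝ (p F) w = 0 := fun w hw => by
      have := (h.inner_sub E hQ (Set.singleton_nonempty 0) hQE hw).eq_zero_of_simple hE (hsE w)
        (fun ι _ e he _ => by rw [hcubE ι e he, inner_zero_left]) hF.preimage_subtypeL
      rwa [hFF] at this
    have h2 : E.orthogonalProjectionOnto (p F) = 0 := by
      have := (h.sub E hQ (Set.singleton_nonempty 0) hQE).eq_zero_of_simple hE
        (fun hE2 u K hu hK => by
          have hE' : Eᗮ ≠ ⊥ := by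
            rw [Ne, Submodule.orthogonal_eq_bot_iff]
            rintro rfl
            rw [finrank_top] at hE2
            omega
          obtain ⟨z, hz, hz0⟩ := Submodule.exists_mem_ne_zero_of_ne_bot hE'
          have e1 := h.rot u z _ (by simpa using hu) hz0 ((hK.image E.subtypeL).add hQ)
          rw [refl_image_of_orthogonal hz, refl_image_add _ _ hQE] at e1
          · rw [e1, proj_refl, proj_refl_of_orthogonal _ hz]
          · rw [Set.singleton_zero, add_zero]
            rintro _ ⟨x, -, rfl⟩
            exact E.le_orthogonal_orthogonal x.2)
        (fun w => by
          simp only [inner_proj]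
          exact hsE w)
        (fun ι _ e he _ => by rw [hcubE ι e he, map_zero]) hF.preimage_subtypeL
      rwa [hFF] at this
    refine ext_inner_right ℝ fun w => ?_
    obtain ⟨a, ha, b, hb, rfl⟩ := E.exists_add_mem_mem_orthogonal w
    have h3 := inner_proj E (p F) ⟨a, ha⟩
    rw [h2, inner_zero_left] at h3
    rw [inner_zero_left, inner_add_right, h1 b hb, add_zero]
    exact h3.symm
  exact key _ ⊤ rfl K hK (by simp)

end Classification

section Bodies

open MeasureTheory

variable {n : ℕ}

theorem CC.coe (K : Body n) : CC (K : Set (En n)) := ⟨K.isCompact, K.convex⟩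

theorem coe_nsmul_body (k : ℕ) (K : Body n) :
    ((k • K : Body n) : Set (En n)) = (k : ℝ) • (K : Set (En n)) := by
  induction k with
  | zero => rw [zero_nsmul, ConvexBody.coe_zero, Nat.cast_zero, Set.zero_smul_set K.nonempty]
  | succ k ih =>
    rw [succ_nsmul, ConvexBody.coe_add, ih, Nat.cast_succ,
      K.convex.add_smul (Nat.cast_nonneg k) zero_le_one, one_smul]

theorem coe_nsmul_unitB (k : ℕ) :
    ((k • unitB n : Body n) : Set (En n)) = Metric.closedBall 0 (k : ℝ) := by
  rw [coe_nsmul_body]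
  change (k : ℝ) • Metric.closedBall (0 : En n) 1 = _
  rw [smul_closedBall _ _ zero_le_one, smul_zero, mul_one, Real.norm_natCast]

theorem quer_eq_querSet (hn : 1 ≤ n) {i : ℕ} (hi : i ≤ n) (K : Body n) :
    quer (n - i) K = querSet volume n i (K : Set (En n)) := by
  have hV : 0 < Module.finrank ℝ (En n) := by rwa [finrank_euclideanSpace_fin]
  have := Module.finrank_pos_iff.1 hV
  rw [quer, mixedVol, querSet, Nat.sub_sub_self hi]
  congr 1
  refine Finset.sum_congr rfl fun S _ => ?_
  rcases S.eq_empty_or_nonempty with rfl | hS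
  · rw [if_neg Finset.not_nonempty_empty, Finset.filter_empty, Finset.filter_empty,
      Finset.card_empty, Nat.cast_zero, Set.zero_smul_set K.nonempty, zero_add,
      Metric.closedBall_zero, measureReal_def, measure_singleton, ENNReal.toReal_zero, mul_zero]
  · rw [if_pos hS, Finset.sum_ite, Finset.sum_const, Finset.sum_const, bvol, ConvexBody.coe_add,
      coe_nsmul_body, coe_nsmul_unitB, measureReal_def]

theorem dist_lt_of_subset {K L : Body n} {δ : ℝ} (hδ : 0 < δ)
    (h1 : (K : Set (En n)) ⊆ (L : Set (En n)) + Metric.closedBall 0 (δ / 2))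
    (h2 : (L : Set (En n)) ⊆ (K : Set (En n)) + Metric.closedBall 0 (δ / 2)) : dist L K < δ := by
  have key : ∀ {A B : Set (En n)}, A ⊆ B + Metric.closedBall 0 (δ / 2) →
      ∀ x ∈ A, ∃ y ∈ B, dist x y ≤ δ / 2 := by
    intro A B h x hx
    obtain ⟨y, hy, z, hz, rfl⟩ := h hx
    exact ⟨y, hy, by simpa using hz⟩
  rw [← ConvexBody.hausdorffDist_coe]
  exact (Metric.hausdorffDist_le_of_mem_dist (by positivity) (key h2) (key h1)).trans_lt
    (half_lt_self hδ)

theorem subset_add_closedBall {K L : Body n} {δ : ℝ} (h : dist K L < δ) :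
    (K : Set (En n)) ⊆ (L : Set (En n)) + Metric.closedBall 0 δ := by
  intro x hx
  rw [← ConvexBody.hausdorffDist_coe] at h
  obtain ⟨y, hy, hxy⟩ := Metric.exists_dist_lt_of_hausdorffDist_lt hx h
    (ConvexBody.hausdorffEDist_ne_top)
  exact ⟨y, hy, x - y, by simpa [dist_eq_norm] using hxy.le, by simp⟩

theorem HCont.continuous_coe {ν : Set (En n) → ℝ} (h : HCont ν) :
    Continuous fun K : Body n => ν (K : Set (En n)) := by
  rw [Metric.continuous_iff]
  intro K ε hε
  obtain ⟨δ, hδ, H⟩ := h K (CC.coe K) K.nonempty ε hε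
  exact ⟨δ, hδ, fun L hL => H L (CC.coe L) L.nonempty
    (subset_add_closedBall (by rwa [dist_comm])) (subset_add_closedBall hL)⟩

open Classical in
/-- Extension of a function on convex bodies to all sets by the value `0`. -/
def extendBody {α : Type*} [Zero α] (f : Body n → α) (s : Set (En n)) : α :=
  if h : CC s ∧ s.Nonempty then f ⟨s, h.1.2, h.1.1, h.2⟩ else 0

theorem extendBody_coe {α : Type*} [Zero α] (f : Body n → α) (K : Body n) :
    extendBody f (K : Set (En n)) = f K := by
  rw [extendBody, dif_pos ⟨CC.coe K, K.nonempty⟩]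
  rfl

theorem extendBody_empty {α : Type*} [Zero α] (f : Body n → α) : extendBody f ∅ = 0 :=
  dif_neg fun h => Set.not_nonempty_empty h.2

theorem inner_extendBody (p : Body n → En n) (w : En n) (s : Set (En n)) :
    inner ℝ (extendBody p s) w = extendBody (fun K => inner ℝ (p K) w) s := by
  by_cases h : CC s ∧ s.Nonempty
  · rw [extendBody, extendBody, dif_pos h, dif_pos h]
  · rw [extendBody, extendBody, dif_neg h, dif_neg h, inner_zero_left]

theorem CC.exists_coe {s : Set (En n)} (h : CC s) (h' : s.Nonempty) :
    ∃ K : Body n, (K : Set (En n)) = s := ⟨⟨s, h.2, h.1, h'⟩, rfl⟩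

theorem IsVal.extendBody {f : Body n → ℝ} (hf : IsValuation f) : IsVal (extendBody f) where
  empty := extendBody_empty f
  union_add_inter A B hA hB hAB := by
    rcases A.eq_empty_or_nonempty with rfl | hA'
    · rw [Set.empty_union, Set.empty_inter, add_comm]
    rcases B.eq_empty_or_nonempty with rfl | hB'
    · rw [Set.union_empty, Set.inter_empty]
    obtain ⟨a, ha⟩ := hA'
    obtain ⟨b, hb⟩ := hB'
    obtain ⟨z, -, hz⟩ := exists_mem_segment_inter hA.1.isClosed hB.1.isClosed hAB ha hb
    obtain ⟨I, hI⟩ := (hA.inter hB.1.isClosed hB.2).exists_coe ⟨z, hz⟩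
    obtain ⟨U, hU⟩ := CC.exists_coe ⟨hA.1.union hB.1, hAB⟩ ⟨a, Or.inl ha⟩
    obtain ⟨K, rfl⟩ := hA.exists_coe ⟨a, ha⟩
    obtain ⟨L, rfl⟩ := hB.exists_coe ⟨b, hb⟩
    rw [← hU, ← hI, extendBody_coe, extendBody_coe, extendBody_coe, extendBody_coe,
      hf K L U I hU hI]

theorem HCont.extendBody {f : Body n → ℝ} (hf : Continuous f) : HCont (extendBody f) := by
  intro K hK hK' ε hε
  obtain ⟨K, rfl⟩ := hK.exists_coe hK'
  obtain ⟨δ, hδ, H⟩ := Metric.continuous_iff.1 hf K ε hε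
  refine ⟨δ / 2, by positivity, fun L hL hL' h1 h2 => ?_⟩
  obtain ⟨L, rfl⟩ := hL.exists_coe hL'
  rw [extendBody_coe, extendBody_coe, ← Real.dist_eq]
  exact H L (dist_lt_of_subset hδ h1 h2)

theorem extendBody_translate {α : Type*} [Zero α] {f : Body n → α} (hf : IsTransInv f) (x : En n)
    (K : Set (En n)) (hK : CC K) : extendBody f ({x} + K) = extendBody f K := by
  rcases K.eq_empty_or_nonempty with rfl | hK'
  · rw [Set.add_empty]
  · obtain ⟨K, rfl⟩ := hK.exists_coe hK'
    rw [extendBody_coe, ← hf x K, ← extendBody_coe f (transBody x K), Set.singleton_add]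
    rfl

theorem det_refl {V : Type} [NormedAddCommGroup V] [InnerProductSpace ℝ V] [FiniteDimensional ℝ V]
    {u : V} (hu : u ≠ 0) : LinearMap.det (refl u : V →ₗ[ℝ] V) = -1 := by
  have h : (refl u : V →ₗ[ℝ] V) = (ℝ ∙ u)ᗮ.reflection.toLinearMap := by
    ext x
    change refl u x = (ℝ ∙ u)ᗮ.reflection x
    rw [Submodule.reflection_orthogonal_apply, Submodule.reflection_singleton_apply, refl_apply]
    simp only [neg_sub, ← Nat.cast_smul_eq_nsmul ℝ, smul_smul, RCLike.ofReal_real_eq_id, id]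
    push_cast
    ring_nf
  rw [h, Submodule.det_reflection, Submodule.orthogonal_orthogonal, finrank_span_singleton hu,
    pow_one]

theorem exists_SOGroup {u w : En n} (hu : u ≠ 0) (hw : w ≠ 0) :
    ∃ g : SOGroup n, ∀ x, Matrix.toEuclideanLin (SOMat g) x = refl u (refl w x) := by
  let M : Matrix (Fin n) (Fin n) ℝ := (Matrix.toEuclideanCLM (n := Fin n) (𝕜 := ℝ)).symm (rot u w)
  have hM : M ∈ Matrix.orthogonalGroup (Fin n) ℝ :=
    Unitary.map_mem (Matrix.toEuclideanCLM (n := Fin n) (𝕜 := ℝ)).symm (rot u w).2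
  have hlin : Matrix.toEuclideanLin M =
      (refl u : En n →ₗ[ℝ] En n) ∘ₗ (refl w : En n →ₗ[ℝ] En n) := by
    rw [← Matrix.coe_toEuclideanCLM_eq_toEuclideanLin]
    simp only [M, StarAlgEquiv.apply_symm_apply]
    rfl
  have hdet : M.det = 1 := by
    rw [← LinearMap.det_toLin (EuclideanSpace.basisFun (Fin n) ℝ).toBasis M,
      ← Matrix.toEuclideanLin_eq_toLin_orthonormal, hlin, LinearMap.det_comp, det_refl hu,
      det_refl hw]
    norm_num
  exact ⟨⟨⟨M, hM⟩, hdet⟩, fun x => by rw [SOMat, hlin]; rfl⟩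

theorem coe_rotBody {u w : En n} {g : SOGroup n}
    (hg : ∀ x, Matrix.toEuclideanLin (SOMat g) x = refl u (refl w x)) (K : Body n) :
    (rotBody g K : Set (En n)) = refl u '' (refl w '' (K : Set (En n))) := by
  change Matrix.toEuclideanLin (SOMat g) '' _ = _
  rw [Set.image_image]
  exact Set.image_congr fun x _ => hg x

theorem invVal_querSet_comp (hn : 1 ≤ n) {i : ℕ} {Φ : Body n → Body n} (hΦ : IsMinkValHom i Φ)
    (hSO : IsSOEquivariant Φ) :
    InvVal (extendBody fun K => querSet volume n 1 (Φ K : Set (En n))) := by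
  have hfin : Module.finrank ℝ (En n) = n := finrank_euclideanSpace_fin
  have hq := invVal_querSet (volume : Measure (En n)) n 1
  refine ⟨IsVal.extendBody fun K L U I hU hI => ?_, extendBody_translate fun x K => ?_,
    HCont.extendBody (hq.hcont.continuous_coe.comp hΦ.1), fun u w K hu hw hK => ?_⟩
  · have hadd : ∀ A B : Body n, querSet volume n 1 ((A + B : Body n) : Set (En n)) =
        querSet volume n 1 (A : Set (En n)) + querSet volume n 1 (B : Set (En n)) := fun A B =>
      querSet_one_additive volume hfin hn (CC.coe A) A.nonempty (CC.coe B) B.nonempty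
    rw [← hadd, ← hadd, hΦ.2.1 K L U I hU hI]
  · rw [hΦ.2.2.1]
  · rcases K.eq_empty_or_nonempty with rfl | hK'
    · rw [Set.image_empty, Set.image_empty]
    obtain ⟨K, rfl⟩ := hK.exists_coe hK'
    obtain ⟨g, hg⟩ := exists_SOGroup hu hw
    rw [← coe_rotBody hg, extendBody_coe, extendBody_coe, hSO, coe_rotBody hg,
      hq.rot _ _ _ hu hw (CC.coe _)]

theorem vecVal_of_singleton {i : ℕ} {Φ : Body n → Body n} (hΦ : IsMinkValHom i Φ)
    (hSO : IsSOEquivariant Φ) {p : Body n → En n} (hp : ∀ K, (Φ K : Set (En n)) = {p K}) :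
    VecVal (extendBody p) := by
  have hcont : Continuous p := Metric.continuous_iff.2 fun K ε hε => by
    obtain ⟨δ, hδ, H⟩ := Metric.continuous_iff.1 hΦ.1 K ε hε
    refine ⟨δ, hδ, fun L hL => ?_⟩
    have := H L hL
    rwa [← ConvexBody.hausdorffDist_coe, hp, hp, Metric.hausdorffDist_singleton] at this
  refine ⟨fun w => ?_, extendBody_translate fun x K => ?_, fun w => ?_, fun u w K hu hw hK => ?_⟩
  · simp only [inner_extendBody]
    refine IsVal.extendBody fun K L U I hU hI => ?_
    have h := congrArg (fun A : Body n => (A : Set (En n))) (hΦ.2.1 K L U I hU hI)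
    simp only [ConvexBody.coe_add, hp, Set.singleton_add_singleton,
      Set.singleton_eq_singleton_iff] at h
    rw [← inner_add_left, h, inner_add_left]
  · rw [← Set.singleton_eq_singleton_iff, ← hp, ← hp, hΦ.2.2.1]
  · simp only [inner_extendBody]
    exact HCont.extendBody (hcont.inner continuous_const)
  · rcases K.eq_empty_or_nonempty with rfl | hK'
    · rw [Set.image_empty, Set.image_empty, extendBody_empty, map_zero, map_zero]
    obtain ⟨K, rfl⟩ := hK.exists_coe hK'
    obtain ⟨g, hg⟩ := exists_SOGroup hu hw
    rw [← coe_rotBody hg, extendBody_coe, extendBody_coe, ← Set.singleton_eq_singleton_iff, ← hp,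
      hSO, coe_rotBody hg, hp, Set.image_singleton, Set.image_singleton]

theorem querSet_comp_two_smul (hn : 1 ≤ n) {i : ℕ} {Φ : Body n → Body n} (hΦ : IsMinkValHom i Φ)
    (K : Set (En n)) (hK : CC K) :
    extendBody (fun K => querSet volume n 1 (Φ K : Set (En n))) ((2 : ℝ) • K) =
      2 ^ i * extendBody (fun K => querSet volume n 1 (Φ K : Set (En n))) K := by
  rcases K.eq_empty_or_nonempty with rfl | hK'
  · rw [Set.smul_set_empty, extendBody_empty, mul_zero]
  obtain ⟨K, rfl⟩ := hK.exists_coe hK'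
  have h : (2 : ℝ) • (K : Set (En n)) = (scaleBody 2 K : Body n) := rfl
  rw [h, extendBody_coe, extendBody_coe, hΦ.2.2.2 2 two_pos]
  exact (invVal_querSet volume n 1).hcont.smul_of_additive
    (fun A B hA hA' hB hB' =>
      querSet_one_additive volume finrank_euclideanSpace_fin hn hA hA' hB hB')
    (CC.coe (Φ K)) (Φ K).nonempty (by positivity)

end Bodies

end Hadwiger

/-- **Lemma 7.4 (a).** For a non-trivial `SO(n)` equivariant `Φ_i ∈ MVal_i` there is a
constant `r(Φ_i) > 0` with `W_{n-1}(Φ_i K) = r(Φ_i) W_{n-i}(K)` for all `K`. -/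
theorem exists_constant_quermassintegral (n i : ℕ) (hn : 3 ≤ n)
    (hi1 : 1 ≤ i) (hi2 : i ≤ n - 1)
    (Φ : Body n → Body n) (hΦ : IsMinkValHom i Φ) (hSO : IsSOEquivariant Φ)
    (hnt : ∃ K : Body n, Φ K ≠ 0) :
    ∃ r : ℝ, 0 < r ∧ ∀ K : Body n, quer (n - 1) (Φ K) = r * quer (n - i) K := by
  open Hadwiger MeasureTheory in
  have hfin : Module.finrank ℝ (En n) = n := finrank_euclideanSpace_fin
  have hn1 : 1 ≤ n := by omega
  have hi : i ≤ n := by omega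
  obtain ⟨r, hr⟩ := (invVal_querSet (volume : Measure (En n)) n i).proportional
    (invVal_querSet_comp hn1 hΦ hSO) hi1 (by omega)
    (fun K hK => querSet_two_smul volume hfin hi hK) (querSet_comp_two_smul hn1 hΦ)
    (CC.closedBall 0 1) (querSet_unitBall_pos volume hfin hi).ne'
  have hr' : ∀ K : Body n, querSet volume n 1 (Φ K : Set (En n)) =
      r * querSet volume n i (K : Set (En n)) := fun K => by
    rw [← hr _ (CC.coe K), extendBody_coe]
  refine ⟨r, lt_of_le_of_ne ?_ fun h0 => ?_, fun K => ?_⟩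
  · refine nonneg_of_mul_nonneg_left ?_ (querSet_unitBall_pos (volume : Measure (En n)) hfin hi)
    exact hr' (unitB n) ▸ querSet_one_nonneg volume hfin hn1 (CC.coe _) (Φ _).nonempty
  · have hp : ∀ K, (Φ K : Set (En n)) = {(Φ K).nonempty.some} := fun K =>
      eq_singleton_of_querSet_one_eq_zero volume hfin (by omega) (CC.coe _)
        (Φ K).nonempty.some_mem (by rw [hr', ← h0, zero_mul])
    obtain ⟨K, hK⟩ := hnt
    refine hK (ConvexBody.ext ?_)
    have h := (vecVal_of_singleton hΦ hSO hp).eq_zero (by omega) (CC.coe K)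
    rw [extendBody_coe] at h
    rw [hp, h]
    rfl
  · rw [quer_eq_querSet hn1 hn1, quer_eq_querSet hn1 hi, hr']
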